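/- arXiv:2201.01512 — 4 statements merged into one kernel-verified Lean document; each statement's English description precedes it below -/
import Mathlib

section
/- Let J satisfy (K1), (K2) and the expansion (K3) with 0 < β < 2 and a > 0, let f satisfy Assumption (F), and set r⁺ := sup_{u∈(θ,1]} f(u)/(u−θ). Let C > 0 be a constant such that for every i ≥ 1 one has L^β · R_i(L) → i·a·C as L → ∞. Then liminf_{ε→0⁺} ε^{1/β} · L_ε^ext ≥ (θ·a·C·e^{−1}/r⁺)^{1/β} > 0. -/
open MeasureTheory Filter Set Asymptotics

noncomputable section

/-- `convIter J n` is the (n+1)-fold convolution `J^{*(n+1)}` of `J` with itself: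
`convIter J 0 = J` and `convIter J (n+1) = J ∗ convIter J n`. -/
def convIter (J : ℝ → ℝ) : ℕ → ℝ → ℝ
  | 0 => J
  | n + 1 => fun x => ∫ y, J y * convIter J n (x - y)

/-- `tailR J n L = R_{n+1}(L) = ∫_{|x| ≥ L} J^{*(n+1)}(x) dx`, the tail of the
`(n+1)`-fold convolution of `J`. -/
def tailR (J : ℝ → ℝ) (n : ℕ) (L : ℝ) : ℝ :=
  ∫ x in {x : ℝ | L ≤ |x|}, convIter J n x

/-- The step initial datum `φ(x) = h · 1_{(-L,L)}(x)`. -/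
def stepInit (h L : ℝ) : ℝ → ℝ :=
  Set.indicator (Set.Ioo (-L) L) (fun _ => h)

/-- Assumption (K1): `J` is nonnegative, even, integrable, of total mass 1. -/
def K1 (J : ℝ → ℝ) : Prop :=
  (∀ x, 0 ≤ J x) ∧ (∀ x, J (-x) = J x) ∧ Integrable J ∧ (∫ x, J x) = 1

/-- `u` is a bounded solution of `∂ₜ u = ∫ J(y)(u(t,x-y) - u(t,x)) dy + f(u)` for `t > 0`,
with initial datum `u0`. -/
def IsBddSol (J f : ℝ → ℝ) (u0 : ℝ → ℝ) (u : ℝ → ℝ → ℝ) : Prop :=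
  (∃ M, ∀ t x, 0 ≤ t → |u t x| ≤ M) ∧
  (∀ t, 0 ≤ t → Measurable fun x => u t x) ∧
  (∀ x, ContinuousOn (fun t => u t x) (Set.Ici 0)) ∧
  (∀ x, u 0 x = u0 x) ∧
  (∀ t x, 0 < t → HasDerivAt (fun s => u s x)
    ((∫ y, J y * (u t (x - y) - u t x)) + f (u t x)) t)

/-- Extinction at large times: `sup_x u(t,x) → 0` as `t → ∞`. -/
def Extinct (u : ℝ → ℝ → ℝ) : Prop :=
  Tendsto (fun t => ⨆ x, u t x) atTop (nhds 0)

/-- Propagation: `u(t,x) → 1` as `t → ∞`, locally uniformly in `x`. -/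
def Propagates (u : ℝ → ℝ → ℝ) : Prop :=
  TendstoLocallyUniformly (fun t x => u t x) (fun _ => (1 : ℝ)) atTop

/-- Assumption (F): `f` is Lipschitz, vanishes at `0, θ, 1`, positive on `(θ,1)`,
bistable (with positive integral) or ignition, and `f(u) ≥ rm (u - θ)` on `[0, δ]`. -/
def AssumptionF (f : ℝ → ℝ) (θ rm δ : ℝ) : Prop :=
  (∃ C : ℝ, 0 ≤ C ∧ ∀ u v : ℝ, |f u - f v| ≤ C * |u - v|) ∧
  f 0 = 0 ∧ f θ = 0 ∧ f 1 = 0 ∧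
  (∀ u ∈ Set.Ioo θ 1, 0 < f u) ∧
  (((∀ u ∈ Set.Ioo 0 θ, f u < 0) ∧ 0 < ∫ s in (0:ℝ)..1, f s) ∨
    (∀ u ∈ Set.Ioo 0 θ, f u = 0)) ∧
  0 < rm ∧ δ ∈ Set.Ioo θ 1 ∧
  (∀ u ∈ Set.Icc 0 δ, rm * (u - θ) ≤ f u)

/-- Assumption (K3): the Fourier transform of `J` satisfies
`Ĵ(ξ) = 1 - a |ξ|^β + o(|ξ|^β)` as `ξ → 0`. -/
def K3 (J : ℝ → ℝ) (a β : ℝ) : Prop :=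
  (fun ξ : ℝ => (∫ x : ℝ, Complex.exp (-((ξ : ℂ) * (x : ℂ)) * Complex.I) * (J x : ℂ))
      - ((1 - a * |ξ| ^ β : ℝ) : ℂ))
    =o[nhds (0:ℝ)] (fun ξ : ℝ => |ξ| ^ β)

theorem ext_cp (t0 T K M : ℝ) (hK : 0 < K) (w w' : ℝ → ℝ → ℝ)
    (hM : ∀ t ∈ Icc t0 T, ∀ x, w t x ≤ M)
    (hc : ∀ x, ContinuousOn (fun t => w t x) (Icc t0 T))
    (h0 : ∀ x, w t0 x ≤ 0)
    (hd : ∀ t ∈ Ioc t0 T, ∀ x, HasDerivAt (fun s => w s x) (w' t x) t)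
    (hw : ∀ t ∈ Ioc t0 T, ∀ x B, (∀ y, w t y ≤ B) → 0 < w t x → w' t x ≤ K * B) :
    ∀ t ∈ Icc t0 T, ∀ x, w t x ≤ 0 := by
  have step : ∀ B : ℝ, 0 < B → (∀ t ∈ Icc t0 T, ∀ x, w t x ≤ B * Real.exp (2 * K * (t - t0))) →
      ∀ t ∈ Icc t0 T, ∀ x, w t x ≤ (3/4 * B) * Real.exp (2 * K * (t - t0)) := by
    intro B hB hb t ht x
    rcases eq_or_lt_of_le ht.1 with h | h
    · subst h
      exact (h0 x).trans (by positivity)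
    set g : ℝ → ℝ := fun s => (3/4 * B) * Real.exp (2 * K * (s - t0)) with hg
    have hgd : ∀ s, HasDerivAt g (3/2 * K * B * Real.exp (2 * K * (s - t0))) s := by
      intro s
      have h1 : HasDerivAt (fun s => 2 * K * (s - t0)) (2 * K) s := by
        simpa using ((hasDerivAt_id s).sub_const t0).const_mul (2 * K)
      have h2 := (h1.exp).const_mul (3/4 * B)
      exact h2.congr_deriv (by ring)
    have hgc : Continuous g := continuous_iff_continuousAt.2 fun s => (hgd s).continuousAt
    have hcx := hc x
    have ev : ∀ᶠ s in nhdsWithin t0 (Ioi t0), w s x < g s ∧ s < t := by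
      have c1 : Tendsto (fun s => w s x) (nhdsWithin t0 (Ioi t0)) (nhds (w t0 x)) := by
        have := hcx t0 ⟨le_rfl, ht.1.trans ht.2⟩
        have h3 : Tendsto (fun s => w s x) (nhdsWithin t0 (Ioc t0 T)) (nhds (w t0 x)) :=
          this.mono_left (nhdsWithin_mono _ Ioc_subset_Icc_self)
        rwa [nhdsWithin_Ioc_eq_nhdsGT (h.trans_le ht.2)] at h3
      have c2 : Tendsto g (nhdsWithin t0 (Ioi t0)) (nhds (g t0)) :=
        (hgc.tendsto t0).mono_left nhdsWithin_le_nhds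
      have hlt : w t0 x < g t0 := (h0 x).trans_lt (by simp only [hg]; positivity)
      exact (c1.eventually_lt c2 hlt).and (mem_nhdsWithin_of_mem_nhds (Iio_mem_nhds h))
    obtain ⟨s0, ⟨hs1, hs2⟩, hs3⟩ := (ev.and self_mem_nhdsWithin).exists
    have hs3 : t0 < s0 := hs3
    refine image_le_of_deriv_right_lt_deriv_boundary (f := fun s => w s x)
      (f' := fun s => w' s x) (a := s0) (b := t) (B := g) ?_ ?_ hs1.le hgd ?_ ⟨hs2.le, le_rfl⟩
    · exact hcx.mono (Icc_subset_Icc hs3.le ht.2)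
    · intro s hs
      exact (hd s ⟨hs3.trans_le hs.1, hs.2.le.trans ht.2⟩ x).hasDerivWithinAt
    · intro s hs he
      have he : w s x = g s := he
      have hmem : s ∈ Ioc t0 T := ⟨hs3.trans_le hs.1, hs.2.le.trans ht.2⟩
      have := hw s hmem x _ (hb s (Ioc_subset_Icc_self hmem)) (by rw [he]; simp only [hg]; positivity)
      have hp : 0 < K * B * Real.exp (2 * K * (s - t0)) := by positivity
      nlinarith
  have hn : ∀ n : ℕ, ∀ t ∈ Icc t0 T, ∀ x,
      w t x ≤ ((3/4)^n * max M 1) * Real.exp (2 * K * (t - t0)) := by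
    intro n
    have hM1 : 0 < max M 1 := lt_max_of_lt_right one_pos
    induction n with
    | zero =>
      intro t ht x
      have h1 : 1 ≤ Real.exp (2 * K * (t - t0)) :=
        Real.one_le_exp (mul_nonneg (by positivity) (sub_nonneg.2 ht.1))
      have := hM t ht x
      have h2 := le_max_left M 1
      simp only [pow_zero, one_mul]
      nlinarith
    | succ n ih =>
      intro t ht x
      have := step _ (by positivity) ih t ht x
      calc w t x ≤ _ := this
        _ = _ := by ring
  intro t ht x
  have hl : Tendsto (fun n : ℕ => (((3/4:ℝ))^n * max M 1) * Real.exp (2 * K * (t - t0))) atTop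
      (nhds ((0 * max M 1) * Real.exp (2 * K * (t - t0)))) :=
    ((tendsto_pow_atTop_nhds_zero_of_lt_one (by norm_num) (by norm_num)).mul_const _).mul_const _
  have := ge_of_tendsto' hl (fun n => hn n t ht x)
  simpa using this

def opA (J φ : ℝ → ℝ) (x : ℝ) : ℝ := ∫ y, J y * (φ (x - y) - φ x)

theorem opA_int {J φ : ℝ → ℝ} (hJ : K1 J) (hm : Measurable φ) {M : ℝ} (hb : ∀ x, |φ x| ≤ M)
    (x : ℝ) : Integrable (fun y => J y * φ (x - y)) := by
  have := hJ.2.2.1.mul_bdd (g := fun y => φ (x - y)) (c := M)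
    ((hm.comp (measurable_const.sub measurable_id)).aestronglyMeasurable)
    (ae_of_all _ fun y => by simpa using hb (x - y))
  exact this

theorem opA_int' {J φ : ℝ → ℝ} (hJ : K1 J) (hm : Measurable φ) {M : ℝ} (hb : ∀ x, |φ x| ≤ M)
    (x : ℝ) : Integrable (fun y => J y * (φ (x - y) - φ x)) := by
  have := (opA_int hJ hm hb x).sub (hJ.2.2.1.mul_const (φ x))
  refine this.congr (ae_of_all _ fun y => ?_)
  simp [mul_sub]

theorem opA_eq {J φ : ℝ → ℝ} (hJ : K1 J) (hm : Measurable φ) {M : ℝ} (hb : ∀ x, |φ x| ≤ M)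
    (x : ℝ) : opA J φ x = (∫ y, J y * φ (x - y)) - φ x := by
  unfold opA
  have : ∀ y, J y * (φ (x - y) - φ x) = J y * φ (x - y) - J y * φ x := fun y => mul_sub _ _ _
  simp_rw [this]
  rw [integral_sub (opA_int hJ hm hb x) (hJ.2.2.1.mul_const _), integral_mul_const, hJ.2.2.2,
    one_mul]

theorem opA_le {J φ : ℝ → ℝ} (hJ : K1 J) (hm : Measurable φ) {M : ℝ} (hb : ∀ x, |φ x| ≤ M)
    {B : ℝ} (hB : ∀ x, φ x ≤ B) (x : ℝ) : opA J φ x ≤ B - φ x := by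
  rw [opA_eq hJ hm hb]
  have : ∫ y, J y * φ (x - y) ≤ ∫ y, J y * B :=
    integral_mono (opA_int hJ hm hb x) (hJ.2.2.1.mul_const _)
      (fun y => mul_le_mul_of_nonneg_left (hB _) (hJ.1 y))
  rw [integral_mul_const, hJ.2.2.2, one_mul] at this
  linarith

theorem opA_sub {J φ ψ : ℝ → ℝ} (hJ : K1 J) (hm : Measurable φ) {M : ℝ} (hb : ∀ x, |φ x| ≤ M)
    (hm' : Measurable ψ) {M' : ℝ} (hb' : ∀ x, |ψ x| ≤ M') (x : ℝ) :
    opA J φ x = opA J (fun x => φ x - ψ x) x + opA J ψ x := by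
  have h3 : ∀ x, |φ x - ψ x| ≤ M + M' := fun x =>
    (abs_sub _ _).trans (add_le_add (hb x) (hb' x))
  unfold opA
  rw [← integral_add (opA_int' (φ := fun x => φ x - ψ x) hJ (hm.sub hm') h3 x) (opA_int' hJ hm' hb' x)]
  congr 1
  ext y
  ring

/-- comparison of a solution with a supersolution -/
theorem ext_super {J f u0 : ℝ → ℝ} {u : ℝ → ℝ → ℝ} (hJ : K1 J) (hu : IsBddSol J f u0 u)
    (t0 T K : ℝ) (ht0 : 0 ≤ t0) (hK : 0 ≤ K) (z z' : ℝ → ℝ → ℝ) (Mz : ℝ)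
    (hzb : ∀ t ∈ Icc t0 T, ∀ x, |z t x| ≤ Mz)
    (hzm : ∀ t ∈ Icc t0 T, Measurable (z t))
    (hzd : ∀ t ∈ Icc t0 T, ∀ x, HasDerivAt (fun s => z s x) (z' t x) t)
    (h0 : ∀ x, u t0 x ≤ z t0 x)
    (hz : ∀ t ∈ Ioc t0 T, ∀ x, z t x < u t x →
      opA J (z t) x + f (u t x) - z' t x ≤ K * (u t x - z t x)) :
    ∀ t ∈ Icc t0 T, ∀ x, u t x ≤ z t x := by
  obtain ⟨⟨M, hM⟩, hum, huc, -, hud⟩ := hu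
  have key := ext_cp t0 T (K + 1) (M + Mz) (by positivity) (fun t x => u t x - z t x)
    (fun t x => opA J (u t) x + f (u t x) - z' t x) ?_ ?_ ?_ ?_ ?_
  · intro t ht x
    have := key t ht x
    linarith
  · intro t ht x
    have h1 := hM t x (ht0.trans ht.1)
    have h2 := hzb t ht x
    rw [abs_le] at h1 h2
    linarith
  · intro x
    refine ((huc x).mono fun s hs => ht0.trans hs.1).sub ?_
    exact fun s hs => (hzd s hs x).continuousAt.continuousWithinAt
  · intro x
    have := h0 x
    linarith
  · intro t ht x
    exact (hud t x (ht0.trans_lt ht.1)).sub (hzd t (Ioc_subset_Icc_self ht) x)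
  · intro t ht x B hB hpos
    have htI := Ioc_subset_Icc_self ht
    have htp : 0 ≤ t := ht0.trans htI.1
    have h1 := opA_sub hJ (hum t htp) (fun x => hM t x htp) (hzm t htI) (hzb t htI) x
    have h2 := opA_le (φ := fun x => u t x - z t x) hJ ((hum t htp).sub (hzm t htI))
      (M := M + Mz) (fun x => (abs_sub _ _).trans (add_le_add (hM t x htp) (hzb t htI x))) hB x
    have h3 := hz t ht x (by linarith)
    have h4 := hB x
    have h5 : K * (u t x - z t x) ≤ K * B := mul_le_mul_of_nonneg_left h4 hK
    have h6 : opA J (u t) x = opA J (fun x => u t x) x := rfl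
    have hpos' : 0 < u t x - z t x := hpos
    have h4' : u t x - z t x ≤ B := h4
    show opA J (u t) x + f (u t x) - z' t x ≤ (K + 1) * B
    nlinarith

theorem ext_nonneg {J f u0 : ℝ → ℝ} {u : ℝ → ℝ → ℝ} (hJ : K1 J) (hu : IsBddSol J f u0 u)
    (hu0 : ∀ x, 0 ≤ u0 x) {Cf : ℝ} (hCf : 0 ≤ Cf) (hf : ∀ u v : ℝ, |f u - f v| ≤ Cf * |u - v|)
    (hf0 : f 0 = 0) : ∀ t x, 0 ≤ t → 0 ≤ u t x := by
  intro T x0 hT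
  obtain ⟨⟨M, hM⟩, hum, huc, hi, hud⟩ := hu
  have key := ext_cp 0 T (Cf + 1) M (by positivity) (fun t x => - u t x)
    (fun t x => - (opA J (u t) x + f (u t x))) ?_ ?_ ?_ ?_ ?_
  · have := key T ⟨hT, le_rfl⟩ x0
    linarith
  · intro t ht x
    have h1 := hM t x ht.1
    rw [abs_le] at h1
    linarith
  · intro x
    exact ((huc x).mono fun s hs => hs.1).neg
  · intro x
    have := hu0 x
    rw [hi]
    linarith
  · intro t ht x
    exact (hud t x ht.1).neg
  · intro t ht x B hB hpos
    have htp : 0 ≤ t := ht.1.le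
    have h2 := opA_le (φ := fun x => - u t x) hJ ((hum t htp).neg)
      (M := M) (fun x => by rw [abs_neg]; exact hM t x htp) hB x
    have h1 : opA J (fun x => - u t x) x = - opA J (u t) x := by
      unfold opA
      rw [← integral_neg]
      congr 1
      ext y
      ring
    have h4 := hB x
    have h3 := hf (u t x) 0
    have hpos' : 0 < - u t x := hpos
    rw [hf0, sub_zero, sub_zero, abs_of_neg (by linarith : u t x < 0)] at h3
    have h5 := neg_abs_le (f (u t x))
    have h6 : Cf * (- u t x) ≤ Cf * B := mul_le_mul_of_nonneg_left h4 hCf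
    show - (opA J (u t) x + f (u t x)) ≤ (Cf + 1) * B
    nlinarith

theorem tailR_zero (J : ℝ → ℝ) (L : ℝ) : tailR J 0 L = ∫ x in {x : ℝ | L ≤ |x|}, J x := rfl

theorem meas_tail (L : ℝ) : MeasurableSet {x : ℝ | L ≤ |x|} :=
  measurableSet_le measurable_const measurable_id.abs

theorem tail_nonneg {J : ℝ → ℝ} (hJ : K1 J) (L : ℝ) : 0 ≤ tailR J 0 L :=
  integral_nonneg fun x => hJ.1 x

theorem tail_tendsto {J : ℝ → ℝ} {β c : ℝ} (hβ : 0 < β)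
    (h : Tendsto (fun L : ℝ => L ^ β * tailR J 0 L) atTop (nhds c)) :
    Tendsto (fun L : ℝ => tailR J 0 L) atTop (nhds 0) := by
  have h1 := (tendsto_rpow_neg_atTop hβ).mul h
  rw [zero_mul] at h1
  refine h1.congr' ?_
  filter_upwards [eventually_gt_atTop 0] with L hL
  rw [← mul_assoc, ← Real.rpow_add hL]
  simp

theorem uni_nonneg {J : ℝ → ℝ} (hJ : K1 J) (hK2 : AntitoneOn J (Set.Ioi 0)) {L x : ℝ}
    (hL : 0 < L) (hx : 0 ≤ x) :
    ∫ y in (x - L)..(x + L), J y ≤ ∫ y in (-L)..L, J y := by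
  have hi : ∀ a b, IntervalIntegrable J volume a b := fun a b => hJ.2.2.1.intervalIntegrable
  have e1 : ∫ y in (x - L)..(x + L), J y
      = (∫ y in (x - L)..L, J y) + ∫ y in L..(x + L), J y :=
    (intervalIntegral.integral_add_adjacent_intervals (hi _ _) (hi _ _)).symm
  have e2 : ∫ y in (-L)..L, J y = (∫ y in (-L)..(x - L), J y) + ∫ y in (x - L)..L, J y :=
    (intervalIntegral.integral_add_adjacent_intervals (hi _ _) (hi _ _)).symm
  have e3 : ∫ y in L..(x + L), J (y - 2 * L) = ∫ y in (-L)..(x - L), J y := by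
    rw [intervalIntegral.integral_comp_sub_right]
    congr 1 <;> ring
  have e4 : ∫ y in L..(x + L), J y ≤ ∫ y in L..(x + L), J (y - 2 * L) := by
    refine intervalIntegral.integral_mono_ae_restrict (by linarith) (hi _ _)
      ((hJ.2.2.1.comp_sub_right (2 * L)).intervalIntegrable) ?_
    have hne : ∀ᵐ y ∂(volume.restrict (Icc L (x + L))), y ≠ 2 * L :=
      ae_restrict_of_ae (Measure.ae_ne volume (2 * L))
    filter_upwards [ae_restrict_mem measurableSet_Icc, hne] with y hy hy2
    have hy1 : L ≤ y := hy.1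
    have hab : J (y - 2 * L) = J |y - 2 * L| := by
      rcases abs_choice (y - 2 * L) with h | h <;> rw [h]
      exact (hJ.2.1 _).symm
    rw [hab]
    refine hK2 (abs_pos.2 (sub_ne_zero.2 hy2)) (hL.trans_le hy1) ?_
    rw [abs_le]
    constructor <;> linarith
  linarith

theorem uni_all {J : ℝ → ℝ} (hJ : K1 J) (hK2 : AntitoneOn J (Set.Ioi 0)) {L : ℝ}
    (hL : 0 < L) (x : ℝ) :
    ∫ y in {y | |x - y| < L}, J y ≤ 1 - tailR J 0 L := by
  have h1 : ∫ y in (x - L)..(x + L), J y ≤ ∫ y in (-L)..L, J y := by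
    rcases le_total 0 x with hx | hx
    · exact uni_nonneg hJ hK2 hL hx
    · have := uni_nonneg hJ hK2 hL (neg_nonneg.2 hx)
      have e : ∫ y in (x - L)..(x + L), J (-y) = ∫ y in (-x - L)..(-x + L), J y := by
        rw [intervalIntegral.integral_comp_neg]
        congr 1 <;> ring
      simp_rw [hJ.2.1] at e
      rw [e]
      exact this
  have s1 : {y | |x - y| < L} = Ioo (x - L) (x + L) := by
    ext y
    simp only [mem_ofPred_eq, mem_Ioo, abs_lt]
    constructor <;> rintro ⟨h, h'⟩ <;> constructor <;> linarith
  have s2 : {x : ℝ | L ≤ |x|}ᶜ = Ioo (-L) L := by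
    ext y
    simp only [mem_compl_iff, mem_ofPred_eq, mem_Ioo, not_le, abs_lt]
  have h2 := integral_add_compl (meas_tail L) hJ.2.2.1
  rw [s2, hJ.2.2.2, ← tailR_zero] at h2
  rw [s1, ← integral_Ioc_eq_integral_Ioo, ← intervalIntegral.integral_of_le (by linarith)]
  rw [← integral_Ioc_eq_integral_Ioo, ← intervalIntegral.integral_of_le (by linarith)] at h2
  linarith

theorem conv_bound {J φ : ℝ → ℝ} (hJ : K1 J) (hK2 : AntitoneOn J (Set.Ioi 0)) {L : ℝ}
    (hL : 0 < L) (hm : Measurable φ) {M : ℝ} (hb : ∀ x, |φ x| ≤ M) {P σ : ℝ} (hP : ∀ x, φ x ≤ P)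
    (hσ : ∀ x, L ≤ |x| → φ x ≤ σ) (hPσ : σ ≤ P) (x : ℝ) :
    ∫ y, J y * φ (x - y) ≤ σ + (P - σ) * (1 - tailR J 0 L) := by
  have hms : MeasurableSet {y | |x - y| < L} :=
    measurableSet_lt ((measurable_const.sub measurable_id).abs) measurable_const
  have hi2 : Integrable ({y | |x - y| < L}.indicator J) := hJ.2.2.1.indicator hms
  have h1 : ∫ y, J y * φ (x - y) ≤
      ∫ y, (J y * σ + (P - σ) * {y | |x - y| < L}.indicator J y) := by
    refine integral_mono (opA_int hJ hm hb x) ((hJ.2.2.1.mul_const _).add (hi2.const_mul _)) ?_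
    intro y
    have hJy := hJ.1 y
    by_cases h : |x - y| < L
    · have : ({y | |x - y| < L}.indicator J y) = J y := indicator_of_mem (by exact h) _
      simp only [this]
      nlinarith [mul_le_mul_of_nonneg_left (hP (x - y)) hJy]
    · have : ({y | |x - y| < L}.indicator J y) = 0 := indicator_of_notMem (by exact h) _
      simp only [this]
      nlinarith [mul_le_mul_of_nonneg_left (hσ (x - y) (not_lt.1 h)) hJy]
  rw [integral_add (hJ.2.2.1.mul_const _) (hi2.const_mul _), integral_mul_const, hJ.2.2.2,
    integral_const_mul, integral_indicator hms, one_mul] at h1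
  have := mul_le_mul_of_nonneg_left (uni_all hJ hK2 hL x) (sub_nonneg.2 hPσ)
  linarith

def psiF (L l x : ℝ) : ℝ := max 0 (min 1 ((L + l - |x|) / l))

theorem psiF_nonneg (L l x : ℝ) : 0 ≤ psiF L l x := le_max_left _ _
theorem psiF_le (L l x : ℝ) : psiF L l x ≤ 1 := max_le zero_le_one (min_le_left _ _)
theorem psiF_abs (L l x : ℝ) : |psiF L l x| ≤ 1 := by
  rw [abs_of_nonneg (psiF_nonneg _ _ _)]
  exact psiF_le _ _ _
theorem psiF_meas (L l : ℝ) : Measurable (psiF L l) := by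
  have : Continuous (psiF L l) := by
    unfold psiF
    fun_prop
  exact this.measurable
theorem psiF_one {L l x : ℝ} (hl : 0 < l) (hx : |x| ≤ L) : psiF L l x = 1 := by
  have : 1 ≤ (L + l - |x|) / l := by
    rw [le_div_iff₀ hl]
    linarith
  simp [psiF, this]
theorem psiF_zero {L l x : ℝ} (hl : 0 < l) (hx : L + l ≤ |x|) : psiF L l x = 0 := by
  have : (L + l - |x|) / l ≤ 0 := div_nonpos_of_nonpos_of_nonneg (by linarith) hl.le
  exact max_eq_left ((min_le_right _ _).trans this)
theorem psiF_lip {L l : ℝ} (hl : 0 < l) (x y : ℝ) : psiF L l (x - y) ≤ psiF L l x + |y| / l := by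
  have h1 : (L + l - |x - y|) / l ≤ (L + l - |x|) / l + |y| / l := by
    rw [← add_div]
    refine div_le_div_of_nonneg_right ?_ hl.le
    have := abs_add_le (x - y) y
    simp only [sub_add_cancel] at this
    linarith
  have h2 : 0 ≤ |y| / l := by positivity
  unfold psiF
  refine max_le (add_nonneg (le_max_left _ _) h2) ?_
  rcases min_cases 1 ((L + l - |x|) / l) with ⟨h, _⟩ | ⟨h, _⟩
  · refine (min_le_left _ _).trans ?_
    have := le_max_right 0 (min 1 ((L + l - |x|) / l))
    rw [h] at this ⊢
    linarith
  · refine (min_le_right _ _).trans (h1.trans ?_)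
    have := le_max_right 0 (min 1 ((L + l - |x|) / l))
    rw [h] at this ⊢
    linarith

theorem psiF_op {J : ℝ → ℝ} (hJ : K1 J)
    (ht : Tendsto (fun L : ℝ => tailR J 0 L) atTop (nhds 0)) {η : ℝ} (hη : 0 < η) :
    ∃ l0 : ℝ, 0 < l0 ∧ ∀ l, l0 ≤ l → ∀ L x, opA J (psiF L l) x ≤ η := by
  have h1 := (ht.comp (tendsto_id.const_mul_atTop (half_pos hη))).eventually
    (gt_mem_nhds (half_pos hη))
  obtain ⟨l1, hl1⟩ := eventually_atTop.1 h1
  refine ⟨max l1 1, lt_max_of_lt_right one_pos, fun l hl L x => ?_⟩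
  have hlp : 0 < l := one_pos.trans_le ((le_max_right _ _).trans hl)
  have hR : tailR J 0 (η / 2 * l) < η / 2 := hl1 l ((le_max_left _ _).trans hl)
  have hms := meas_tail (η / 2 * l)
  have hi2 : Integrable ({y : ℝ | η / 2 * l ≤ |y|}.indicator J) := hJ.2.2.1.indicator hms
  have h2 : opA J (psiF L l) x ≤
      ∫ y, (J y * (η / 2) + {y : ℝ | η / 2 * l ≤ |y|}.indicator J y) := by
    refine integral_mono (opA_int' hJ (psiF_meas L l) (psiF_abs L l) x)
      ((hJ.2.2.1.mul_const _).add hi2) ?_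
    intro y
    have hJy := hJ.1 y
    by_cases h : η / 2 * l ≤ |y|
    · have e : ({y : ℝ | η / 2 * l ≤ |y|}.indicator J y) = J y := indicator_of_mem (by exact h) _
      simp only [e]
      have : psiF L l (x - y) - psiF L l x ≤ 1 := by
        linarith [psiF_le L l (x - y), psiF_nonneg L l x]
      nlinarith [mul_le_mul_of_nonneg_left this hJy]
    · have e : ({y : ℝ | η / 2 * l ≤ |y|}.indicator J y) = 0 :=
        indicator_of_notMem (by exact h) _
      simp only [e, add_zero]
      refine mul_le_mul_of_nonneg_left ?_ hJy
      have h3 := psiF_lip (L := L) hlp x y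
      have : |y| / l ≤ η / 2 := by
        rw [div_le_iff₀ hlp]
        exact (not_le.1 h).le
      linarith
  rw [integral_add (hJ.2.2.1.mul_const _) hi2, integral_mul_const, hJ.2.2.2,
    integral_indicator hms, one_mul, ← tailR_zero] at h2
  linarith

theorem opA_const (J : ℝ → ℝ) (c x : ℝ) : opA J (fun _ => c) x = 0 := by
  simp [opA]

theorem opA_const_mul (J φ : ℝ → ℝ) (c d x : ℝ) :
    opA J (fun x => c * (φ x + d)) x = c * opA J φ x := by
  unfold opA
  rw [← integral_const_mul]
  congr 1
  ext y
  ring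

theorem ext_stepA {J f : ℝ → ℝ} {u : ℝ → ℝ → ℝ} (hJ : K1 J) {h L l η r : ℝ}
    (hu : IsBddSol J f (stepInit h L) u) (hh : h ≤ 1) (hl : 0 < l) (hr : 0 ≤ r) (hη0 : 0 ≤ η)
    (hη : ∀ x, opA J (psiF L l) x ≤ η)
    (hf : ∀ t x, 0 ≤ t → f (u t x) ≤ r * u t x) :
    ∀ t x, 0 ≤ t → u t x ≤ Real.exp (r * t) * (psiF L l x + η * t) := by
  intro T x0 hT
  refine ext_super hJ hu 0 T r le_rfl hr
    (fun t x => Real.exp (r * t) * (psiF L l x + η * t))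
    (fun t x => r * (Real.exp (r * t) * (psiF L l x + η * t)) + Real.exp (r * t) * η)
    (Real.exp (r * T) * (1 + η * T)) ?_ ?_ ?_ ?_ ?_ T ⟨hT, le_rfl⟩ x0
  · intro t ht x
    have := psiF_nonneg L l x
    have ht0 := ht.1
    rw [abs_of_nonneg (by positivity)]
    have := psiF_le L l x
    have ht1 := ht.2
    gcongr
  · intro t ht
    exact ((psiF_meas L l).add_const _).const_mul _
  · intro t ht x
    have h1 : HasDerivAt (fun s => r * s) r t := by
      simpa using (hasDerivAt_id t).const_mul r
    have h2 : HasDerivAt (fun s => psiF L l x + η * s) η t := by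
      simpa using ((hasDerivAt_id t).const_mul η).const_add (psiF L l x)
    exact (h1.exp.mul h2).congr_deriv (by ring)
  · intro x
    rw [hu.2.2.2.1]
    simp only [mul_zero, Real.exp_zero, add_zero, one_mul, stepInit]
    by_cases hx : x ∈ Ioo (-L) L
    · rw [indicator_of_mem hx, psiF_one hl (abs_le.2 ⟨hx.1.le, hx.2.le⟩)]
      exact hh
    · rw [indicator_of_notMem hx]
      exact psiF_nonneg _ _ _
  · intro t ht x hx
    rw [opA_const_mul]
    have h1 := hf t x ht.1.le
    have h2 := mul_le_mul_of_nonneg_left (hη x) (Real.exp_pos (r * t)).le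
    linarith

theorem ext_stepB {J f u0 : ℝ → ℝ} {u : ℝ → ℝ → ℝ} (hJ : K1 J)
    (hK2 : AntitoneOn J (Set.Ioi 0)) {L σ θ ε r T : ℝ}
    (hu : IsBddSol J f u0 u) (hL : 0 < L) (hr : 0 < r) (hσθ : 2 * σ ≤ θ) (hε : 0 ≤ ε)
    (hf : ∀ t x, 0 ≤ t → f (u t x) ≤ r * max 0 (u t x - θ))
    (hσ : ∀ t ∈ Icc 0 T, ∀ x, L ≤ |x| → u t x ≤ σ)
    (hRT : (θ - 2 * σ) * tailR J 0 L * T ≤ σ)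
    (hi : ∀ x, u 0 x ≤ θ + ε) :
    ∀ t ∈ Icc 0 T, ∀ x,
      u t x ≤ θ + ε * Real.exp (r * t) - (θ - 2 * σ) * tailR J 0 L * t := by
  obtain ⟨⟨M, hM⟩, hum, huc, -, hud⟩ := hu
  have hR := tail_nonneg hJ L
  set R := tailR J 0 L with hRd
  set m : ℝ → ℝ := fun t => θ + ε * Real.exp (r * t) - (θ - 2 * σ) * R * t with hm
  have hq : 0 ≤ (θ - 2 * σ) * R := mul_nonneg (by linarith) hR
  have hmd : ∀ t, HasDerivAt m (r * (ε * Real.exp (r * t)) - (θ - 2 * σ) * R) t := by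
    intro t
    have h1 : HasDerivAt (fun s => r * s) r t := by
      simpa using (hasDerivAt_id t).const_mul r
    have h2 : HasDerivAt (fun s => (θ - 2 * σ) * R * s) ((θ - 2 * σ) * R) t := by
      simpa using (hasDerivAt_id t).const_mul ((θ - 2 * σ) * R)
    exact (((h1.exp.const_mul ε).const_add θ).sub h2).congr_deriv (by ring)
  have hm1 : ∀ t ∈ Icc 0 T, θ - σ ≤ m t := by
    intro t ht
    have : (θ - 2 * σ) * R * t ≤ (θ - 2 * σ) * R * T := mul_le_mul_of_nonneg_left ht.2 hq
    have h2 : 0 ≤ ε * Real.exp (r * t) := by positivity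
    simp only [hm]
    linarith
  have key := ext_cp 0 T (r + 1) (M - (θ - σ)) (by positivity) (fun t x => u t x - m t)
    (fun t x => opA J (u t) x + f (u t x) - (r * (ε * Real.exp (r * t)) - (θ - 2 * σ) * R))
      ?_ ?_ ?_ ?_ ?_
  · intro t ht x
    have := key t ht x
    simp only [hm] at this
    linarith
  · intro t ht x
    have h1 := hM t x ht.1
    rw [abs_le] at h1
    have h2 := hm1 t ht
    linarith
  · intro x
    refine ((huc x).mono fun s hs => hs.1).sub ?_
    exact fun s hs => (hmd s).continuousAt.continuousWithinAt
  · intro x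
    have := hi x
    simp only [hm, mul_zero, Real.exp_zero]
    linarith
  · intro t ht x
    exact (hud t x ht.1).sub (hmd t)
  · intro t ht x B hB hpos
    have htI := Ioc_subset_Icc_self ht
    have htp : 0 ≤ t := htI.1
    have hpos' : 0 < u t x - m t := hpos
    have hBx : u t x - m t ≤ B := hB x
    have hmt := hm1 t htI
    have h1 := opA_eq hJ (hum t htp) (fun x => hM t x htp) x
    have h2 := conv_bound (σ := σ) (P := m t + B) hJ hK2 hL (hum t htp) (fun x => hM t x htp)
      (fun y => by have h : u t y - m t ≤ B := hB y
                   linarith) (hσ t htI) (by linarith) x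
    rw [← hRd] at h2
    have h3 := hf t x htp
    have h4 : max 0 (u t x - θ) ≤ ε * Real.exp (r * t) + B := by
      have h5 : 0 ≤ ε * Real.exp (r * t) := by positivity
      refine max_le (by linarith) ?_
      have h6 : m t ≤ θ + ε * Real.exp (r * t) := by
        have := mul_nonneg hq htp
        simp only [hm]
        linarith
      linarith
    have h5 := mul_le_mul_of_nonneg_left h4 hr.le
    have h6 : (θ - 2 * σ) * R ≤ (m t + B - σ) * R := mul_le_mul_of_nonneg_right (by linarith) hR
    have h7 : opA J (u t) x = opA J (fun x => u t x) x := rfl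
    show opA J (u t) x + f (u t x) - (r * (ε * Real.exp (r * t)) - (θ - 2 * σ) * R) ≤ (r + 1) * B
    linarith

def lamJ (J : ℝ → ℝ) (ξ : ℝ) : ℝ := ∫ y, J y * (1 - Real.cos (ξ * y))

theorem cos_bd (ξ : ℝ) (x : ℝ) : |Real.cos (ξ * x)| ≤ 1 := Real.abs_cos_le_one _

theorem lam_int {J : ℝ → ℝ} (hJ : K1 J) (ξ : ℝ) :
    Integrable (fun y => J y * (1 - Real.cos (ξ * y))) := by
  refine hJ.2.2.1.mul_bdd (c := 2) ?_ (ae_of_all _ fun y => ?_)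
  · exact (by fun_prop : Continuous fun y => 1 - Real.cos (ξ * y)).aestronglyMeasurable
  · rw [Real.norm_eq_abs, abs_le]
    have h1 := Real.cos_le_one (ξ * y)
    have h2 := Real.neg_one_le_cos (ξ * y)
    constructor <;> linarith

theorem lam_nonneg {J : ℝ → ℝ} (hJ : K1 J) (ξ : ℝ) : 0 ≤ lamJ J ξ :=
  integral_nonneg fun y => mul_nonneg (hJ.1 y) (sub_nonneg.2 (Real.cos_le_one _))

theorem lam_pos {J : ℝ → ℝ} (hJ : K1 J) {ξ : ℝ} (hξ : ξ ≠ 0) : 0 < lamJ J ξ := by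
  refine lt_of_le_of_ne (lam_nonneg hJ ξ) fun h => ?_
  have h1 := (integral_eq_zero_iff_of_nonneg
    (fun y => mul_nonneg (hJ.1 y) (sub_nonneg.2 (Real.cos_le_one _))) (lam_int hJ ξ)).1 h.symm
  have hcount : (range fun n : ℤ => (n : ℝ) * (2 * Real.pi) / ξ).Countable := countable_range _
  have h2 : ∀ᵐ y : ℝ, y ∉ (range fun n : ℤ => (n : ℝ) * (2 * Real.pi) / ξ) :=
    hcount.ae_notMem volume
  have h3 : J =ᵐ[volume] 0 := by
    filter_upwards [h1, h2] with y hy1 hy2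
    have hy1 : J y * (1 - Real.cos (ξ * y)) = 0 := hy1
    rcases mul_eq_zero.1 hy1 with h | h
    · exact h
    · exfalso
      have : Real.cos (ξ * y) = 1 := by linarith
      obtain ⟨n, hn⟩ := (Real.cos_eq_one_iff _).1 this
      apply hy2
      refine ⟨n, ?_⟩
      simp only
      rw [hn]
      field_simp
  have := integral_congr_ae h3
  rw [hJ.2.2.2] at this
  simp at this

theorem opA_cos {J : ℝ → ℝ} (hJ : K1 J) (ξ x : ℝ) :
    opA J (fun x => Real.cos (ξ * x)) x = - lamJ J ξ * Real.cos (ξ * x) := by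
  have hs : Integrable (fun y => J y * Real.sin (ξ * y)) := by
    refine hJ.2.2.1.mul_bdd (c := 1) ?_ (ae_of_all _ fun y => ?_)
    · exact (by fun_prop : Continuous fun y => Real.sin (ξ * y)).aestronglyMeasurable
    · exact Real.abs_sin_le_one _
  have h0 : ∫ y, J y * Real.sin (ξ * y) = 0 := by
    have := integral_neg_eq_self (fun y => J y * Real.sin (ξ * y)) volume
    simp only [hJ.2.1, mul_neg, Real.sin_neg, integral_neg] at this
    linarith
  have e : ∀ y, J y * (Real.cos (ξ * (x - y)) - Real.cos (ξ * x)) =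
      (-Real.cos (ξ * x)) * (J y * (1 - Real.cos (ξ * y)))
        + Real.sin (ξ * x) * (J y * Real.sin (ξ * y)) := by
    intro y
    rw [mul_sub ξ, Real.cos_sub]
    ring
  unfold opA
  simp_rw [e]
  rw [integral_add ((lam_int hJ ξ).const_mul _) (hs.const_mul _), integral_const_mul,
    integral_const_mul, h0, lamJ]
  ring

theorem opA_sum {J : ℝ → ℝ} (hJ : K1 J) {ι : Type} (s : Finset ι) (q c : ι → ℝ) (x : ℝ) :
    opA J (fun x => ∑ p ∈ s, Real.cos (q p * x) * c p) x
      = ∑ p ∈ s, Real.cos (q p * x) * (c p * (- lamJ J (q p))) := by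
  have h1 : ∀ p, ∫ y, J y * (Real.cos (q p * (x - y)) - Real.cos (q p * x)) =
    - lamJ J (q p) * Real.cos (q p * x) := fun p => opA_cos hJ (q p) x
  have h2 : ∀ p, Integrable (fun y => J y * (Real.cos (q p * (x - y)) - Real.cos (q p * x))) :=
    fun p => opA_int' (φ := fun x => Real.cos (q p * x)) hJ
      (by fun_prop : Continuous fun x => Real.cos (q p * x)).measurable (cos_bd (q p)) x
  have e : ∀ y, J y * ((∑ p ∈ s, Real.cos (q p * (x - y)) * c p)
      - ∑ p ∈ s, Real.cos (q p * x) * c p)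
      = ∑ p ∈ s, c p * (J y * (Real.cos (q p * (x - y)) - Real.cos (q p * x))) := by
    intro y
    rw [← Finset.sum_sub_distrib, Finset.mul_sum]
    refine Finset.sum_congr rfl fun p _ => ?_
    ring
  unfold opA
  simp_rw [e]
  rw [integral_finsetSum _ (fun p _ => (h2 p).const_mul _)]
  refine Finset.sum_congr rfl fun p _ => ?_
  rw [integral_const_mul, h1]
  ring

theorem ext_stepC {J f u0 : ℝ → ℝ} {u : ℝ → ℝ → ℝ} (hJ : K1 J)
    (hu : IsBddSol J f u0 u) {T : ℝ} (hT : 0 ≤ T)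
    (hu0 : ∀ t x, 0 ≤ t → 0 ≤ u t x) (hu1 : ∀ t x, 0 ≤ t → u t x ≤ 1)
    (hf : ∀ t x, T ≤ t → f (u t x) ≤ 0)
    (hdec : ∀ σ, 0 < σ → ∃ A, 0 < A ∧ ∀ x, A ≤ |x| → u T x ≤ σ) : Extinct u := by
  unfold Extinct
  rw [Metric.tendsto_atTop]
  intro e he
  obtain ⟨A, hA, hAu⟩ := hdec (e / 4) (by positivity)
  obtain ⟨N, hN⟩ := exists_nat_gt (8 / e)
  have hNr : (0:ℝ) < N := (by positivity : (0:ℝ) < 8 / e).trans hN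
  set ξ : ℝ := 1 / (N * A) with hξ
  have hξ0 : 0 < ξ := by positivity
  set s : Finset (ℕ × ℕ) := Finset.range N ×ˢ Finset.range N with hs
  set q : ℕ × ℕ → ℝ := fun p => ((p.1 : ℝ) - p.2) * ξ with hq
  set D : ℝ := 2 / (N:ℝ) ^ 2 with hD
  have hD0 : 0 < D := by positivity
  set S : ℝ → ℝ := fun t => ∑ p ∈ s, Real.exp (- lamJ J (q p) * (t - T)) with hS
  -- the bound
  have hb : ∀ t x, T ≤ t → u t x ≤ e / 4 + D * S t := by
    intro t1 x1 ht1
    set z : ℝ → ℝ → ℝ := fun t x =>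
      ∑ p ∈ s, Real.cos (q p * x) * Real.exp (- lamJ J (q p) * (t - T)) with hz
    set z' : ℝ → ℝ → ℝ := fun t x =>
      ∑ p ∈ s, Real.cos (q p * x) *
        (Real.exp (- lamJ J (q p) * (t - T)) * (- lamJ J (q p))) with hz'
    have hexp : ∀ t, T ≤ t → ∀ p, Real.exp (- lamJ J (q p) * (t - T)) ≤ 1 := by
      intro t ht p
      rw [Real.exp_le_one_iff]
      have := mul_nonneg (lam_nonneg hJ (q p)) (sub_nonneg.2 ht)
      linarith
    have hzS : ∀ t x, |z t x| ≤ S t := by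
      intro t x
      refine (Finset.abs_sum_le_sum_abs _ _).trans (Finset.sum_le_sum fun p _ => ?_)
      rw [abs_mul, abs_of_pos (Real.exp_pos _)]
      exact mul_le_of_le_one_left (Real.exp_pos _).le (cos_bd _ _)
    have hSs : ∀ t, T ≤ t → S t ≤ s.card := by
      intro t ht
      have := Finset.sum_le_sum (s := s) fun p _ => hexp t ht p
      simpa [hS] using this
    have main := ext_super hJ hu T t1 0 hT le_rfl (fun t x => D * (z t x + e / 4 / D))
      (fun t x => D * z' t x) (D * (s.card + e / 4 / D)) ?_ ?_ ?_ ?_ ?_ t1 ⟨ht1, le_rfl⟩ x1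
    · refine main.trans ?_
      have h1 := (le_abs_self _).trans (hzS t1 x1)
      have h2 := mul_le_mul_of_nonneg_left h1 hD0.le
      have h3 : D * (e / 4 / D) = e / 4 := by field_simp
      simp only [mul_add]
      rw [h3]
      linarith
    · intro t ht x
      rw [abs_mul, abs_of_pos hD0]
      refine mul_le_mul_of_nonneg_left ((abs_add_le _ _).trans ?_) hD0.le
      rw [abs_of_pos (by positivity : 0 < e / 4 / D)]
      have := (hzS t x).trans (hSs t ht.1)
      linarith
    · intro t ht
      have : Continuous (fun x => D * (z t x + e / 4 / D)) := by
        simp only [hz]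
        fun_prop
      exact this.measurable
    · intro t ht x
      refine HasDerivAt.const_mul D (HasDerivAt.add_const _ ?_)
      refine HasDerivAt.fun_sum fun p _ => ?_
      refine HasDerivAt.const_mul _ ?_
      have h1 : HasDerivAt (fun s => - lamJ J (q p) * (s - T)) (- lamJ J (q p)) t := by
        simpa using ((hasDerivAt_id t).sub_const T).const_mul (- lamJ J (q p))
      exact h1.exp
    · intro x
      have hzT : z T x = ∑ p ∈ s, Real.cos (q p * x) := by
        simp [hz]
      have h3 : D * (e / 4 / D) = e / 4 := by field_simp
      have hzpos : 0 ≤ z T x := by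
        have : z T x = (∑ j ∈ Finset.range N, Real.cos (j * ξ * x)) ^ 2
            + (∑ j ∈ Finset.range N, Real.sin (j * ξ * x)) ^ 2 := by
          rw [hzT, hs, Finset.sum_product, sq, sq, Finset.sum_mul_sum, Finset.sum_mul_sum,
            ← Finset.sum_add_distrib]
          refine Finset.sum_congr rfl fun j _ => ?_
          rw [← Finset.sum_add_distrib]
          refine Finset.sum_congr rfl fun k _ => ?_
          rw [← Real.cos_sub]
          congr 1
          simp only [hq]
          ring
        rw [this]
        positivity
      rcases le_or_gt A |x| with hx | hx
      · have h4 := hAu x hx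
        have h5 := mul_nonneg hD0.le hzpos
        simp only [mul_add]
        rw [h3]
        linarith
      · have h4 := hu1 T x hT
        have h6 : (N:ℝ) ^ 2 * (1 / 2) ≤ z T x := by
          have hc : (N:ℝ)^2 * (1/2) = ∑ p ∈ s, (1/2 : ℝ) := by
            rw [Finset.sum_const, hs, Finset.card_product, Finset.card_range, nsmul_eq_mul]
            push_cast
            ring
          rw [hzT, hc]
          refine Finset.sum_le_sum fun p hp => ?_
          rw [hs, Finset.mem_product, Finset.mem_range, Finset.mem_range] at hp
          have hp1 : (p.1 : ℝ) < N := by exact_mod_cast hp.1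
          have hp2 : (p.2 : ℝ) < N := by exact_mod_cast hp.2
          have hp3 : (0:ℝ) ≤ p.1 := Nat.cast_nonneg _
          have hp4 : (0:ℝ) ≤ p.2 := Nat.cast_nonneg _
          have hy : |q p * x| ≤ 1 := by
            have h7 : |(p.1 : ℝ) - p.2| ≤ N := by
              rw [abs_le]
              constructor <;> linarith
            calc |q p * x| = |(p.1 : ℝ) - p.2| * ξ * |x| := by
                  rw [abs_mul, hq, abs_mul, abs_of_pos hξ0]
              _ ≤ N * ξ * A := by gcongr
              _ = 1 := by rw [hξ]; field_simp
          have h8 := Real.one_sub_sq_div_two_le_cos (x := q p * x)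
          have h9 : (q p * x) ^ 2 ≤ 1 := (sq_le_one_iff_abs_le_one _).2 hy
          linarith
        have h7 := mul_le_mul_of_nonneg_left h6 hD0.le
        have h8 : D * ((N:ℝ) ^ 2 * (1 / 2)) = 1 := by
          rw [hD]
          field_simp
        simp only [mul_add]
        rw [h3]
        linarith
    · intro t ht x hx
      have h1 : opA J (fun x => D * (z t x + e / 4 / D)) x = D * z' t x := by
        rw [opA_const_mul, opA_sum hJ]
      rw [h1]
      have := hf t x ht.1.le
      linarith
  -- the limit
  have hlim : Tendsto S atTop (nhds (∑ p ∈ s, if p.1 = p.2 then (1:ℝ) else 0)) := by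
    refine tendsto_finsetSum _ fun p _ => ?_
    by_cases hp : p.1 = p.2
    · have : lamJ J (q p) = 0 := by simp [lamJ, hq, hp]
      simp [this, hp]
    · have hqp : q p ≠ 0 := by
        refine mul_ne_zero (sub_ne_zero.2 ?_) hξ0.ne'
        exact_mod_cast hp
      rw [if_neg hp]
      have hl := lam_pos hJ hqp
      refine Real.tendsto_exp_atBot.comp ?_
      refine Tendsto.const_mul_atTop_of_neg (by linarith) ?_
      exact tendsto_atTop_add_const_right _ _ tendsto_id
  have hval : (∑ p ∈ s, if p.1 = p.2 then (1:ℝ) else 0) = N := by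
    rw [hs, Finset.sum_product]
    simp only
    rw [Finset.sum_congr rfl (g := fun _ => (1:ℝ))]
    · simp
    · intro i hi
      rw [Finset.sum_ite_eq, if_pos hi]
  rw [hval] at hlim
  have hDN : D * N < e / 4 := by
    have : D * N = 2 / N := by rw [hD]; field_simp
    rw [this, div_lt_iff₀ hNr]
    rw [div_lt_iff₀ he] at hN
    linarith
  obtain ⟨t1, ht1⟩ := eventually_atTop.1 ((hlim.const_mul D).eventually (gt_mem_nhds hDN))
  refine ⟨max t1 T, fun t ht => ?_⟩
  have hT1 : T ≤ t := (le_max_right _ _).trans ht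
  have h1 := ht1 t ((le_max_left _ _).trans ht)
  have h2 : ⨆ x, u t x ≤ e / 2 := ciSup_le fun x => by
    have := hb t x hT1
    linarith
  have h3 : 0 ≤ ⨆ x, u t x := Real.iSup_nonneg fun x => hu0 t x (hT.trans hT1)
  rw [Real.dist_eq, sub_zero, abs_of_nonneg h3]
  linarith

/-- **Corollary (Asymptotic extinction criterion, 0 < β < 2).**
Under (K1), (K2), (K3) with `0 < β < 2`, `a > 0`, and Assumption (F), if `C > 0` is such that
`L^β R_i(L) → i a C` as `L → ∞` for every `i ≥ 1`, then
`liminf_{ε→0⁺} ε^{1/β} L_ε^ext ≥ (θ a C e^{-1} / r⁺)^{1/β} > 0`, where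
`L_ε^ext` is the supremum of the sizes `L > 0` leading to extinction.  (The liminf inequality is
stated equivalently: for every `0 < c < (θ a C e^{-1}/r⁺)^{1/β}` and every sufficiently small
`ε > 0` there is an extinction size `L ≥ c ε^{-1/β}`.) -/
theorem asymptotic_extinction_beta_lt_two
    (J f : ℝ → ℝ) (θ rm δ rp a β C : ℝ)
    (hK1 : K1 J) (hK2 : AntitoneOn J (Set.Ioi 0))
    (hβ : 0 < β) (hβ2 : β < 2) (ha : 0 < a) (hK3 : K3 J a β)
    (hθ : θ ∈ Set.Ioo (0:ℝ) 1) (hF : AssumptionF f θ rm δ)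
    (hrp : IsLUB ((fun u => f u / (u - θ)) '' Set.Ioc θ 1) rp)
    (hrp0 : 0 < rp)
    (hC : 0 < C)
    (htail : ∀ n : ℕ, Tendsto (fun L : ℝ => L ^ β * tailR J n L)
      atTop (nhds (((n : ℝ) + 1) * a * C))) :
    0 < (θ * a * C * Real.exp (-1) / rp) ^ (1/β) ∧
    ∀ c, 0 < c → c < (θ * a * C * Real.exp (-1) / rp) ^ (1/β) →
      ∀ᶠ ε in nhdsWithin 0 (Set.Ioi (0:ℝ)), ∃ L,
        c / ε ^ (1/β) ≤ L ∧ 0 < L ∧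
        ∀ u, IsBddSol J f (stepInit (θ + ε) L) u → Extinct u := by
  have hX : 0 < θ * a * C * Real.exp (-1) / rp := by
    have := hθ.1
    positivity
  refine ⟨Real.rpow_pos_of_pos hX _, fun c hc hcX => ?_⟩
  obtain ⟨⟨Cf, hCf, hLip⟩, hf0, hfθ, hf1, -, hbi, -, -, -⟩ := hF
  have hθ0 := hθ.1
  have hfneg : ∀ v, 0 ≤ v → v ≤ θ → f v ≤ 0 := by
    intro v h0 h1
    rcases eq_or_lt_of_le h0 with h | h
    · rw [← h, hf0]
    rcases eq_or_lt_of_le h1 with h' | h'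
    · rw [h', hfθ]
    rcases hbi with hb | hb
    · exact (hb.1 v ⟨h, h'⟩).le
    · exact (hb v ⟨h, h'⟩).le
  have hfr : ∀ v, 0 ≤ v → v ≤ 1 → f v ≤ rp * max 0 (v - θ) := by
    intro v h0 h1
    rcases le_or_gt v θ with h | h
    · exact (hfneg v h0 h).trans (mul_nonneg hrp0.le (le_max_left _ _))
    · have h2 : f v / (v - θ) ≤ rp := hrp.1 ⟨v, ⟨h, h1⟩, rfl⟩
      rw [div_le_iff₀ (sub_pos.2 h)] at h2
      exact h2.trans (mul_le_mul_of_nonneg_left (le_max_right _ _) hrp0.le)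
  have ht0 : Tendsto (fun L : ℝ => L ^ β * tailR J 0 L) atTop (nhds (a * C)) := by
    have := htail 0
    simpa using this
  have hR0 := tail_tendsto hβ ht0
  have hcβ : c ^ β * (Real.exp 1 * rp) < θ * (a * C) := by
    have h1 : c ^ β < θ * a * C * Real.exp (-1) / rp := by
      have := Real.rpow_lt_rpow hc.le hcX hβ
      rwa [← Real.rpow_mul hX.le, one_div, inv_mul_cancel₀ hβ.ne', Real.rpow_one] at this
    rw [lt_div_iff₀ hrp0] at h1
    have h2 : Real.exp (-1) * Real.exp 1 = 1 := by rw [← Real.exp_add]; simp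
    have h3 := mul_lt_mul_of_pos_right h1 (Real.exp_pos 1)
    calc c ^ β * (Real.exp 1 * rp) = c ^ β * rp * Real.exp 1 := by ring
      _ < _ := h3
      _ = θ * (a * C) * (Real.exp (-1) * Real.exp 1) := by ring
      _ = _ := by rw [h2, mul_one]
  -- choice of s
  obtain ⟨s, hs0, hsθ, hs⟩ : ∃ s : ℝ, 0 < s ∧ 2 * s < θ ∧
      c ^ β * (1 + s) ^ β * (Real.exp 1 * rp) < (θ - 2 * s) * (a * C) := by
    have hA : Tendsto (fun s : ℝ => c ^ β * (1 + s) ^ β * (Real.exp 1 * rp))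
        (nhdsWithin 0 (Ioi 0)) (nhds (c ^ β * (1 + 0) ^ β * (Real.exp 1 * rp))) := by
      refine Tendsto.mono_left ?_ nhdsWithin_le_nhds
      have h1 : Tendsto (fun s : ℝ => (1 + s) ^ β) (nhds 0) (nhds ((1 + 0) ^ β)) :=
        ((continuous_const.add continuous_id).tendsto 0).rpow_const (Or.inr hβ.le)
      exact (h1.const_mul _).mul_const _
    have hB : Tendsto (fun s : ℝ => (θ - 2 * s) * (a * C))
        (nhdsWithin 0 (Ioi 0)) (nhds ((θ - 2 * 0) * (a * C))) := by
      refine Tendsto.mono_left ?_ nhdsWithin_le_nhds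
      exact (by fun_prop : Continuous fun s : ℝ => (θ - 2 * s) * (a * C)).tendsto 0
    have h2 := hA.eventually_lt hB (by simpa using hcβ)
    have h3 : ∀ᶠ s in nhdsWithin (0:ℝ) (Ioi 0), s < θ / 2 :=
      mem_nhdsWithin_of_mem_nhds (Iio_mem_nhds (by positivity))
    obtain ⟨s, ⟨hs1, hs2⟩, hs3⟩ := ((h2.and h3).and self_mem_nhdsWithin).exists
    exact ⟨s, hs3, by linarith, hs1⟩
  have hT : 0 < 1 / rp := by positivity
  have hrT : rp * (1 / rp) = 1 := by field_simp
  obtain ⟨l0, hl0, hpsi⟩ := psiF_op hK1 hR0 (η := s * rp * Real.exp (-1)) (by positivity)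
  have hQ : c ^ β * (1 + s) ^ β * (Real.exp 1 * rp) / (θ - 2 * s) < a * C := by
    rw [div_lt_iff₀ (by linarith)]
    linarith
  -- eventual conditions in L'
  have hL1 : ∀ᶠ L' in atTop,
      c ^ β * (1 + s) ^ β * (Real.exp 1 * rp) / (θ - 2 * s) < L' ^ β * tailR J 0 L' :=
    ht0.eventually (lt_mem_nhds hQ)
  have hL2 : ∀ᶠ L' in atTop, (θ - 2 * s) * tailR J 0 L' * (1 / rp) < s := by
    have h := (hR0.const_mul (θ - 2 * s)).mul_const (1 / rp)
    exact h.eventually (gt_mem_nhds (by simpa using hs0))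
  have hLt : Tendsto (fun ε : ℝ => c / ε ^ (1/β)) (nhdsWithin 0 (Ioi 0)) atTop := by
    have h1 : Tendsto (fun ε : ℝ => c * (ε⁻¹) ^ (1/β)) (nhdsWithin 0 (Ioi 0)) atTop :=
      Tendsto.const_mul_atTop hc
        ((tendsto_rpow_atTop (by positivity : 0 < 1/β)).comp tendsto_inv_nhdsGT_zero)
    refine h1.congr' ?_
    filter_upwards [self_mem_nhdsWithin] with ε hε
    rw [Real.inv_rpow (le_of_lt hε), ← div_eq_mul_inv]
  have hL't := hLt.const_mul_atTop (by linarith : 0 < 1 + s)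
  have hε1 : ∀ᶠ ε in nhdsWithin (0:ℝ) (Ioi 0), ε < 1 - θ :=
    mem_nhdsWithin_of_mem_nhds (Iio_mem_nhds (by linarith [hθ.2]))
  filter_upwards [self_mem_nhdsWithin, hε1, hL't.eventually hL1, hL't.eventually hL2,
    hLt.eventually (eventually_ge_atTop (l0 / s))] with ε hε hε1 hL1 hL2 hL3
  have hε : 0 < ε := hε
  set L := c / ε ^ (1/β) with hLdef
  have hLpos : 0 < L := by positivity
  refine ⟨L, le_rfl, hLpos, fun u hu => ?_⟩
  have hL'pos : 0 < (1 + s) * L := by positivity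
  have hLβ : ((1 + s) * L) ^ β * ε = c ^ β * (1 + s) ^ β := by
    rw [Real.mul_rpow (by positivity) hLpos.le, hLdef, Real.div_rpow hc.le (by positivity),
      ← Real.rpow_mul hε.le, one_div, inv_mul_cancel₀ hβ.ne', Real.rpow_one]
    field_simp
  have hkey : ε * (Real.exp 1 * rp) < (θ - 2 * s) * tailR J 0 ((1 + s) * L) := by
    rw [div_lt_iff₀ (by linarith), ← hLβ] at hL1
    have hp : 0 < ((1 + s) * L) ^ β := by positivity
    refine lt_of_mul_lt_mul_left (a := ((1 + s) * L) ^ β) ?_ hp.le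
    linarith
  have hst : ∀ x, 0 ≤ stepInit (θ + ε) L x := fun x =>
    indicator_nonneg (fun _ _ => by positivity) x
  have hu0 := ext_nonneg hK1 hu hst hCf hLip hf0
  have hi : ∀ x, u 0 x ≤ θ + ε := by
    intro x
    rw [hu.2.2.2.1]
    exact indicator_le' (fun _ _ => le_rfl) (fun _ _ => by positivity) x
  have hcst : ∀ d t0 : ℝ, 0 ≤ t0 → f d = 0 → (∀ x, u t0 x ≤ d) → ∀ t x, t0 ≤ t → u t x ≤ d := by
    intro d t0 ht0 hd h0 t x ht
    refine ext_super hK1 hu t0 t Cf ht0 hCf (fun _ _ => d) (fun _ _ => 0) |d|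
      (fun _ _ _ => le_rfl) (fun _ _ => measurable_const) (fun _ _ _ => hasDerivAt_const _ _)
      h0 ?_ t ⟨ht, le_rfl⟩ x
    intro t ht x hx
    rw [opA_const]
    have h1 := hLip (u t x) d
    rw [hd, sub_zero, abs_of_pos (sub_pos.2 hx)] at h1
    have := le_abs_self (f (u t x))
    linarith
  have hu1 : ∀ t x, 0 ≤ t → u t x ≤ 1 :=
    hcst 1 0 le_rfl hf1 (fun x => (hi x).trans (by linarith))
  have hfu : ∀ t x, 0 ≤ t → f (u t x) ≤ rp * max 0 (u t x - θ) := fun t x ht =>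
    hfr _ (hu0 t x ht) (hu1 t x ht)
  have hfu' : ∀ t x, 0 ≤ t → f (u t x) ≤ rp * u t x := fun t x ht =>
    (hfu t x ht).trans (mul_le_mul_of_nonneg_left
      (max_le (hu0 t x ht) (by linarith)) hrp0.le)
  have hdecay : ∀ σ l : ℝ, 0 < σ → 0 < l →
      (∀ x, opA J (psiF L l) x ≤ σ * rp * Real.exp (-1)) →
      ∀ t ∈ Icc 0 (1 / rp), ∀ x, L + l ≤ |x| → u t x ≤ σ := by
    intro σ l hσ hl hop t ht x hx
    have h1 := ext_stepA hK1 hu (by linarith) hl hrp0.le (by positivity) hop hfu' t x ht.1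
    rw [psiF_zero hl hx, zero_add] at h1
    have h2 : Real.exp (rp * t) ≤ Real.exp 1 := by
      rw [Real.exp_le_exp, ← hrT]
      exact mul_le_mul_of_nonneg_left ht.2 hrp0.le
    have ht1 := ht.1
    have ht2 := ht.2
    calc u t x ≤ _ := h1
      _ ≤ Real.exp 1 * (σ * rp * Real.exp (-1) * (1 / rp)) := by gcongr
      _ = σ * (rp * (1 / rp)) * (Real.exp 1 * Real.exp (-1)) := by ring
      _ = σ := by rw [hrT, ← Real.exp_add]; simp
  have hsL : l0 ≤ s * L := by
    have := (div_le_iff₀ hs0).1 hL3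
    linarith
  have hout : ∀ t ∈ Icc 0 (1 / rp), ∀ x, (1 + s) * L ≤ |x| → u t x ≤ s := by
    intro t ht x hx
    exact hdecay s (s * L) hs0 (by positivity) (hpsi _ hsL L) t ht x (by linarith)
  have hB := ext_stepB hK1 hK2 hu hL'pos hrp0 hsθ.le hε.le hfu hout hL2.le hi
    (1 / rp) ⟨hT.le, le_rfl⟩
  have hTθ : ∀ x, u (1 / rp) x ≤ θ := by
    intro x
    refine (hB x).trans ?_
    rw [hrT]
    have h1 := mul_le_mul_of_nonneg_right hkey.le hT.le
    have h2 : ε * (Real.exp 1 * rp) * (1 / rp) = ε * Real.exp 1 := by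
      rw [mul_assoc, mul_assoc, hrT, mul_one]
    linarith
  refine ext_stepC hK1 hu hT.le hu0 hu1 ?_ ?_
  · intro t x ht
    exact hfneg _ (hu0 t x (hT.le.trans ht)) (hcst θ (1 / rp) hT.le hfθ hTθ t x ht)
  · intro σ hσ
    obtain ⟨l1, hl1, hpsi1⟩ := psiF_op hK1 hR0 (η := σ * rp * Real.exp (-1)) (by positivity)
    refine ⟨L + l1, by positivity, fun x hx => ?_⟩
    exact hdecay σ l1 hσ hl1 (hpsi1 l1 le_rfl L) _ ⟨hT.le, le_rfl⟩ x hx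
end
end

section
/- Let J satisfy (K1), let f satisfy Assumption (F) with constants r⁻ > 0 and δ ∈ (θ,1), and assume the propagation assumption (P) holds. Then for any α ∈ (0, δ−θ) and any m ∈ (0,1) there exists ε₀ > 0 such that for all ε ∈ (0, ε₀) and every L > 0 satisfying ε/(2(θ+ε)) ≥ e^{−T_ε} · ∑_{i=1}^∞ (T_ε^i/i!) · R_i((1−m)L), where T_ε := (1/r⁻)·ln(2α/ε), one has L_ε^prop ≤ L. -/
open MeasureTheory Filter Set Asymptotics

noncomputable section

/-- law of one jump -/
def jumpLaw (J : ℝ → ℝ) : Measure ℝ := volume.withDensity (fun x => ENNReal.ofReal (J x))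

/-- law of n jumps -/
def walkLaw (J : ℝ → ℝ) : ℕ → Measure ℝ
  | 0 => Measure.dirac 0
  | n + 1 => (jumpLaw J).conv (walkLaw J n)

/-- tail of the law -/
def tailW (J : ℝ → ℝ) (n : ℕ) (l : ℝ) : ℝ := (walkLaw J n).real {x : ℝ | l ≤ |x|}

lemma jumpLaw_prob {J : ℝ → ℝ} (h : K1 J) : IsProbabilityMeasure (jumpLaw J) := by
  constructor
  rw [jumpLaw, withDensity_apply _ MeasurableSet.univ, Measure.restrict_univ,
    ← ofReal_integral_eq_lintegral_ofReal h.2.2.1 (ae_of_all _ h.1), h.2.2.2]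
  simp

lemma walkLaw_prob {J : ℝ → ℝ} (h : K1 J) (n : ℕ) : IsProbabilityMeasure (walkLaw J n) := by
  induction n with
  | zero => rw [walkLaw]; infer_instance
  | succ n ih =>
    have := jumpLaw_prob h
    rw [walkLaw]; infer_instance

lemma walkLaw_add {J : ℝ → ℝ} (h : K1 J) (m n : ℕ) :
    walkLaw J (m + n) = (walkLaw J m).conv (walkLaw J n) := by
  have hp := walkLaw_prob h
  have := jumpLaw_prob h
  induction m with
  | zero => rw [walkLaw, Measure.dirac_zero_conv, zero_add]
  | succ m ih =>
    rw [Nat.add_right_comm, walkLaw, ih, walkLaw, Measure.conv_assoc]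

lemma jumpLaw_symm {J : ℝ → ℝ} (h : K1 J) : (jumpLaw J).map (fun x => -x) = jumpLaw J := by
  ext s hs
  rw [Measure.map_apply measurable_neg hs, jumpLaw, withDensity_apply _ hs,
    withDensity_apply _ (measurable_neg hs), ← lintegral_indicator hs,
    ← lintegral_indicator (measurable_neg hs), ← lintegral_neg_eq_self]
  congr 1
  ext x
  have : (-x ∈ ((fun x : ℝ => -x) ⁻¹' s : Set ℝ)) ↔ x ∈ s := by rw [mem_preimage, neg_neg]
  by_cases hx : x ∈ s
  · rw [indicator_of_mem (this.2 hx), indicator_of_mem hx, h.2.1]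
  · rw [indicator_of_notMem (fun hh => hx (this.1 hh)), indicator_of_notMem hx]

lemma walkLaw_symm {J : ℝ → ℝ} (h : K1 J) (n : ℕ) :
    (walkLaw J n).map (fun x => -x) = walkLaw J n := by
  induction n with
  | zero => rw [walkLaw, Measure.map_dirac' measurable_neg]; simp
  | succ n ih =>
    have hp := walkLaw_prob h n
    have := jumpLaw_prob h
    have := Measure.map_conv_addMonoidHom (μ := jumpLaw J) (ν := walkLaw J n)
      (L := (negAddMonoidHom : ℝ →+ ℝ)) measurable_neg
    rw [walkLaw]
    simp only [coe_negAddMonoidHom] at this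
    have h2 : (Neg.neg : ℝ → ℝ) = fun x => -x := rfl
    rw [h2, jumpLaw_symm h, ih] at this
    exact this

lemma tail_conv_ge {ρ σ : Measure ℝ} [IsProbabilityMeasure ρ] [IsProbabilityMeasure σ]
    (hσ : σ.map (fun x => -x) = σ) (l : ℝ) (A : Set (ℝ × ℝ))
    (hA : ∀ p ∈ A, l ≤ |p.1 + p.2| ∨ l ≤ |p.1 - p.2|) :
    (ρ.prod σ).real A ≤ 2 * (ρ.conv σ).real {x : ℝ | l ≤ |x|} := by
  have hm : MeasurableSet {x : ℝ | l ≤ |x|} := measurableSet_le measurable_const (by fun_prop)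
  have e1 : (ρ.conv σ).real {x : ℝ | l ≤ |x|} = (ρ.prod σ).real {p | l ≤ |p.1 + p.2|} := by
    rw [Measure.conv, measureReal_def, Measure.map_apply (by fun_prop) hm, measureReal_def]
    rfl
  have e2 : (ρ.prod σ).real {p | l ≤ |p.1 + p.2|} = (ρ.prod σ).real {p | l ≤ |p.1 - p.2|} := by
    have : (ρ.prod σ).map (Prod.map id (fun x => -x)) = ρ.prod σ := by
      rw [← Measure.map_prod_map _ _ measurable_id measurable_neg, hσ, Measure.map_id]
    conv_lhs => rw [← this]
    rw [measureReal_def, Measure.map_apply (by fun_prop)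
      (measurableSet_le measurable_const (by fun_prop)), measureReal_def]
    rfl
  have : (ρ.prod σ).real A ≤ (ρ.prod σ).real ({p | l ≤ |p.1 + p.2|} ∪ {p | l ≤ |p.1 - p.2|}) :=
    measureReal_mono (fun p hp => hA p hp)
  have h3 := measureReal_union_le (μ := ρ.prod σ) {p | l ≤ |p.1 + p.2|} {p | l ≤ |p.1 - p.2|}
  linarith

lemma tailW_add {J : ℝ → ℝ} (h : K1 J) (m n : ℕ) (l : ℝ) :
    tailW J m l ≤ 2 * tailW J (m + n) l := by
  have := walkLaw_prob h
  have h1 := tail_conv_ge (ρ := walkLaw J m) (walkLaw_symm h n) l ({x : ℝ | l ≤ |x|} ×ˢ univ) (by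
    rintro ⟨x, y⟩ ⟨hp, -⟩
    simp only [mem_ofPred_eq] at *
    by_contra! hc
    have : |2 * x| ≤ |x + y| + |x - y| := by
      have e : 2 * x = (x + y) + (x - y) := by ring
      rw [e]; exact abs_add_le _ _
    rw [abs_mul] at this; norm_num at this; linarith)
  rw [measureReal_prod_prod, ← walkLaw_add h] at h1
  simpa [tailW] using h1

lemma tailW_double {J : ℝ → ℝ} (h : K1 J) (m : ℕ) (c : ℝ) :
    tailW J m c * tailW J m c ≤ 2 * tailW J (m + m) (2 * c) := by
  have := walkLaw_prob h
  have h1 := tail_conv_ge (ρ := walkLaw J m) (walkLaw_symm h m) (2 * c)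
    ({x : ℝ | c ≤ |x|} ×ˢ {x : ℝ | c ≤ |x|}) (by
    rintro ⟨x, y⟩ ⟨hp, hq⟩
    simp only [mem_ofPred_eq] at *
    rcases abs_cases x with ⟨h1, _⟩ | ⟨h1, _⟩ <;> rcases abs_cases y with ⟨h2, _⟩ | ⟨h2, _⟩
    · left; exact le_trans (by linarith) (le_abs_self _)
    · right; exact le_trans (by linarith) (le_abs_self _)
    · right; exact le_trans (by linarith) (neg_le_abs _)
    · left; exact le_trans (by linarith) (neg_le_abs _))
  rw [measureReal_prod_prod, ← walkLaw_add h] at h1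
  simpa [tailW] using h1

lemma tailW_nonneg (J : ℝ → ℝ) (n : ℕ) (l : ℝ) : 0 ≤ tailW J n l := measureReal_nonneg

lemma tailW_le_one {J : ℝ → ℝ} (h : K1 J) (n : ℕ) (l : ℝ) : tailW J n l ≤ 1 := by
  have := walkLaw_prob h
  exact measureReal_le_one

lemma tailW_anti {J : ℝ → ℝ} (h : K1 J) (n : ℕ) {l l' : ℝ} (hl : l ≤ l') :
    tailW J n l' ≤ tailW J n l := by
  have := walkLaw_prob h
  exact measureReal_mono (fun x hx => le_trans hl hx)

lemma tailW_zero (J : ℝ → ℝ) {l : ℝ} (hl : 0 < l) : tailW J 0 l = 0 := by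
  have hm : MeasurableSet {x : ℝ | l ≤ |x|} := measurableSet_le measurable_const (by fun_prop)
  rw [tailW, walkLaw, measureReal_def, Measure.dirac_apply' _ hm]
  simp [indicator, not_le.2 hl]

lemma tailW_pos {J : ℝ → ℝ} (h : K1 J) (l : ℝ) : ∃ n, 0 < tailW J n l := by
  have hpr := jumpLaw_prob h
  have hw := walkLaw_prob h
  have hc : ∃ k : ℕ, 0 < tailW J 1 (1 / ((k:ℝ) + 1)) := by
    by_contra! hc
    have h0 : ∀ k : ℕ, jumpLaw J {x : ℝ | 1 / ((k:ℝ) + 1) ≤ |x|} = 0 := by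
      intro k
      have h1 := le_antisymm (hc k) (tailW_nonneg _ _ _)
      rw [tailW, walkLaw, walkLaw, Measure.conv_dirac_zero] at h1
      exact (measureReal_eq_zero_iff).1 h1
    have h2 : jumpLaw J {0} = 0 := by
      have : jumpLaw J ≪ volume := withDensity_absolutelyContinuous _ _
      exact this (by simp)
    have h3 : jumpLaw J univ ≤ jumpLaw J ({0} ∪ ⋃ k : ℕ, {x : ℝ | 1 / ((k:ℝ) + 1) ≤ |x|}) := by
      apply measure_mono
      intro x _
      by_cases hx : x = 0
      · left; exact hx
      · right
        obtain ⟨k, hk⟩ := exists_nat_one_div_lt (abs_pos.2 hx)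
        exact mem_iUnion.2 ⟨k, hk.le⟩
    rw [measure_union_null h2 (measure_iUnion_null h0)] at h3
    simp at h3
  obtain ⟨k, hk⟩ := hc
  set c := 1 / ((k:ℝ) + 1) with hcdef
  have hcpos : 0 < c := by positivity
  have hind : ∀ j : ℕ, 0 < tailW J (2 ^ j) (2 ^ j * c) := by
    intro j
    induction j with
    | zero => simpa using hk
    | succ j ih =>
      have h1 := tailW_double h (2 ^ j) (2 ^ j * c)
      have e : 2 ^ (j + 1) = 2 ^ j + 2 ^ j := by ring
      have e' : (2:ℝ) ^ (j + 1) * c = 2 * (2 ^ j * c) := by ring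
      rw [e, e']
      have := mul_pos ih ih
      linarith
  obtain ⟨j, hj⟩ := pow_unbounded_of_one_lt (l / c) (by norm_num : (1:ℝ) < 2)
  refine ⟨2 ^ j, lt_of_lt_of_le (hind j) (tailW_anti h _ ?_)⟩
  exact ((div_lt_iff₀ hcpos).1 hj).le

lemma convIter_facts {J : ℝ → ℝ} (h : K1 J) (n : ℕ) :
    (∀ x, 0 ≤ convIter J n x) ∧ Integrable (convIter J n) ∧
    walkLaw J (n + 1) = volume.withDensity (fun x => ENNReal.ofReal (convIter J n x)) := by
  have hpr := jumpLaw_prob h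
  have hw := walkLaw_prob h
  induction n with
  | zero =>
    refine ⟨h.1, h.2.2.1, ?_⟩
    rw [walkLaw, walkLaw, Measure.conv_dirac_zero]; rfl
  | succ n ih =>
    obtain ⟨i1, i2, i3⟩ := ih
    have e : convIter J (n + 1) = convolution J (convIter J n) (ContinuousLinearMap.mul ℝ ℝ) volume := by
      ext x; simp [convIter, convolution]
    refine ⟨fun x => integral_nonneg fun y => mul_nonneg (h.1 _) (i1 _), ?_, ?_⟩
    · rw [e]; exact h.2.2.1.integrable_convolution _ i2
    · rw [walkLaw, i3, jumpLaw, conv_withDensity_eq_mlconvolution₀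
        h.2.2.1.aemeasurable.ennreal_ofReal i2.aemeasurable.ennreal_ofReal]
      apply withDensity_congr_ae
      filter_upwards [h.2.2.1.ae_convolution_exists (ContinuousLinearMap.mul ℝ ℝ) i2] with x hx
      have hx' : Integrable (fun y => J y * convIter J n (x - y)) := by
        simpa [ConvolutionExistsAt] using hx
      simp only [lconvolution_def, convIter]
      rw [ofReal_integral_eq_lintegral_ofReal hx'
        (ae_of_all _ fun y => mul_nonneg (h.1 _) (i1 _))]
      congr 1
      ext y
      rw [ENNReal.ofReal_mul (h.1 _), sub_eq_neg_add]

lemma tailR_eq {J : ℝ → ℝ} (h : K1 J) (n : ℕ) (l : ℝ) : tailR J n l = tailW J (n + 1) l := by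
  have hm : MeasurableSet {x : ℝ | l ≤ |x|} := measurableSet_le measurable_const (by fun_prop)
  obtain ⟨i1, i2, i3⟩ := convIter_facts h n
  rw [tailR, tailW, i3, measureReal_def, withDensity_apply _ hm,
    integral_eq_lintegral_of_nonneg_ae (ae_of_all _ i1) i2.aestronglyMeasurable.restrict]

/-- mass of the window -/
def winA (J : ℝ → ℝ) (L : ℝ) (n : ℕ) (x : ℝ) : ℝ := (walkLaw J n).real {y : ℝ | |x - y| < L}

lemma winA_facts {J : ℝ → ℝ} (h : K1 J) (L : ℝ) (n : ℕ) :
    (∀ x, 0 ≤ winA J L n x) ∧ (∀ x, winA J L n x ≤ 1) ∧ Measurable (winA J L n) := by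
  have hw := walkLaw_prob h
  refine ⟨fun x => measureReal_nonneg, fun x => measureReal_le_one, ?_⟩
  have : MeasurableSet {p : ℝ × ℝ | |p.1 - p.2| < L} := measurableSet_lt (by fun_prop) measurable_const
  exact (measurable_measure_prodMk_left (ν := walkLaw J n) this).ennreal_toReal

lemma winA_succ {J : ℝ → ℝ} (h : K1 J) (L : ℝ) (n : ℕ) (x : ℝ) :
    winA J L (n + 1) x = ∫ y, J y * winA J L n (x - y) := by
  have hpr := jumpLaw_prob h
  have hw := walkLaw_prob h
  obtain ⟨f1, f2, f3⟩ := winA_facts h L n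
  have hm : MeasurableSet {y : ℝ | |x - y| < L} := measurableSet_lt (by fun_prop) measurable_const
  have hm2 : Measurable fun y => winA J L n (x - y) := f3.comp (by fun_prop)
  rw [integral_eq_lintegral_of_nonneg_ae (ae_of_all _ fun y => mul_nonneg (h.1 _) (f1 _))
    (h.2.2.1.aestronglyMeasurable.mul hm2.aestronglyMeasurable)]
  rw [winA, walkLaw, measureReal_def, Measure.conv, Measure.map_apply (by fun_prop) hm,
    Measure.prod_apply (by measurability), jumpLaw,
    lintegral_withDensity_eq_lintegral_mul₀ h.2.2.1.aemeasurable.ennreal_ofReal]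
  · congr 2
    ext y
    simp only [Pi.mul_apply]
    rw [ENNReal.ofReal_mul (h.1 _)]
    congr 1
    rw [winA, ofReal_measureReal]
    congr 1
    ext z
    simp [sub_sub]
  · exact (measurable_measure_prodMk_left (by measurability)).aemeasurable

lemma winA_zero (J : ℝ → ℝ) (L x : ℝ) : winA J L 0 x = (Ioo (-L) L).indicator (fun _ => 1) x := by
  have hm : MeasurableSet {y : ℝ | |x - y| < L} := measurableSet_lt (by fun_prop) measurable_const
  rw [winA, walkLaw, measureReal_def, Measure.dirac_apply' _ hm]
  by_cases hx : |x| < L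
  · simp [indicator, hx, abs_lt.1 hx]
  · have : ¬ (-L < x ∧ x < L) := fun hh => hx (abs_lt.2 hh)
    simp [indicator, hx, this]

lemma winA_ge {J : ℝ → ℝ} (h : K1 J) {L l x : ℝ} (hx : |x| + l ≤ L) (n : ℕ) :
    1 - tailW J n l ≤ winA J L n x := by
  have hw := walkLaw_prob h
  have hm : MeasurableSet {x : ℝ | l ≤ |x|} := measurableSet_le measurable_const (by fun_prop)
  rw [tailW, ← probReal_compl_eq_one_sub hm, winA]
  refine measureReal_mono (fun y hy => ?_)
  simp only [mem_compl_iff, mem_ofPred_eq, not_le] at *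
  have := abs_sub x y
  linarith

/-- Poisson averaged tail -/
def poisH (J : ℝ → ℝ) (t l : ℝ) : ℝ :=
  Real.exp (-t) * ∑' n : ℕ, t ^ n / (Nat.factorial n : ℝ) * tailW J n l

lemma hasSum_exp' (t : ℝ) : HasSum (fun n : ℕ => t ^ n / (Nat.factorial n : ℝ)) (Real.exp t) := by
  rw [Real.exp_eq_exp_ℝ]
  exact NormedSpace.expSeries_div_hasSum_exp t

lemma summable_pois {t : ℝ} (ht : 0 ≤ t) {b : ℕ → ℝ} (h0 : ∀ n, 0 ≤ b n) (h1 : ∀ n, b n ≤ 1) :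
    Summable (fun n : ℕ => t ^ n / (Nat.factorial n : ℝ) * b n) := by
  refine Summable.of_nonneg_of_le (fun n => mul_nonneg (by positivity) (h0 n)) (fun n => ?_)
    (hasSum_exp' t).summable
  exact mul_le_of_le_one_right (by positivity) (h1 n)

lemma poisH_eq {J : ℝ → ℝ} (h : K1 J) {t l : ℝ} (ht : 0 ≤ t) (hl : 0 < l) :
    poisH J t l = Real.exp (-t) *
      ∑' n : ℕ, t ^ (n + 1) / (Nat.factorial (n + 1) : ℝ) * tailR J n l := by
  rw [poisH, (summable_pois ht (tailW_nonneg J · l) (tailW_le_one h · l)).tsum_eq_zero_add,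
    tailW_zero J hl]
  simp [tailR_eq h]

lemma poisH_shift {J : ℝ → ℝ} (h : K1 J) {t s : ℝ} (ht : 0 ≤ t) (hs : 0 ≤ s) (l : ℝ) :
    (1 + Real.exp (-s)) / 2 * poisH J t l ≤ poisH J (t + s) l := by
  set r : ℕ → ℝ := fun n => tailW J n l with hr
  set c : ℕ → ℝ := fun n => if n = 0 then 1 else 1 / 2 with hc
  have hc0 : ∀ n, 0 ≤ c n := fun n => by simp only [hc]; split_ifs <;> norm_num
  have hc1 : ∀ n, c n ≤ 1 := fun n => by simp only [hc]; split_ifs <;> norm_num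
  have hr0 : ∀ n, 0 ≤ r n := (tailW_nonneg J · l)
  have hr1 : ∀ n, r n ≤ 1 := (tailW_le_one h · l)
  have S1 := summable_pois ht hr0 hr1
  have S2 := summable_pois hs hc0 hc1
  have S3 := summable_pois (add_nonneg ht hs) hr0 hr1
  have N1 := S1.norm
  have N2 := S2.norm
  have hcs : ∑' n : ℕ, s ^ n / (Nat.factorial n : ℝ) * c n = (1 + Real.exp s) / 2 := by
    have a1 := (hasSum_exp' s).mul_right (1 / 2)
    have a2 : HasSum (fun n : ℕ => if n = 0 then (1 / 2 : ℝ) else 0) (1 / 2) := by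
      simpa using hasSum_ite_eq (0 : ℕ) (1 / 2 : ℝ)
    have a3 := a1.add a2
    have e : (fun n : ℕ => s ^ n / (Nat.factorial n : ℝ) * c n) =
        fun n : ℕ => s ^ n / (Nat.factorial n : ℝ) * (1 / 2) + if n = 0 then (1 / 2 : ℝ) else 0 := by
      ext n
      by_cases hn : n = 0
      · subst hn; simp [hc]; norm_num
      · simp [hc, hn]
    rw [e, a3.tsum_eq]; ring
  have key : (∑' n : ℕ, t ^ n / (Nat.factorial n : ℝ) * r n) *
      (∑' n : ℕ, s ^ n / (Nat.factorial n : ℝ) * c n) ≤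
      ∑' n : ℕ, (t + s) ^ n / (Nat.factorial n : ℝ) * r n := by
    rw [tsum_mul_tsum_eq_tsum_sum_antidiagonal_of_summable_norm N1 N2]
    refine Summable.tsum_le_tsum (fun n => ?_)
      (summable_norm_sum_mul_antidiagonal_of_summable_norm N1 N2).of_norm S3
    have hb : (t + s) ^ n / (Nat.factorial n : ℝ) = ∑ kl ∈ Finset.HasAntidiagonal.antidiagonal n,
        (t ^ kl.1 / (Nat.factorial kl.1 : ℝ)) * (s ^ kl.2 / (Nat.factorial kl.2 : ℝ)) := by
      rw [(Commute.all t s).add_pow', Finset.sum_div]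
      refine Finset.sum_congr rfl fun kl hkl => ?_
      have hk := Finset.HasAntidiagonal.mem_antidiagonal.1 hkl
      have hch := Nat.choose_mul_factorial_mul_factorial (show kl.1 ≤ n by omega)
      rw [show n - kl.1 = kl.2 by omega] at hch
      have hch' : ((n.choose kl.1 : ℕ) : ℝ) * (Nat.factorial kl.1 : ℝ) * (Nat.factorial kl.2 : ℝ)
          = (Nat.factorial n : ℝ) := by exact_mod_cast hch
      have p1 : (Nat.factorial kl.1 : ℝ) ≠ 0 := by positivity
      have p2 : (Nat.factorial kl.2 : ℝ) ≠ 0 := by positivity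
      have p3 : (n.choose kl.1 : ℝ) ≠ 0 := by
        intro h0; rw [h0] at hch'; simp at hch'
        exact (Nat.factorial_ne_zero n) (by exact_mod_cast hch'.symm)
      rw [← hch', nsmul_eq_mul]
      field_simp
    rw [hb, Finset.sum_mul]
    refine Finset.sum_le_sum fun kl hkl => ?_
    have hk := Finset.HasAntidiagonal.mem_antidiagonal.1 hkl
    have hcr : r kl.1 * c kl.2 ≤ r n := by
      simp only [hc]
      split_ifs with h0
      · rw [h0, add_zero] at hk; rw [hk]; simp
      · have := tailW_add h kl.1 kl.2 l
        rw [hk] at this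
        simp only [hr]; linarith
    calc _ = (t ^ kl.1 / (Nat.factorial kl.1 : ℝ)) * (s ^ kl.2 / (Nat.factorial kl.2 : ℝ)) *
          (r kl.1 * c kl.2) := by ring
      _ ≤ _ := mul_le_mul_of_nonneg_left hcr (by positivity)
  rw [hcs] at key
  have h2 := mul_le_mul_of_nonneg_left key (Real.exp_pos (-(t + s))).le
  have e : Real.exp (-(t + s)) = Real.exp (-t) * Real.exp (-s) := by rw [← Real.exp_add]; ring_nf
  have e1 : Real.exp (-s) * Real.exp s = 1 := by rw [← Real.exp_add]; simp
  calc (1 + Real.exp (-s)) / 2 * poisH J t l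
      = Real.exp (-t) * ((Real.exp (-s) * Real.exp s + Real.exp (-s)) / 2) *
        (∑' n : ℕ, t ^ n / (Nat.factorial n : ℝ) * r n) := by rw [poisH, e1]; ring
    _ = Real.exp (-(t + s)) * ((∑' n : ℕ, t ^ n / (Nat.factorial n : ℝ) * r n) *
        ((1 + Real.exp s) / 2)) := by rw [e]; ring
    _ ≤ _ := h2

lemma poisH_lower {J : ℝ → ℝ} (h : K1 J) (l0 : ℝ) :
    ∃ κ > 0, ∃ T0, 0 ≤ T0 ∧ ∀ T, T0 ≤ T → ∀ l, l ≤ l0 → κ ≤ poisH J T l := by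
  obtain ⟨n, hn⟩ := tailW_pos h l0
  set p := tailW J n l0
  have lim : Tendsto (fun T : ℝ => p / 2 * (1 - ∑ i ∈ Finset.range n,
      T ^ i * Real.exp (-T) / (Nat.factorial i : ℝ))) atTop (nhds (p / 2 * (1 - ∑ i ∈ Finset.range n,
        0 / (Nat.factorial i : ℝ)))) := by
    refine Tendsto.const_mul _ (Tendsto.const_sub _ (tendsto_finsetSum _ fun i _ => ?_))
    exact (Real.tendsto_pow_mul_exp_neg_atTop_nhds_zero i).div_const _
  simp only [zero_div, Finset.sum_const_zero, sub_zero, mul_one] at lim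
  have ev := (lim.eventually (eventually_gt_nhds (show p / 4 < p / 2 by linarith))).and
    (eventually_ge_atTop 0)
  obtain ⟨T0, hT0⟩ := eventually_atTop.1 ev
  refine ⟨p / 4, by positivity, T0, (hT0 T0 le_rfl).2, fun T hT l hl => ?_⟩
  obtain ⟨h1, hT'⟩ := hT0 T hT
  refine h1.le.trans ?_
  have a1 := (hasSum_exp' T).mul_right (p / 2)
  have a2 : HasSum (fun i : ℕ => if i ∈ Finset.range n then T ^ i / (Nat.factorial i : ℝ) * (p / 2)
      else 0) (∑ i ∈ Finset.range n, T ^ i / (Nat.factorial i : ℝ) * (p / 2)) := by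
    have := hasSum_sum_of_ne_finset_zero (L := SummationFilter.unconditional ℕ) (f := fun i : ℕ => if i ∈ Finset.range n then
      T ^ i / (Nat.factorial i : ℝ) * (p / 2) else 0) (s := Finset.range n)
      (by intro b hb; simp only [hb, if_false])
    convert this using 1
    exact Finset.sum_congr rfl fun i hi => by simp only [hi, if_true]
  have a3 := a1.sub a2
  have S := summable_pois hT' (tailW_nonneg J · l) (tailW_le_one h · l)
  have key := hasSum_le (fun i => ?_) a3 S.hasSum
  · rw [poisH]
    refine le_trans (le_of_eq ?_) (mul_le_mul_of_nonneg_left key (Real.exp_pos (-T)).le)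
    have e1 : Real.exp (-T) * Real.exp T = 1 := by rw [← Real.exp_add]; simp
    rw [mul_sub, mul_sub (Real.exp (-T)), ← mul_assoc (Real.exp (-T)), e1, Finset.mul_sum, Finset.mul_sum]
    congr 1
    · ring
    · exact Finset.sum_congr rfl fun i hi => by ring
  · by_cases hi : i ∈ Finset.range n
    · simp only [hi, if_true, sub_self]
      exact mul_nonneg (by positivity) (tailW_nonneg _ _ _)
    · simp only [hi, if_false, sub_zero]
      refine mul_le_mul_of_nonneg_left ?_ (by positivity)
      rw [Finset.mem_range, not_lt] at hi
      have b1 := tailW_add h n (i - n) l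
      rw [Nat.add_sub_cancel' hi] at b1
      have b2 := tailW_anti h n hl
      simp only [p]; linarith

lemma barrier_1d {T A lam : ℝ} (hA : 0 ≤ A) {g : ℝ → ℝ}
    (hc : ContinuousOn g (Icc 0 T)) (h0 : 0 ≤ g 0)
    (hd : ∀ t, 0 < t → t ≤ T → g t < 0 → ∃ d, HasDerivAt g d t ∧ -(A * (lam * Real.exp (lam * t))) ≤ d) :
    ∀ t, 0 ≤ t → t ≤ T → -(A * Real.exp (lam * t)) ≤ g t := by
  intro t0 h1 h2
  by_contra! hlt
  have hneg : g t0 < 0 := lt_of_lt_of_le hlt (by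
    have := mul_nonneg hA (Real.exp_pos (lam * t0)).le; linarith)
  have hc' : ContinuousOn g (Icc 0 t0) := hc.mono (Icc_subset_Icc_right h2)
  have hcomp : IsCompact (Icc 0 t0 ∩ g ⁻¹' (Ici 0)) := by
    have := hc'.preimage_isClosed_of_isClosed isClosed_Icc (isClosed_Ici (a := (0:ℝ)))
    exact isCompact_Icc.of_isClosed_subset this inter_subset_left
  obtain ⟨s, ⟨hs1, hs2⟩, hs3⟩ := hcomp.exists_isGreatest ⟨0, ⟨le_rfl, h1⟩, h0⟩
  have hs2' : 0 ≤ g s := hs2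
  have hlt' : ∀ r, s < r → r ≤ t0 → g r < 0 := by
    intro r hr1 hr2
    by_contra! hge
    exact absurd (hs3 ⟨⟨hs1.1.trans hr1.le, hr2⟩, hge⟩) (not_le.2 hr1)
  have hE : ∀ t, HasDerivAt (fun r => A * Real.exp (lam * r)) (A * (lam * Real.exp (lam * t))) t := by
    intro t
    exact (((hasDerivAt_id t).const_mul lam).exp.const_mul A).congr_deriv (by simp only [id]; ring)
  have hmono : MonotoneOn (fun r => g r + A * Real.exp (lam * r)) (Icc s t0) := by
    have hder : ∀ r ∈ interior (Icc s t0), ∃ d, HasDerivAt (fun r => g r + A * Real.exp (lam * r)) d r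
        ∧ 0 ≤ d := by
      intro r hr
      rw [interior_Icc] at hr
      obtain ⟨d, hd1, hd2⟩ := hd r (lt_of_le_of_lt hs1.1 hr.1) (hr.2.le.trans h2) (hlt' r hr.1 hr.2.le)
      exact ⟨_, hd1.add (hE r), by linarith⟩
    refine monotoneOn_of_deriv_nonneg (convex_Icc _ _) ?_ ?_ ?_
    · refine (hc'.mono (Icc_subset_Icc_left hs1.1)).add ?_
      fun_prop
    · intro r hr
      obtain ⟨d, h, _⟩ := hder r hr
      exact h.differentiableAt.differentiableWithinAt
    · intro r hr
      obtain ⟨d, h, h'⟩ := hder r hr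
      rw [h.deriv]; exact h'
  have := hmono ⟨le_rfl, hs1.2⟩ ⟨hs1.2, le_rfl⟩ hs1.2
  simp only at this
  have h5 := mul_nonneg hA (Real.exp_pos (lam * s)).le
  linarith

lemma integrable_J_mul {J : ℝ → ℝ} (hK : K1 J) {v : ℝ → ℝ} (hv : Measurable v) {M : ℝ}
    (hM : ∀ x, |v x| ≤ M) (x : ℝ) : Integrable (fun y => J y * v (x - y)) := by
  have : Measurable fun y => v (x - y) := hv.comp (by fun_prop)
  exact hK.2.2.1.mul_bdd (c := M) this.aestronglyMeasurable (ae_of_all _ fun y => hM _)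

lemma integral_J_sub {J : ℝ → ℝ} (hK : K1 J) {v : ℝ → ℝ} (hv : Measurable v) {M : ℝ}
    (hM : ∀ x, |v x| ≤ M) (x c : ℝ) :
    ∫ y, J y * (v (x - y) - c) = (∫ y, J y * v (x - y)) - c := by
  simp_rw [mul_sub]
  rw [integral_sub (integrable_J_mul hK hv hM x) (hK.2.2.1.mul_const c), integral_mul_const, hK.2.2.2,
    one_mul]

lemma integral_J_const {J : ℝ → ℝ} (hK : K1 J) (c : ℝ) : ∫ y, J y * c = c := by
  rw [integral_mul_const, hK.2.2.2, one_mul]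

lemma integral_J_ge {J : ℝ → ℝ} (hK : K1 J) {v : ℝ → ℝ} (hv : Measurable v) {M c : ℝ}
    (hM : ∀ x, |v x| ≤ M) (hc : ∀ x, c ≤ v x) (x : ℝ) : c ≤ ∫ y, J y * v (x - y) := by
  rw [← integral_J_const hK c]
  exact integral_mono (hK.2.2.1.mul_const c) (integrable_J_mul hK hv hM x)
    fun y => mul_le_mul_of_nonneg_left (hc _) (hK.1 y)

lemma integral_J_le {J : ℝ → ℝ} (hK : K1 J) {v : ℝ → ℝ} (hv : Measurable v) {M c : ℝ}
    (hM : ∀ x, |v x| ≤ M) (hc : ∀ x, v x ≤ c) (x : ℝ) : ∫ y, J y * v (x - y) ≤ c := by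
  rw [← integral_J_const hK c]
  exact integral_mono (integrable_J_mul hK hv hM x) (hK.2.2.1.mul_const c)
    fun y => mul_le_mul_of_nonneg_left (hc _) (hK.1 y)

lemma max_principle {J : ℝ → ℝ} (hK : K1 J) {T C M : ℝ} (hC : 0 ≤ C) {z : ℝ → ℝ → ℝ}
    (hb : ∀ t, 0 ≤ t → t ≤ T → ∀ x, |z t x| ≤ M)
    (hm : ∀ t, 0 ≤ t → t ≤ T → Measurable (z t))
    (hc : ∀ x, ContinuousOn (fun t => z t x) (Icc 0 T))
    (h0 : ∀ x, 0 ≤ z 0 x)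
    (hd : ∀ t x, 0 < t → t ≤ T → z t x < 0 → ∃ d, HasDerivAt (fun s => z s x) d t ∧
      (∫ y, J y * z t (x - y)) - z t x + C * z t x ≤ d) :
    ∀ t, 0 ≤ t → t ≤ T → ∀ x, 0 ≤ z t x := by
  have M0 : ∀ t, 0 ≤ t → t ≤ T → 0 ≤ M := fun t h1 h2 => (abs_nonneg _).trans (hb t h1 h2 0)
  set lam := 2 * (1 + C) with hlam
  have hlam0 : 0 ≤ lam := by positivity
  have key : ∀ n : ℕ, ∀ t, 0 ≤ t → t ≤ T → ∀ x,
      -(M * (1 / 2) ^ n * Real.exp (lam * t)) ≤ z t x := by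
    intro n
    induction n with
    | zero =>
      intro t h1 h2 x
      have a1 := (abs_le.1 (hb t h1 h2 x)).1
      have a2 : 1 ≤ Real.exp (lam * t) := Real.one_le_exp (by positivity)
      have a3 := M0 t h1 h2
      simp only [pow_zero, mul_one]
      nlinarith
    | succ n ih =>
      intro t h1 h2 x
      have a3 := M0 t h1 h2
      refine barrier_1d (g := fun t => z t x) (by positivity) (hc x) (h0 x) ?_ t h1 h2
      intro s s1 s2 s3
      obtain ⟨d, d1, d2⟩ := hd s x s1 s2 s3
      refine ⟨d, d1, le_trans ?_ d2⟩
      have b1 := integral_J_ge hK (hm s s1.le s2) (hb s s1.le s2) (ih s s1.le s2) x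
      have b2 := ih s s1.le s2 x
      have b3 := mul_le_mul_of_nonneg_left b2 hC
      have e : M * (1 / 2) ^ (n + 1) * (lam * Real.exp (lam * s)) =
        (1 + C) * (M * (1 / 2) ^ n * Real.exp (lam * s)) := by
        rw [pow_succ, hlam]; ring
      rw [e]
      linarith
  intro t h1 h2 x
  have lim : Tendsto (fun n : ℕ => -(M * (1 / 2 : ℝ) ^ n * Real.exp (lam * t))) atTop
      (nhds (-(M * 0 * Real.exp (lam * t)))) :=
    (((tendsto_pow_atTop_nhds_zero_of_lt_one (by norm_num) (by norm_num)).const_mul M).mul_const _).neg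
  simp only [mul_zero, zero_mul, neg_zero] at lim
  exact le_of_tendsto lim (Eventually.of_forall fun n => key n t h1 h2 x)

/-- regularity of a space time function -/
def NiceOn (T : ℝ) (u : ℝ → ℝ → ℝ) : Prop :=
  (∃ M, ∀ t, 0 ≤ t → t ≤ T → ∀ x, |u t x| ≤ M) ∧
  (∀ t, 0 ≤ t → t ≤ T → Measurable (u t)) ∧
  (∀ x, ContinuousOn (fun t => u t x) (Icc 0 T))

lemma compare {J : ℝ → ℝ} (hK : K1 J) {T C : ℝ} (hC : 0 ≤ C) {u w F G : ℝ → ℝ → ℝ}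
    (nu : NiceOn T u) (nw : NiceOn T w) (h0 : ∀ x, w 0 x ≤ u 0 x)
    (hu : ∀ t x, 0 < t → t ≤ T →
      HasDerivAt (fun s => u s x) ((∫ y, J y * u t (x - y)) - u t x + F t x) t)
    (hw : ∀ t x, 0 < t → t ≤ T → ∃ d, HasDerivAt (fun s => w s x) d t ∧
      d ≤ (∫ y, J y * w t (x - y)) - w t x + G t x)
    (hFG : ∀ t x, 0 < t → t ≤ T → u t x < w t x → C * (u t x - w t x) ≤ F t x - G t x) :
    ∀ t, 0 ≤ t → t ≤ T → ∀ x, w t x ≤ u t x := by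
  obtain ⟨⟨M1, u1⟩, u2, u3⟩ := nu
  obtain ⟨⟨M2, w1⟩, w2, w3⟩ := nw
  have := max_principle hK (T := T) (C := C) (M := M1 + M2) hC (z := fun t x => u t x - w t x)
    (fun t h1 h2 x => (abs_sub _ _).trans (add_le_add (u1 t h1 h2 x) (w1 t h1 h2 x)))
    (fun t h1 h2 => (u2 t h1 h2).sub (w2 t h1 h2)) (fun x => (u3 x).sub (w3 x))
    (fun x => sub_nonneg.2 (h0 x)) ?_
  · exact fun t h1 h2 x => sub_nonneg.1 (this t h1 h2 x)
  · intro t x h1 h2 h3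
    obtain ⟨d, d1, d2⟩ := hw t x h1 h2
    refine ⟨_, (hu t x h1 h2).sub d1, ?_⟩
    have e : ∫ y, J y * (u t (x - y) - w t (x - y)) =
        (∫ y, J y * u t (x - y)) - ∫ y, J y * w t (x - y) := by
      simp_rw [mul_sub]
      exact integral_sub (integrable_J_mul hK (u2 t h1.le h2) (u1 t h1.le h2) x)
        (integrable_J_mul hK (w2 t h1.le h2) (w1 t h1.le h2) x)
    simp only [e]
    have := hFG t x h1 h2 (by linarith)
    linarith

lemma sol_nice {J f u0 : ℝ → ℝ} {u : ℝ → ℝ → ℝ} (hs : IsBddSol J f u0 u) {τ : ℝ} (hτ : 0 ≤ τ) (T : ℝ) :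
    NiceOn T (fun t x => u (τ + t) x) := by
  obtain ⟨⟨M, h1⟩, h2, h3, -, -⟩ := hs
  refine ⟨⟨M, fun t ht _ x => h1 _ _ (by linarith)⟩, fun t ht _ => h2 _ (by linarith), fun x => ?_⟩
  exact (h3 x).comp (by fun_prop) (fun t ht => by
    have := ht.1; simp only [mem_Ici]; linarith)

lemma sol_deriv {J f u0 : ℝ → ℝ} (hK : K1 J) {u : ℝ → ℝ → ℝ} (hs : IsBddSol J f u0 u) {τ : ℝ}
    (hτ : 0 ≤ τ) (t x : ℝ) (ht : 0 < t) :
    HasDerivAt (fun s => u (τ + s) x)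
      ((∫ y, J y * u (τ + t) (x - y)) - u (τ + t) x + f (u (τ + t) x)) t := by
  obtain ⟨⟨M, h1⟩, h2, -, -, h5⟩ := hs
  have hp : 0 < τ + t := by linarith
  have := h5 (τ + t) x hp
  rw [integral_J_sub hK (h2 _ hp.le) (fun x => h1 _ x hp.le)] at this
  exact this.comp_const_add τ t

lemma const_nice (T c : ℝ) : NiceOn T (fun _ _ => c) :=
  ⟨⟨|c|, fun _ _ _ _ => le_rfl⟩, fun _ _ _ => measurable_const, fun _ => continuousOn_const⟩

lemma lip_ge {f : ℝ → ℝ} {C : ℝ} (hL : ∀ u v : ℝ, |f u - f v| ≤ C * |u - v|) {a b : ℝ} (h : a < b) :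
    C * (a - b) ≤ f a - f b := by
  have h1 := (abs_le.1 (hL a b)).1
  rw [abs_of_neg (sub_neg.2 h)] at h1
  linarith

lemma sol_nonneg {J f u0 : ℝ → ℝ} (hK : K1 J) {C : ℝ} (hC : 0 ≤ C)
    (hL : ∀ u v : ℝ, |f u - f v| ≤ C * |u - v|) (hf : f 0 = 0) {u : ℝ → ℝ → ℝ}
    (hs : IsBddSol J f u0 u) (h0 : ∀ x, 0 ≤ u0 x) (t : ℝ) (ht : 0 ≤ t) (x : ℝ) : 0 ≤ u t x := by
  have := compare hK (T := t) hC (u := fun t x => u (0 + t) x) (w := fun _ _ => 0)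
    (F := fun t x => f (u (0 + t) x)) (G := fun _ _ => 0)
    (sol_nice hs le_rfl t) (const_nice t 0)
    (fun x => by simp only [add_zero, hs.2.2.2.1]; exact h0 x)
    (fun s x h1 _ => sol_deriv hK hs le_rfl s x h1)
    (fun s x _ _ => ⟨0, hasDerivAt_const _ _, by simp⟩)
    (fun s x _ _ h => by simpa [hf] using lip_ge hL h)
    t ht le_rfl x
  simpa using this

lemma sol_le_one {J f u0 : ℝ → ℝ} (hK : K1 J) {C : ℝ} (hC : 0 ≤ C)
    (hL : ∀ u v : ℝ, |f u - f v| ≤ C * |u - v|) (hf : f 1 = 0) {u : ℝ → ℝ → ℝ}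
    (hs : IsBddSol J f u0 u) (h0 : ∀ x, u0 x ≤ 1) (t : ℝ) (ht : 0 ≤ t) (x : ℝ) : u t x ≤ 1 := by
  have := compare hK (T := t) hC (w := fun t x => u (0 + t) x) (u := fun _ _ => 1)
    (G := fun t x => f (u (0 + t) x)) (F := fun _ _ => 0)
    (const_nice t 1) (sol_nice hs le_rfl t)
    (fun x => by simp only [add_zero, hs.2.2.2.1]; exact h0 x)
    (fun s x _ _ => by
      refine (hasDerivAt_const (x := s) (c := (1:ℝ))).congr_deriv ?_
      rw [integral_J_const hK]; simp)
    (fun s x h1 _ => ⟨_, sol_deriv hK hs le_rfl s x h1, le_rfl⟩)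
    (fun s x _ _ h => by simpa [hf] using lip_ge hL h)
    t ht le_rfl x
  simpa using this

lemma sol_compare {J f u0 w0 : ℝ → ℝ} (hK : K1 J) {C : ℝ} (hC : 0 ≤ C)
    (hL : ∀ u v : ℝ, |f u - f v| ≤ C * |u - v|) {u w : ℝ → ℝ → ℝ}
    (hs : IsBddSol J f u0 u) (hs' : IsBddSol J f w0 w) {τ : ℝ} (hτ : 0 ≤ τ)
    (h0 : ∀ x, w0 x ≤ u τ x) (t : ℝ) (ht : 0 ≤ t) (x : ℝ) : w t x ≤ u (τ + t) x := by
  have := compare hK (T := t) hC (w := fun t x => w (0 + t) x) (u := fun t x => u (τ + t) x)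
    (G := fun t x => f (w (0 + t) x)) (F := fun t x => f (u (τ + t) x))
    (sol_nice hs hτ t) (sol_nice hs' le_rfl t)
    (fun x => by simp only [add_zero, hs'.2.2.2.1]; exact h0 x)
    (fun s x h1 _ => sol_deriv hK hs hτ s x h1)
    (fun s x h1 _ => ⟨_, sol_deriv hK hs' le_rfl s x h1, le_rfl⟩)
    (fun s x _ _ h => lip_ge hL h)
    t ht le_rfl x
  simpa using this

/-- monotone part of the nonlinearity -/
def opG (J f : ℝ → ℝ) (C : ℝ) (v : ℝ → ℝ) (x : ℝ) : ℝ :=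
  (∫ y, J y * v (x - y)) + (f (v x) + C * v x)

/-- Duhamel map -/
def opPhi (J f : ℝ → ℝ) (C : ℝ) (u0 : ℝ → ℝ) (w : ℝ → ℝ → ℝ) (t x : ℝ) : ℝ :=
  Real.exp (-((1 + C) * max t 0)) *
    (u0 x + ∫ s in (0:ℝ)..(max t 0), Real.exp ((1 + C) * s) * opG J f C (w s) x)

/-- the class of admissible functions -/
def Adm (w : ℝ → ℝ → ℝ) : Prop :=
  Measurable (Function.uncurry w) ∧ (∀ t x, 0 ≤ w t x) ∧ (∀ t x, w t x ≤ 1)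

lemma Adm.meas {w : ℝ → ℝ → ℝ} (h : Adm w) (t : ℝ) : Measurable (w t) :=
  h.1.comp (measurable_prodMk_left (x := t))

lemma Adm.bdd {w : ℝ → ℝ → ℝ} (h : Adm w) (t x : ℝ) : |w t x| ≤ 1 :=
  abs_le.2 ⟨by linarith [h.2.1 t x], h.2.2 t x⟩

section
variable {J f u0 : ℝ → ℝ} {C : ℝ}

lemma lip_cont (hL : ∀ u v : ℝ, |f u - f v| ≤ C * |u - v|) : Continuous f := by
  by_cases hC : 0 ≤ C
  · refine (LipschitzWith.of_dist_le_mul (K := ⟨C, hC⟩) fun u v => ?_).continuous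
    simp only [Real.dist_eq]; exact hL u v
  · exfalso
    have := hL 0 1
    norm_num at this
    linarith [abs_nonneg (f 0 - f 1)]

lemma g_mono (hL : ∀ u v : ℝ, |f u - f v| ≤ C * |u - v|) {a b : ℝ} (h : a ≤ b) :
    f a + C * a ≤ f b + C * b := by
  have := (abs_le.1 (hL a b)).2
  rw [abs_of_nonpos (by linarith)] at this
  linarith

lemma opG_mono (hK : K1 J) (hL : ∀ u v : ℝ, |f u - f v| ≤ C * |u - v|) {v v' : ℝ → ℝ}
    (m : Measurable v) (m' : Measurable v') (b : ∀ x, |v x| ≤ 1) (b' : ∀ x, |v' x| ≤ 1)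
    (h : ∀ x, v x ≤ v' x) (x : ℝ) : opG J f C v x ≤ opG J f C v' x := by
  refine add_le_add ?_ (g_mono hL (h x))
  exact integral_mono (integrable_J_mul hK m b x) (integrable_J_mul hK m' b' x)
    fun y => mul_le_mul_of_nonneg_left (h _) (hK.1 y)

lemma opG_bounds (hK : K1 J) (hL : ∀ u v : ℝ, |f u - f v| ≤ C * |u - v|)
    (f0 : f 0 = 0) (f1 : f 1 = 0) {w : ℝ → ℝ → ℝ} (hw : Adm w) (t x : ℝ) :
    0 ≤ opG J f C (w t) x ∧ opG J f C (w t) x ≤ 1 + C := by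
  have h1 := integral_J_ge hK (hw.meas t) (hw.bdd t) (hw.2.1 t) x
  have h2 := integral_J_le hK (hw.meas t) (hw.bdd t) (hw.2.2 t) x
  have h3 := g_mono hL (hw.2.1 t x)
  have h4 := g_mono hL (hw.2.2 t x)
  rw [f0] at h3
  rw [f1] at h4
  constructor <;> simp only [opG] <;> linarith

lemma opG_meas (hK : K1 J) (hL : ∀ u v : ℝ, |f u - f v| ≤ C * |u - v|)
    {w : ℝ → ℝ → ℝ} (hw : Adm w) : Measurable (fun p : ℝ × ℝ => opG J f C (w p.1) p.2) := by
  have hf : Measurable f := (lip_cont hL).measurable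
  have hw1 : Measurable (fun p : ℝ × ℝ => w p.1 p.2) := hw.1
  refine Measurable.add ?_ ((hf.comp hw1).add (hw1.const_mul C))
  set J' := hK.2.2.1.aestronglyMeasurable.mk J with hJ'
  have hm : StronglyMeasurable J' := hK.2.2.1.aestronglyMeasurable.stronglyMeasurable_mk
  have e : (fun p : ℝ × ℝ => ∫ y, J y * w p.1 (p.2 - y)) =
      fun p : ℝ × ℝ => ∫ y, J' y * w p.1 (p.2 - y) := by
    ext p
    apply integral_congr_ae
    filter_upwards [hK.2.2.1.aestronglyMeasurable.ae_eq_mk] with y hy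
    rw [hy]
  rw [e]
  have h2 : Measurable (fun q : (ℝ × ℝ) × ℝ => J' q.2 * w q.1.1 (q.1.2 - q.2)) := by
    refine (hm.measurable.comp measurable_snd).mul ?_
    exact hw1.comp (f := fun q : (ℝ × ℝ) × ℝ => (q.1.1, q.1.2 - q.2)) (by fun_prop)
  exact (StronglyMeasurable.integral_prod_right (f := fun (p : ℝ × ℝ) y => J' y * w p.1 (p.2 - y))
    h2.stronglyMeasurable).measurable

lemma hasDerivAt_expK (K s : ℝ) : HasDerivAt (fun r => Real.exp (K * r)) (Real.exp (K * s) * K) s := by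
  exact (((hasDerivAt_id s).const_mul K).exp).congr_deriv (by simp only [id, mul_one])

lemma duh_intervalIntegrable (hK : K1 J) (hL : ∀ u v : ℝ, |f u - f v| ≤ C * |u - v|)
    (f0 : f 0 = 0) (f1 : f 1 = 0) {w : ℝ → ℝ → ℝ} (hw : Adm w) (x a b : ℝ) :
    IntervalIntegrable (fun s => Real.exp ((1 + C) * s) * opG J f C (w s) x) volume a b := by
  have hc : Continuous fun s => Real.exp ((1 + C) * s) * (1 + C) := by fun_prop
  refine (hc.intervalIntegrable a b).mono_fun' ?_ (ae_of_all _ fun s => ?_)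
  · refine Measurable.aestronglyMeasurable ?_
    refine Measurable.mul (by fun_prop) ?_
    exact (opG_meas hK hL hw).comp (f := fun s : ℝ => (s, x)) (by fun_prop)
  · have := opG_bounds hK hL f0 f1 hw s x
    beta_reduce
    rw [Real.norm_eq_abs, abs_of_nonneg (mul_nonneg (Real.exp_pos _).le this.1)]
    exact mul_le_mul_of_nonneg_left this.2 (Real.exp_pos _).le

lemma opPhi_mono (hK : K1 J) (hL : ∀ u v : ℝ, |f u - f v| ≤ C * |u - v|)
    (f0 : f 0 = 0) (f1 : f 1 = 0) {w w' : ℝ → ℝ → ℝ} (hw : Adm w) (hw' : Adm w')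
    (h : ∀ t x, w t x ≤ w' t x) (t x : ℝ) : opPhi J f C u0 w t x ≤ opPhi J f C u0 w' t x := by
  refine mul_le_mul_of_nonneg_left (add_le_add le_rfl ?_) (Real.exp_pos _).le
  refine intervalIntegral.integral_mono_on (le_max_right _ _) (duh_intervalIntegrable hK hL f0 f1 hw x _ _)
    (duh_intervalIntegrable hK hL f0 f1 hw' x _ _) fun s _ => ?_
  exact mul_le_mul_of_nonneg_left (opG_mono hK hL (hw.meas s) (hw'.meas s) (hw.bdd s) (hw'.bdd s)
    (h s) x) (Real.exp_pos _).le

lemma opPhi_adm (hK : K1 J) (hL : ∀ u v : ℝ, |f u - f v| ≤ C * |u - v|)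
    (f0 : f 0 = 0) (f1 : f 1 = 0) (m0 : Measurable u0) (b0 : ∀ x, 0 ≤ u0 x) (b1 : ∀ x, u0 x ≤ 1)
    {w : ℝ → ℝ → ℝ} (hw : Adm w) : Adm (opPhi J f C u0 w) := by
  refine ⟨?_, fun t x => ?_, fun t x => ?_⟩
  · have e : Function.uncurry (opPhi J f C u0 w) = fun p : ℝ × ℝ =>
        Real.exp (-((1 + C) * max p.1 0)) * (u0 p.2 + ∫ s,
          (if 0 < s ∧ s ≤ max p.1 0 then Real.exp ((1 + C) * s) * opG J f C (w s) p.2 else 0)) := by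
      ext p
      simp only [Function.uncurry, opPhi]
      rw [intervalIntegral.integral_of_le (le_max_right _ _), ← integral_indicator measurableSet_Ioc]
      congr 3
      ext s
      simp only [indicator, mem_Ioc]
    rw [e]
    refine Measurable.mul (by fun_prop) (Measurable.add (m0.comp measurable_snd) ?_)
    have h2 : Measurable (fun q : (ℝ × ℝ) × ℝ => if 0 < q.2 ∧ q.2 ≤ max q.1.1 0 then
        Real.exp ((1 + C) * q.2) * opG J f C (w q.2) q.1.2 else 0) := by
      refine Measurable.ite ?_ ?_ measurable_const
      · exact (measurableSet_lt measurable_const measurable_snd).inter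
          (measurableSet_le measurable_snd (by fun_prop))
      · refine Measurable.mul (by fun_prop) ?_
        exact (opG_meas hK hL hw).comp (f := fun q : (ℝ × ℝ) × ℝ => (q.2, q.1.2)) (by fun_prop)
    exact (StronglyMeasurable.integral_prod_right (f := fun (p : ℝ × ℝ) s =>
      if 0 < s ∧ s ≤ max p.1 0 then Real.exp ((1 + C) * s) * opG J f C (w s) p.2 else 0)
      h2.stronglyMeasurable).measurable
  · refine mul_nonneg (Real.exp_pos _).le (add_nonneg (b0 x) ?_)
    exact intervalIntegral.integral_nonneg (le_max_right _ _) fun s _ =>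
      mul_nonneg (Real.exp_pos _).le (opG_bounds hK hL f0 f1 hw s x).1
  · have hc : Continuous fun s => Real.exp ((1 + C) * s) * (1 + C) := by fun_prop
    have h1 : ∫ s in (0:ℝ)..(max t 0), Real.exp ((1 + C) * s) * opG J f C (w s) x ≤
        ∫ s in (0:ℝ)..(max t 0), Real.exp ((1 + C) * s) * (1 + C) :=
      intervalIntegral.integral_mono_on (le_max_right _ _) (duh_intervalIntegrable hK hL f0 f1 hw x _ _)
        (hc.intervalIntegrable _ _) fun s _ =>
          mul_le_mul_of_nonneg_left (opG_bounds hK hL f0 f1 hw s x).2 (Real.exp_pos _).le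
    rw [intervalIntegral.integral_eq_sub_of_hasDerivAt (fun s _ => hasDerivAt_expK (1 + C) s)
      (hc.intervalIntegrable _ _)] at h1
    simp only [mul_zero, Real.exp_zero] at h1
    have h2 : u0 x + ∫ s in (0:ℝ)..(max t 0), Real.exp ((1 + C) * s) * opG J f C (w s) x ≤
      Real.exp ((1 + C) * max t 0) := by linarith [b1 x]
    have h3 := mul_le_mul_of_nonneg_left h2 (Real.exp_pos (-((1 + C) * max t 0))).le
    rw [← Real.exp_add, neg_add_cancel, Real.exp_zero] at h3
    exact h3

lemma opG_tendsto (hK : K1 J) (hL : ∀ u v : ℝ, |f u - f v| ≤ C * |u - v|) {ι : Type*} {l : Filter ι}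
    [l.IsCountablyGenerated] {v : ι → ℝ → ℝ} {v' : ℝ → ℝ}
    (m : ∀ n, Measurable (v n)) (b : ∀ n x, |v n x| ≤ 1)
    (h : ∀ x, Tendsto (fun n => v n x) l (nhds (v' x))) (x : ℝ) :
    Tendsto (fun n => opG J f C (v n) x) l (nhds (opG J f C v' x)) := by
  refine Tendsto.add ?_ ((((lip_cont hL).tendsto _).comp (h x)).add ((h x).const_mul C))
  refine tendsto_integral_filter_of_dominated_convergence J ?_ ?_ hK.2.2.1 ?_
  · exact Eventually.of_forall fun n => (integrable_J_mul hK (m n) (b n) x).aestronglyMeasurable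
  · refine Eventually.of_forall fun n => ae_of_all _ fun y => ?_
    rw [norm_mul, Real.norm_eq_abs, Real.norm_eq_abs, abs_of_nonneg (hK.1 y)]
    exact mul_le_of_le_one_right (hK.1 y) (b _ _)
  · exact ae_of_all _ fun y => (h (x - y)).const_mul (J y)

lemma exists_fixed (hK : K1 J) (hL : ∀ u v : ℝ, |f u - f v| ≤ C * |u - v|)
    (f0 : f 0 = 0) (f1 : f 1 = 0) (m0 : Measurable u0) (b0 : ∀ x, 0 ≤ u0 x) (b1 : ∀ x, u0 x ≤ 1) :
    ∃ w, Adm w ∧ ∀ t x, w t x = opPhi J f C u0 w t x := by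
  set W : ℕ → ℝ → ℝ → ℝ := fun n => (opPhi J f C u0)^[n] (fun _ _ => 0) with hW
  have Ws : ∀ n, W (n + 1) = opPhi J f C u0 (W n) := fun n => Function.iterate_succ_apply' _ _ _
  have Wa : ∀ n, Adm (W n) := by
    intro n
    induction n with
    | zero => exact ⟨measurable_const, fun _ _ => le_rfl, fun _ _ => zero_le_one⟩
    | succ n ih => rw [Ws]; exact opPhi_adm hK hL f0 f1 m0 b0 b1 ih
  have Wm : ∀ n t x, W n t x ≤ W (n + 1) t x := by
    intro n
    induction n with
    | zero => exact (Wa 1).2.1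
    | succ n ih =>
      intro t x
      rw [Ws (n + 1)]
      conv_lhs => rw [Ws n]
      exact opPhi_mono hK hL f0 f1 (Wa n) (Wa (n + 1)) ih t x
  have lim : ∀ t x, Tendsto (fun n => W n t x) atTop (nhds (⨆ n, W n t x)) := fun t x =>
    tendsto_atTop_ciSup (monotone_nat_of_le_succ fun n => Wm n t x)
      ⟨1, by rintro _ ⟨n, rfl⟩; exact (Wa n).2.2 t x⟩
  have adm : Adm (fun t x => ⨆ n, W n t x) := by
    refine ⟨?_, fun t x => ?_, fun t x => ?_⟩
    · exact measurable_of_tendsto_metrizable (fun n => (Wa n).1)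
        (tendsto_pi_nhds.2 fun p => lim p.1 p.2)
    · exact ge_of_tendsto (lim t x) (Eventually.of_forall fun n => (Wa n).2.1 t x)
    · exact le_of_tendsto (lim t x) (Eventually.of_forall fun n => (Wa n).2.2 t x)
  refine ⟨_, adm, fun t x => ?_⟩
  refine tendsto_nhds_unique ((lim t x).comp (tendsto_add_atTop_nat 1)) ?_
  have : (fun n => W n t x) ∘ (fun a => a + 1) = fun n => opPhi J f C u0 (W n) t x := by
    ext n; simp only [Function.comp, Ws]
  rw [this]
  refine Tendsto.const_mul _ (Tendsto.const_add _ ?_)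
  have hc : Continuous fun s => Real.exp ((1 + C) * s) * (1 + C) := by fun_prop
  refine intervalIntegral.tendsto_integral_filter_of_dominated_convergence
    (fun s => Real.exp ((1 + C) * s) * (1 + C)) ?_ ?_ (hc.intervalIntegrable _ _) ?_
  · exact Eventually.of_forall fun n =>
      ((duh_intervalIntegrable hK hL f0 f1 (Wa n) x _ _).def').aestronglyMeasurable
  · refine Eventually.of_forall fun n => ae_of_all _ fun s _ => ?_
    have := opG_bounds hK hL f0 f1 (Wa n) s x
    rw [Real.norm_eq_abs, abs_of_nonneg (mul_nonneg (Real.exp_pos _).le this.1)]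
    exact mul_le_mul_of_nonneg_left this.2 (Real.exp_pos _).le
  · refine ae_of_all _ fun s _ => Tendsto.const_mul _ ?_
    exact opG_tendsto hK hL (fun n => (Wa n).meas s) (fun n => (Wa n).bdd s) (lim s) x

lemma exists_sol (hK : K1 J) (hL : ∀ u v : ℝ, |f u - f v| ≤ C * |u - v|)
    (f0 : f 0 = 0) (f1 : f 1 = 0) (m0 : Measurable u0) (b0 : ∀ x, 0 ≤ u0 x) (b1 : ∀ x, u0 x ≤ 1) :
    ∃ w, IsBddSol J f u0 w := by
  obtain ⟨w, hw, hfix⟩ := exists_fixed hK hL f0 f1 m0 b0 b1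
  have hcont : ∀ x, Continuous fun t => w t x := by
    intro x
    have h1 := intervalIntegral.continuous_primitive (duh_intervalIntegrable hK hL f0 f1 hw x) 0
    have h2 : (fun t => w t x) = fun t => Real.exp (-((1 + C) * max t 0)) *
      (u0 x + ∫ s in (0:ℝ)..(max t 0), Real.exp ((1 + C) * s) * opG J f C (w s) x) := by
      ext t; exact hfix t x
    rw [h2]
    exact Continuous.mul (by fun_prop) (continuous_const.add (h1.comp (by fun_prop)))
  have hG : ∀ x, Continuous fun s => opG J f C (w s) x := fun x =>
    continuous_iff_continuousAt.2 fun s =>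
      opG_tendsto hK hL (fun s => hw.meas s) (fun s => hw.bdd s) (fun y => (hcont y).tendsto s) x
  refine ⟨w, ⟨1, fun t x _ => hw.bdd t x⟩, fun t _ => hw.meas t, fun x => (hcont x).continuousOn,
    fun x => ?_, fun t x ht => ?_⟩
  · rw [hfix]; simp [opPhi]
  · have hg : Continuous fun s => Real.exp ((1 + C) * s) * opG J f C (w s) x :=
      Continuous.mul (by fun_prop) (hG x)
    have d1 : HasDerivAt (fun r => ∫ s in (0:ℝ)..r, Real.exp ((1 + C) * s) * opG J f C (w s) x)
        (Real.exp ((1 + C) * t) * opG J f C (w t) x) t :=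
      intervalIntegral.integral_hasDerivAt_right (hg.intervalIntegrable _ _)
        (hg.stronglyMeasurableAtFilter _ _) hg.continuousAt
    have d2 := (hasDerivAt_expK (-(1 + C)) t).mul (d1.const_add (u0 x))
    have ev : (fun s => w s x) =ᶠ[nhds t] (fun r => Real.exp (-(1 + C) * r)) *
        (fun r => u0 x + ∫ s in (0:ℝ)..r, Real.exp ((1 + C) * s) * opG J f C (w s) x) := by
      filter_upwards [eventually_gt_nhds ht] with r hr
      rw [hfix r x, opPhi, max_eq_left hr.le]
      simp only [Pi.mul_apply, neg_mul]
    have hv := ev.eq_of_nhds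
    refine (d2.congr_of_eventuallyEq ev).congr_deriv ?_
    simp only [Pi.mul_apply] at hv
    rw [integral_J_sub hK (hw.meas t) (hw.bdd t)]
    have e1 : Real.exp (-(1 + C) * t) * Real.exp ((1 + C) * t) = 1 := by
      rw [← Real.exp_add, ← Real.exp_zero]; congr 1; ring
    calc _ = -(1 + C) * (Real.exp (-(1 + C) * t) * (u0 x +
          ∫ s in (0:ℝ)..t, Real.exp ((1 + C) * s) * opG J f C (w s) x)) +
          (Real.exp (-(1 + C) * t) * Real.exp ((1 + C) * t)) * opG J f C (w t) x := by ring
      _ = _ := by rw [← hv, e1, opG]; ring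
end

/-- partial sums of the exponential series of the jump operator -/
def serS (J : ℝ → ℝ) (L : ℝ) (N : ℕ) (t x : ℝ) : ℝ :=
  ∑ n ∈ Finset.range (N + 1), t ^ n / (Nat.factorial n : ℝ) * winA J L n x

lemma serS_hasDerivAt (J : ℝ → ℝ) (L : ℝ) (N : ℕ) (t x : ℝ) :
    HasDerivAt (fun s => serS J L N s x)
      (∑ n ∈ Finset.range N, t ^ n / (Nat.factorial n : ℝ) * winA J L (n + 1) x) t := by
  induction N with
  | zero =>
    have : (fun s => serS J L 0 s x) = fun _ => winA J L 0 x := by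
      ext s; simp [serS]
    rw [this]; simpa using hasDerivAt_const t (winA J L 0 x)
  | succ N ih =>
    have e : (fun s => serS J L (N + 1) s x) = fun s => serS J L N s x +
        s ^ (N + 1) / (Nat.factorial (N + 1) : ℝ) * winA J L (N + 1) x := by
      ext s; rw [serS, Finset.sum_range_succ]; rfl
    rw [e, Finset.sum_range_succ]
    refine ih.add ?_
    refine (((hasDerivAt_pow (N + 1) t).div_const _).mul_const _).congr_deriv ?_
    rw [Nat.factorial_succ]
    push_cast
    have : ((N:ℝ) + 1) ≠ 0 := by positivity
    have : (Nat.factorial N : ℝ) ≠ 0 := by positivity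
    field_simp

lemma serS_facts {J : ℝ → ℝ} (hK : K1 J) (L : ℝ) (N : ℕ) {t : ℝ} (ht : 0 ≤ t) :
    (∀ x, 0 ≤ serS J L N t x) ∧ (∀ x, serS J L N t x ≤ Real.exp t) ∧ Measurable (serS J L N t) := by
  refine ⟨fun x => ?_, fun x => ?_, ?_⟩
  · exact Finset.sum_nonneg fun n _ => mul_nonneg (by positivity) ((winA_facts hK L n).1 x)
  · refine le_trans (Finset.sum_le_sum fun n _ => ?_) (Real.sum_le_exp_of_nonneg ht (N + 1))
    exact mul_le_of_le_one_right (by positivity) ((winA_facts hK L n).2.1 x)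
  · exact Finset.measurable_sum _ fun n _ => (winA_facts hK L n).2.2.const_mul _

lemma serS_integral {J : ℝ → ℝ} (hK : K1 J) (L : ℝ) (N : ℕ) {t : ℝ} (ht : 0 ≤ t) (x : ℝ) :
    ∑ n ∈ Finset.range N, t ^ n / (Nat.factorial n : ℝ) * winA J L (n + 1) x ≤
      ∫ y, J y * serS J L N t (x - y) := by
  have e : ∫ y, J y * serS J L N t (x - y) =
      ∑ n ∈ Finset.range (N + 1), t ^ n / (Nat.factorial n : ℝ) * winA J L (n + 1) x := by
    have : (fun y => J y * serS J L N t (x - y)) = fun y => ∑ n ∈ Finset.range (N + 1),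
        t ^ n / (Nat.factorial n : ℝ) * (J y * winA J L n (x - y)) := by
      ext y
      rw [serS, Finset.mul_sum]
      exact Finset.sum_congr rfl fun n _ => by ring
    rw [this, integral_finsetSum]
    · exact Finset.sum_congr rfl fun n _ => by rw [integral_const_mul, winA_succ hK]
    · intro n _
      obtain ⟨a1, a2, a3⟩ := winA_facts hK L n
      exact (integrable_J_mul hK a3 (M := 1)
        (fun x => abs_le.2 ⟨by linarith [a1 x], a2 x⟩) x).const_mul _
  rw [e, Finset.sum_range_succ]
  have := mul_nonneg (show 0 ≤ t ^ N / (Nat.factorial N : ℝ) by positivity)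
    ((winA_facts hK L (N + 1)).1 x)
  linarith

lemma sub_lower {J f : ℝ → ℝ} (hK : K1 J) {C θ rm δ ε L T : ℝ} (hC : 0 ≤ C)
    (hL : ∀ u v : ℝ, |f u - f v| ≤ C * |u - v|) (f0 : f 0 = 0) (hrm : 0 < rm) (hθ : 0 < θ)
    (hf : ∀ u ∈ Set.Icc 0 δ, rm * (u - θ) ≤ f u) (hε : 0 < ε) (hT : 0 ≤ T)
    (hTe : Real.exp (rm * T) * ε ≤ δ - θ) {u : ℝ → ℝ → ℝ}
    (hs : IsBddSol J f (stepInit (θ + ε) L) u) (N : ℕ) (x : ℝ) :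
    θ + Real.exp (rm * T) * ((θ + ε) * (Real.exp (-T) * serS J L N T x) - θ) ≤ u T x := by
  have hu0 : ∀ t, 0 ≤ t → ∀ x, 0 ≤ u t x := fun t ht x => sol_nonneg hK hC hL f0 hs
    (fun x => indicator_nonneg (fun _ _ => by positivity) x) t ht x
  set v : ℝ → ℝ → ℝ := fun t x => Real.exp (-t) * serS J L N t x with hv
  have v0 : ∀ t, 0 ≤ t → ∀ x, 0 ≤ v t x := fun t ht x =>
    mul_nonneg (Real.exp_pos _).le ((serS_facts hK L N ht).1 x)
  have v1 : ∀ t, 0 ≤ t → ∀ x, v t x ≤ 1 := fun t ht x => by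
    have := mul_le_mul_of_nonneg_left ((serS_facts hK L N ht).2.1 x) (Real.exp_pos (-t)).le
    rw [← Real.exp_add, neg_add_cancel, Real.exp_zero] at this
    exact this
  have vm : ∀ t, 0 ≤ t → Measurable (v t) := fun t ht => (serS_facts hK L N ht).2.2.const_mul _
  have vb : ∀ t, 0 ≤ t → ∀ x, |v t x| ≤ 1 := fun t ht x =>
    abs_le.2 ⟨by linarith [v0 t ht x], v1 t ht x⟩
  have vd : ∀ t x, 0 < t → ∃ d, HasDerivAt (fun s => v s x) d t ∧
      d ≤ (∫ y, J y * v t (x - y)) - v t x := by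
    intro t x ht
    refine ⟨_, ((hasDerivAt_neg t).exp).mul (serS_hasDerivAt J L N t x), ?_⟩
    have e : ∫ y, J y * v t (x - y) = Real.exp (-t) * ∫ y, J y * serS J L N t (x - y) := by
      rw [← integral_const_mul]
      congr 1; ext y; simp only [hv]; ring
    have := mul_le_mul_of_nonneg_left (serS_integral hK L N ht.le x) (Real.exp_pos (-t)).le
    rw [e]
    simp only [hv]
    linarith
  set w : ℝ → ℝ → ℝ := fun t x => θ + Real.exp (rm * t) * ((θ + ε) * v t x - θ) with hw
  have hmono : ∀ t, t ≤ T → Real.exp (rm * t) ≤ Real.exp (rm * T) := fun t ht =>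
    Real.exp_le_exp.2 (mul_le_mul_of_nonneg_left ht hrm.le)
  have vc : ∀ x, Continuous fun t => v t x := fun x => by
    refine Continuous.mul (by fun_prop) ?_
    exact continuous_iff_continuousAt.2 fun t => (serS_hasDerivAt J L N t x).continuousAt
  have nw : NiceOn T w := by
    refine ⟨⟨θ + Real.exp (rm * T) * (θ + ε), fun t h1 h2 x => ?_⟩, fun t h1 _ => ?_, fun x => ?_⟩
    · have a1 : |(θ + ε) * v t x - θ| ≤ θ + ε := by
        have b1 := mul_nonneg (show 0 ≤ θ + ε by positivity) (v0 t h1 x)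
        have b2 := mul_le_of_le_one_right (show 0 ≤ θ + ε by positivity) (v1 t h1 x)
        exact abs_le.2 ⟨by linarith, by linarith⟩
      refine (abs_add_le _ _).trans (add_le_add (abs_of_pos hθ).le ?_)
      rw [abs_mul, abs_of_pos (Real.exp_pos _)]
      exact mul_le_mul (hmono t h2) a1 (abs_nonneg _) (Real.exp_pos _).le
    · exact (((vm t h1).const_mul _).sub_const _).const_mul _ |>.const_add _
    · have := vc x
      exact Continuous.continuousOn (by fun_prop)
  refine compare hK hC (T := T) (u := fun t x => u (0 + t) x) (w := w)
    (F := fun t x => f (u (0 + t) x)) (G := fun t x => rm * (w t x - θ)) (sol_nice hs le_rfl T) nw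
    ?_ (fun s x h1 _ => sol_deriv hK hs le_rfl s x h1) ?_ ?_ T hT le_rfl x |>.trans (by simp)
  · intro x
    simp only [add_zero, hs.2.2.2.1, hw, hv, serS, Finset.sum_range_succ', winA_zero, stepInit]
    by_cases hx : x ∈ Ioo (-L) L <;> simp [hx]
  · intro t x h1 h2
    obtain ⟨d, d1, d2⟩ := vd t x h1
    refine ⟨_, (((hasDerivAt_expK rm t).mul ((d1.const_mul (θ + ε)).sub_const θ)).const_add θ), ?_⟩
    have e : ∫ y, J y * w t (x - y) =
        θ + Real.exp (rm * t) * ((θ + ε) * (∫ y, J y * v t (x - y)) - θ) := by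
      have : (fun y => J y * w t (x - y)) = fun y => J y * (θ - Real.exp (rm * t) * θ) +
          Real.exp (rm * t) * (θ + ε) * (J y * v t (x - y)) := by
        ext y; simp only [hw]; ring
      rw [this, integral_add (hK.2.2.1.mul_const _)
        ((integrable_J_mul hK (vm t h1.le) (vb t h1.le) x).const_mul _), integral_J_const hK,
        integral_const_mul]
      ring
    rw [e]
    have := mul_le_mul_of_nonneg_left d2
      (show 0 ≤ Real.exp (rm * t) * (θ + ε) from mul_nonneg (Real.exp_pos _).le (by positivity))
    simp only [hw]
    linarith
  · intro t x h1 h2 hlt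
    have a1 := lip_ge hL hlt
    have a2 : rm * (w t x - θ) ≤ f (w t x) := by
      refine hf _ ⟨?_, ?_⟩
      · have := hu0 (0 + t) (by linarith) x
        exact this.trans hlt.le
      · have b1 : (θ + ε) * v t x - θ ≤ ε := by
          have := mul_le_of_le_one_right (show 0 ≤ θ + ε by positivity) (v1 t h1.le x)
          linarith
        have b2 := mul_le_mul_of_nonneg_left b1 (Real.exp_pos (rm * t)).le
        have b3 := mul_le_mul_of_nonneg_right (hmono t h2) hε.le
        simp only [hw]
        linarith
    linarith

lemma sub_lower' {J f : ℝ → ℝ} (hK : K1 J) {C θ rm δ ε L T l : ℝ} (hC : 0 ≤ C)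
    (hL : ∀ u v : ℝ, |f u - f v| ≤ C * |u - v|) (f0 : f 0 = 0) (hrm : 0 < rm) (hθ : 0 < θ)
    (hf : ∀ u ∈ Set.Icc 0 δ, rm * (u - θ) ≤ f u) (hε : 0 < ε) (hT : 0 ≤ T)
    (hTe : Real.exp (rm * T) * ε ≤ δ - θ) {u : ℝ → ℝ → ℝ}
    (hs : IsBddSol J f (stepInit (θ + ε) L) u) (x : ℝ) (hx : |x| + l ≤ L) :
    θ + Real.exp (rm * T) * ((θ + ε) * (1 - poisH J T l) - θ) ≤ u T x := by
  have hsum := (hasSum_exp' T).sub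
    (summable_pois hT (tailW_nonneg J · l) (tailW_le_one hK · l)).hasSum
  have lim := ((hsum.tendsto_sum_nat.comp (tendsto_add_atTop_nat 1)).const_mul (Real.exp (-T)))
  have e1 : Real.exp (-T) * Real.exp T = 1 := by rw [← Real.exp_add]; simp
  rw [mul_sub, e1] at lim
  have lim2 := ((((lim.const_mul (θ + ε)).sub_const θ).const_mul (Real.exp (rm * T))).const_add θ)
  refine le_of_tendsto lim2 (Eventually.of_forall fun N => ?_)
  refine le_trans ?_ (sub_lower hK hC hL f0 hrm hθ hf hε hT hTe hs N x)
  simp only [Function.comp]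
  have : ∑ i ∈ Finset.range (N + 1), (T ^ i / (Nat.factorial i : ℝ) -
      T ^ i / (Nat.factorial i : ℝ) * tailW J i l) ≤ serS J L N T x := by
    refine Finset.sum_le_sum fun n _ => ?_
    have := mul_le_mul_of_nonneg_left (winA_ge hK hx n)
      (show 0 ≤ T ^ n / (Nat.factorial n : ℝ) by positivity)
    linarith
  have p1 := Real.exp_pos (rm * T)
  have p2 := Real.exp_pos (-T)
  gcongr

/-- **Theorem (Propagation).** Under (K1), Assumption (F) (with constants `rm, δ`) and the
propagation assumption (P), for any `α ∈ (0, δ-θ)` and `m ∈ (0,1)` there is `ε₀ > 0` such that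
for all `ε ∈ (0, ε₀)` and every `L > 0` with
`ε/(2(θ+ε)) ≥ e^{-T_ε} ∑_{i≥1} (T_εⁱ/i!) R_i((1-m)L)`, where `T_ε = (1/rm) ln(2α/ε)`,
one has `L_ε^prop ≤ L`. -/
theorem propagation_criterion
    (J f : ℝ → ℝ) (θ rm δ : ℝ)
    (hK1 : K1 J)
    (hθ : θ ∈ Set.Ioo (0:ℝ) 1) (hF : AssumptionF f θ rm δ)
    (hP : ∀ ε, 0 < ε → ε ≤ 1 - θ → ∃ L, 0 < L ∧
      ∀ u, IsBddSol J f (stepInit (θ + ε) L) u → Propagates u) :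
    ∀ α, 0 < α → α < δ - θ → ∀ m, 0 < m → m < 1 →
      ∃ ε₀ > 0, ∀ ε, 0 < ε → ε < ε₀ → ∀ L, 0 < L →
        Real.exp (-((1/rm) * Real.log (2*α/ε))) *
            ∑' n : ℕ, ((1/rm) * Real.log (2*α/ε)) ^ (n + 1) / (Nat.factorial (n + 1) : ℝ) *
              tailR J n ((1 - m) * L)
          ≤ ε / (2 * (θ + ε)) →
        sInf {L' : ℝ | 0 < L' ∧
            ∀ u, IsBddSol J f (stepInit (θ + ε) L') u → Propagates u} ≤ L := by
  intro α hα hαδ m hm hm1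
  obtain ⟨⟨C, hC, hL⟩, f0, -, f1, -, -, hrm, hδ, hf⟩ := hF
  obtain ⟨hθ0, hθ1⟩ := hθ
  have hδ1 := hδ.2
  set s : ℝ := (1 / rm) * Real.log 2 with hs
  have hs0 : 0 ≤ s := mul_nonneg (by positivity) (Real.log_nonneg (by norm_num))
  set q : ℝ := Real.exp (-s) with hq
  have hq0 : 0 < q := Real.exp_pos _
  set α' : ℝ := α * (q / (1 + q)) with hα'
  have hα'0 : 0 < α' := by positivity
  have hα'1 : α' ≤ α := mul_le_of_le_one_right hα.le ((div_le_one (by positivity)).2 (by linarith))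
  obtain ⟨Λ, hΛ, hprop⟩ := hP α' hα'0 (by linarith)
  obtain ⟨w, hw⟩ := exists_sol (u0 := stepInit (θ + α') Λ) hK1 hL f0 f1
    (measurable_const.indicator measurableSet_Ioo)
    (fun x => indicator_nonneg (fun _ _ => by positivity) x)
    (fun x => indicator_le' (fun _ _ => by linarith) (fun _ _ => zero_le_one) x)
  have hwp := hprop w hw
  obtain ⟨κ, hκ, T0, hT0, hlow⟩ := poisH_lower hK1 ((1 - m) * (Λ / m))
  refine ⟨min α (min (θ * κ) (2 * α * Real.exp (-(rm * T0)))), by positivity, ?_⟩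
  intro ε hε hεlt L hLpos hcond
  obtain ⟨e1, e2⟩ := lt_min_iff.1 hεlt
  obtain ⟨e2, e3⟩ := lt_min_iff.1 e2
  set T' : ℝ := (1 / rm) * Real.log (α / ε) with hT'
  have hlog : Real.log (2 * α / ε) = Real.log (α / ε) + Real.log 2 := by
    rw [mul_div_assoc, Real.log_mul (by norm_num) (by positivity)]; ring
  have hT : (1 / rm) * Real.log (2 * α / ε) = T' + s := by rw [hlog, hT', hs]; ring
  have hT'0 : 0 ≤ T' := mul_nonneg (by positivity) (Real.log_nonneg ((one_le_div hε).2 e1.le))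
  have hexp : Real.exp (rm * T') = α / ε := by
    rw [hT', ← mul_assoc, mul_one_div_cancel hrm.ne', one_mul, Real.exp_log (by positivity)]
  have hTT0 : T0 ≤ T' + s := by
    have h1 : rm * T0 ≤ Real.log (2 * α / ε) := by
      rw [Real.le_log_iff_exp_le (by positivity), le_div_iff₀ hε]
      have := mul_le_mul_of_nonneg_left e3.le (Real.exp_pos (rm * T0)).le
      have e : Real.exp (rm * T0) * Real.exp (-(rm * T0)) = 1 := by rw [← Real.exp_add]; simp
      calc _ ≤ _ := this
        _ = 2 * α * (Real.exp (rm * T0) * Real.exp (-(rm * T0))) := by ring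
        _ = 2 * α := by rw [e, mul_one]
    rw [← hT, one_div, inv_mul_eq_div, le_div_iff₀ hrm]
    linarith
  have hl : 0 < (1 - m) * L := mul_pos (by linarith) hLpos
  rw [hT, ← poisH_eq hK1 (by positivity) hl] at hcond
  have hmL : Λ ≤ m * L := by
    by_contra! hlt
    have h1 : L ≤ Λ / m := by rw [le_div_iff₀ hm]; linarith
    have h2 := hlow (T' + s) hTT0 ((1 - m) * L) (mul_le_mul_of_nonneg_left h1 (by linarith))
    have h3 := h2.trans hcond
    rw [le_div_iff₀ (by positivity)] at h3
    nlinarith [mul_pos hκ hε, mul_pos hθ0 hκ]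
  have hsh := (poisH_shift hK1 hT'0 hs0 ((1 - m) * L)).trans hcond
  refine csInf_le ⟨0, fun y hy => hy.1.le⟩ ⟨hLpos, fun u hu => ?_⟩
  have hu1 := sol_le_one hK1 hC hL f1 hu
    (fun x => indicator_le' (fun _ _ => by linarith) (fun _ _ => zero_le_one) x)
  have hu0 := sol_nonneg hK1 hC hL f0 hu
    (fun x => indicator_nonneg (fun _ _ => by positivity) x)
  have hbig : ∀ x, |x| ≤ m * L → θ + α' ≤ u T' x := by
    intro x hx
    refine le_trans ?_ (sub_lower' (l := (1 - m) * L) hK1 hC hL f0 hrm hθ0 hf hε hT'0 ?_ hu x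
      (by linarith))
    · rw [hexp]
      have h1 : (θ + ε) * poisH J T' ((1 - m) * L) ≤ ε / (1 + q) := by
        rw [le_div_iff₀ (by positivity)]
        rw [le_div_iff₀ (by positivity)] at hsh
        linarith
      have h2 : ε * (q / (1 + q)) ≤ (θ + ε) * (1 - poisH J T' ((1 - m) * L)) - θ := by
        have : ε * (q / (1 + q)) = ε - ε / (1 + q) := by field_simp; ring
        rw [this]; linarith
      have h3 := mul_le_mul_of_nonneg_left h2 (show 0 ≤ α / ε by positivity)
      have h4 : α / ε * (ε * (q / (1 + q))) = α' := by rw [hα']; field_simp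
      linarith
    · rw [hexp, div_mul_cancel₀ _ hε.ne']; exact hαδ.le
  have hcmp := sol_compare hK1 hC hL hu hw hT'0 (fun x => by
    rw [stepInit]
    by_cases hx : x ∈ Ioo (-Λ) Λ
    · rw [indicator_of_mem hx]
      exact hbig x ((abs_lt.2 hx).le.trans hmL)
    · rw [indicator_of_notMem hx]; exact hu0 T' hT'0 x)
  rw [Propagates, Metric.tendstoLocallyUniformly_iff] at hwp ⊢
  intro η hη x
  obtain ⟨t, ht, hev⟩ := hwp η hη x
  refine ⟨t, ht, ?_⟩
  have hsub : Tendsto (fun r : ℝ => r - T') atTop atTop := tendsto_atTop_add_const_right _ _ tendsto_id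
  filter_upwards [hsub.eventually hev, eventually_ge_atTop T'] with r hr hrT y hy
  have h1 := hr y hy
  have h2 := hcmp (r - T') (by linarith) y
  have h3 := hu1 r (by linarith) y
  rw [add_sub_cancel] at h2
  rw [Real.dist_eq] at h1 ⊢
  rw [abs_of_nonneg (by linarith)] at h1 ⊢
  linarith
end
end

section
/- Let J ∈ C¹(ℝ) be nonnegative, even, with ∫_ℝ J(x) dx = 1, J' ∈ L¹(ℝ), and finite first moment ∫_ℝ |y| J(y) dy < ∞. Let f ∈ C¹(ℝ) be bistable with threshold θ ∈ (0,1) (f(0) = f(θ) = f(1) = 0, f < 0 on (0,θ), f > 0 on (θ,1)), with f'(0) < 0, f'(1) < 0, and ∫_0^1 f(u) du > 0. Assume there exists an increasing traveling wave (c, U) with speed c > 0: U : ℝ → ℝ is increasing and differentiable, 0 ≤ U ≤ 1, U(−∞) = 0, U(+∞) = 1, and (J ∗ U)(x) − U(x) − c·U'(x) + f(U(x)) = 0 for all x ∈ ℝ. Then for each ε ∈ (0, 1−θ] there exists L > 0 such that the solution u_L^ε of the nonlocal equation with initial datum (θ+ε)·1_{(−L,L)} propagates: u_L^ε(t,x)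 → 1 as t → ∞ locally uniformly in x ∈ ℝ. -/
open MeasureTheory Filter Set Asymptotics

noncomputable section

lemma aux_ode (g : ℝ → ℝ) (K B lam : ℝ) (hK : 0 ≤ K) (hB : 0 ≤ B) (hl : 0 < lam)
    (hg : ContinuousOn g (Set.Ici 0)) (hg0 : g 0 ≤ 0)
    (hd : ∀ t, 0 < t → 0 < g t → ∃ d, HasDerivAt g d t ∧ d ≤ K * (B * Real.exp (lam * t))) :
    ∀ t, 0 ≤ t → g t ≤ K * B / lam * Real.exp (lam * t) := by
  intro t ht
  by_contra! hlt
  have hφ0 : ∀ s, 0 ≤ K * B / lam * Real.exp (lam * s) := fun s => by positivity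
  have hcomp : IsCompact {s | s ∈ Set.Icc 0 t ∧ g s ≤ 0} := by
    have h1 : IsClosed (Set.Icc 0 t ∩ g ⁻¹' Set.Iic 0) :=
      (hg.mono (fun x hx => hx.1)).preimage_isClosed_of_isClosed isClosed_Icc isClosed_Iic
    exact isCompact_Icc.of_isClosed_subset h1 (fun x hx => hx.1)
  obtain ⟨s, ⟨⟨hs0, hst⟩, hgs⟩, hsmax⟩ :=
    hcomp.exists_isGreatest ⟨0, ⟨le_rfl, ht⟩, hg0⟩
  have hpos : ∀ r, s < r → r ≤ t → 0 < g r := by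
    intro r hr hrt
    by_contra! h
    exact absurd (hsmax ⟨⟨hs0.trans hr.le, hrt⟩, h⟩) (not_le.mpr hr)
  have hder : ∀ r, HasDerivAt (fun r => K * B / lam * Real.exp (lam * r))
      (K * (B * Real.exp (lam * r))) r := by
    intro r
    have := (((hasDerivAt_id r).const_mul lam).exp).const_mul (K * B / lam)
    refine this.congr_deriv ?_
    simp only [id]
    field_simp
  have hanti : AntitoneOn (fun r => g r - K * B / lam * Real.exp (lam * r)) (Set.Icc s t) := by
    apply antitoneOn_of_deriv_nonpos (convex_Icc s t)
    · refine (hg.mono (fun x hx => hs0.trans hx.1)).sub ?_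
      fun_prop
    · intro r hr
      rw [interior_Icc] at hr
      obtain ⟨d, hd1, hd2⟩ := hd r (hs0.trans_lt hr.1) (hpos r hr.1 hr.2.le)
      exact (hd1.sub (hder r)).differentiableAt.differentiableWithinAt
    · intro r hr
      rw [interior_Icc] at hr
      obtain ⟨d, hd1, hd2⟩ := hd r (hs0.trans_lt hr.1) (hpos r hr.1 hr.2.le)
      have := (hd1.sub (hder r)).deriv
      have h2 : deriv (fun r => g r - K * B / lam * Real.exp (lam * r)) r = _ := this
      rw [h2]; linarith
  have := hanti (left_mem_Icc.mpr hst) (right_mem_Icc.mpr hst) hst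
  simp only at this
  linarith [hφ0 s]

lemma aux_comparison (v : ℝ → ℝ → ℝ) (K B : ℝ) (hK : 0 ≤ K) (hB : 0 ≤ B)
    (hvB : ∀ t x, 0 ≤ t → v t x ≤ B)
    (hc : ∀ x, ContinuousOn (fun t => v t x) (Set.Ici 0))
    (h0 : ∀ x, v 0 x ≤ 0)
    (hd : ∀ t x b, 0 < t → 0 ≤ b → (∀ y, v t y ≤ b) → 0 < v t x →
      ∃ d, HasDerivAt (fun s => v s x) d t ∧ d ≤ K * b) :
    ∀ t x, 0 ≤ t → v t x ≤ 0 := by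
  have key : ∀ n : ℕ, ∀ t x, 0 ≤ t →
      v t x ≤ B * (1/2)^n * Real.exp (2 * (K + 1) * t) := by
    intro n
    induction n with
    | zero =>
      intro t x ht
      have h1 : 1 ≤ Real.exp (2 * (K + 1) * t) := Real.one_le_exp (by positivity)
      have := hvB t x ht
      simp only [pow_zero, mul_one]
      nlinarith
    | succ n ih =>
      intro t x ht
      have h := aux_ode (fun s => v s x) K (B * (1/2)^n) (2 * (K + 1)) hK (by positivity)
        (by positivity) (hc x) (h0 x) (fun s hs hpos => hd s x _ hs (by positivity)
          (fun y => ih s y hs.le) hpos) t ht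
      refine h.trans ?_
      have hKK : K * (B * (1/2)^n) / (2 * (K + 1)) ≤ B * (1/2)^(n+1) := by
        rw [div_le_iff₀ (by positivity), pow_succ]
        have : 0 ≤ B * (1/2:ℝ)^n := by positivity
        nlinarith
      exact mul_le_mul_of_nonneg_right hKK (Real.exp_pos _).le
  intro t x ht
  have hlim : Tendsto (fun n : ℕ => B * (1/2:ℝ)^n * Real.exp (2 * (K + 1) * t)) atTop (nhds 0) := by
    have := ((tendsto_pow_atTop_nhds_zero_of_lt_one (r := (1/2:ℝ)) (by norm_num)
      (by norm_num)).const_mul B).mul_const (Real.exp (2 * (K + 1) * t))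
    simpa using this
  exact ge_of_tendsto' hlim (fun n => key n t x ht)

lemma aux_int (J g : ℝ → ℝ) (M : ℝ) (hJpos : ∀ x, 0 ≤ J x) (hJint : Integrable J)
    (hg : Measurable g) (hM : ∀ x, |g x| ≤ M) : Integrable (fun y => J y * g y) := by
  refine (hJint.mul_const M).mono' (hJint.aestronglyMeasurable.mul hg.aestronglyMeasurable) ?_
  refine Eventually.of_forall fun y => ?_
  rw [norm_mul, Real.norm_eq_abs, Real.norm_eq_abs, abs_of_nonneg (hJpos y)]
  exact mul_le_mul_of_nonneg_left (hM y) (hJpos y)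

lemma aux_int' (J g : ℝ → ℝ) (M x : ℝ) (hJpos : ∀ x, 0 ≤ J x) (hJint : Integrable J)
    (hg : Measurable g) (hM : ∀ x, |g x| ≤ M) : Integrable (fun y => J y * g (x - y)) :=
  aux_int J (fun y => g (x - y)) M hJpos hJint (hg.comp (measurable_const.sub measurable_id))
    (fun y => hM _)

lemma aux_lip (f : ℝ → ℝ) (hf : ContDiff ℝ 1 f) (M : ℝ) :
    ∃ C, 0 < C ∧ ∀ a ∈ Set.Icc (-M) M, ∀ b ∈ Set.Icc (-M) M, |f a - f b| ≤ C * |a - b| := by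
  have hcd : Continuous (deriv f) := hf.continuous_deriv le_rfl
  obtain ⟨C, hC⟩ := (isCompact_Icc (a := -M) (b := M)).exists_bound_of_continuousOn hcd.continuousOn
  refine ⟨|C| + 1, by positivity, fun a ha b hb => ?_⟩
  have := (convex_Icc (-M) M).norm_image_sub_le_of_norm_deriv_le (𝕜 := ℝ) (f := f) (C := |C| + 1)
    (fun x _ => (hf.differentiable (by norm_num)) x)
    (fun x hx => (hC x hx).trans (by linarith [le_abs_self C])) hb ha
  simpa [Real.norm_eq_abs] using this

lemma aux_Upos (J f U : ℝ → ℝ) (c : ℝ)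
    (hJC : Continuous J) (hJpos : ∀ x, 0 ≤ J x)
    (hJint : Integrable J) (hJmass : (∫ x, J x) = 1)
    (hfC1 : ContDiff ℝ 1 f)
    (hUmono : StrictMono U) (hUdiff : Differentiable ℝ U)
    (hU01 : ∀ x, U x ∈ Set.Icc (0:ℝ) 1) (hc : 0 < c)
    (hTW : ∀ x, (∫ y, J y * U (x - y)) - U x - c * deriv U x + f (U x) = 0) (x0 : ℝ) :
    0 < deriv U x0 := by
  have hnn : ∀ x, 0 ≤ deriv U x := fun x => hUmono.monotone.deriv_nonneg
  refine lt_of_le_of_ne (hnn x0) fun hz => ?_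
  -- interval where J is positive
  obtain ⟨p, hp⟩ : ∃ p, 0 < J p := by
    by_contra! h
    have : J = fun _ => 0 := funext fun x => le_antisymm (h x) (hJpos x)
    rw [this] at hJmass; simp at hJmass
  obtain ⟨r, hr, hrJ⟩ : ∃ r > 0, ∀ y, |y - p| ≤ r → J p / 2 ≤ J y := by
    have := Metric.eventually_nhds_iff.mp
      ((hJC.tendsto p).eventually (lt_mem_nhds (half_lt_self hp)))
    obtain ⟨r, hr, h⟩ := this
    exact ⟨r / 2, by positivity, fun y hy => (h (by rw [Real.dist_eq]; linarith)).le⟩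
  have hUc : Continuous U := hUdiff.continuous
  have hUm : Measurable U := hUc.measurable
  have hUb : ∀ x, |U x| ≤ 1 := fun x => abs_le.mpr ⟨by linarith [(hU01 x).1], (hU01 x).2⟩
  set κ := J p / 2 * (U (x0 - p) - U (x0 - (p + r))) with hκ
  have hκpos : 0 < κ := mul_pos (by positivity) (sub_pos.mpr (hUmono (by linarith)))
  have hg : ∀ h, 0 < h → h ≤ r →
      κ * h ≤ (∫ y, J y * U (x0 - y)) - ∫ y, J y * U (x0 - h - y) := by
    intro h hh hhr
    have i1 := aux_int' J U 1 x0 hJpos hJint hUm hUb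
    have i2 := aux_int' J U 1 (x0 - h) hJpos hJint hUm hUb
    rw [← integral_sub i1 i2]
    have s1 : ∫ y in Set.Ioc (p - r) (p + r), (J p / 2) * (U (x0 - y) - U (x0 - h - y)) ≤
        ∫ y in Set.Ioc (p - r) (p + r), (J y * U (x0 - y) - J y * U (x0 - h - y)) := by
      apply setIntegral_mono_on
      · exact (Continuous.integrableOn_Ioc (by fun_prop))
      · exact (i1.sub i2).integrableOn
      · exact measurableSet_Ioc
      · intro y hy
        have h1 : J p / 2 ≤ J y := hrJ y (abs_le.mpr ⟨by linarith [hy.1], by linarith [hy.2]⟩)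
        have h2 : U (x0 - h - y) ≤ U (x0 - y) := hUmono.monotone (by linarith)
        nlinarith
    have s2 : ∫ y in Set.Ioc (p - r) (p + r), (J y * U (x0 - y) - J y * U (x0 - h - y)) ≤
        ∫ y, (J y * U (x0 - y) - J y * U (x0 - h - y)) := by
      apply setIntegral_le_integral (i1.sub i2)
      refine Eventually.of_forall fun y => ?_
      have h2 : U (x0 - h - y) ≤ U (x0 - y) := hUmono.monotone (by linarith)
      have := hJpos y
      show 0 ≤ J y * U (x0 - y) - J y * U (x0 - h - y)
      nlinarith
    refine le_trans ?_ (s1.trans s2)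
    rw [integral_const_mul, hκ, mul_assoc]
    apply mul_le_mul_of_nonneg_left _ (by positivity)
    rw [← intervalIntegral.integral_of_le (by linarith),
      intervalIntegral.integral_sub (Continuous.intervalIntegrable (by fun_prop) _ _)
        (Continuous.intervalIntegrable (by fun_prop) _ _),
      intervalIntegral.integral_comp_sub_left, intervalIntegral.integral_comp_sub_left,
      intervalIntegral.integral_interval_sub_interval_comm' (hUc.intervalIntegrable _ _)
        (hUc.intervalIntegrable _ _) (hUc.intervalIntegrable _ _)]
    have t1 : h * U (x0 - p) ≤ ∫ y in (x0 - h - (p - r))..(x0 - (p - r)), U y := by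
      have : ∫ y in (x0 - h - (p - r))..(x0 - (p - r)), U (x0 - p) ≤
        ∫ y in (x0 - h - (p - r))..(x0 - (p - r)), U y := by
        apply intervalIntegral.integral_mono_on (by linarith) (by simp) (hUc.intervalIntegrable _ _)
        intro y hy
        exact hUmono.monotone (by linarith [hy.1])
      rw [intervalIntegral.integral_const, smul_eq_mul] at this
      linarith
    have t2 : ∫ y in (x0 - h - (p + r))..(x0 - (p + r)), U y ≤ h * U (x0 - (p + r)) := by
      have : ∫ y in (x0 - h - (p + r))..(x0 - (p + r)), U y ≤
        ∫ y in (x0 - h - (p + r))..(x0 - (p + r)), U (x0 - (p + r)) := by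
        apply intervalIntegral.integral_mono_on (by linarith) (hUc.intervalIntegrable _ _) (by simp)
        intro y hy
        exact hUmono.monotone (by linarith [hy.2])
      rw [intervalIntegral.integral_const, smul_eq_mul] at this
      linarith
    linarith
  -- F = U - f ∘ U has zero derivative at x0
  have hF : HasDerivAt (fun x => U x - f (U x)) 0 x0 := by
    have h1 : HasDerivAt U 0 x0 := by
      have := (hUdiff x0).hasDerivAt
      rwa [← hz] at this
    have h2 : HasDerivAt f (deriv f (U x0)) (U x0) :=
      ((hfC1.differentiable (by norm_num)) _).hasDerivAt
    exact (h1.sub (h2.comp x0 h1)).congr_deriv (by simp)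
  have hFo := (hasDerivAt_iff_isLittleO.mp hF).def (c := κ / 2) (by positivity)
  obtain ⟨ρ, hρ, hρ'⟩ := Metric.eventually_nhds_iff.mp hFo
  set h := min r (ρ / 2) with hh
  have hhpos : 0 < h := lt_min hr (by positivity)
  have h1 := hg h hhpos (min_le_left _ _)
  have h2 := @hρ' (x0 - h) (by
    rw [Real.dist_eq, sub_sub_cancel_left, abs_neg, abs_of_pos hhpos]
    exact (min_le_right _ _).trans_lt (by linarith))
  have e1 := hTW x0
  have e2 := hTW (x0 - h)
  have e3 := hnn (x0 - h)
  rw [← hz] at e1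
  simp only [smul_zero, sub_zero, sub_sub_cancel_left, norm_neg, Real.norm_eq_abs,
    abs_of_pos hhpos] at h2
  have h3 := (abs_le.mp h2).1
  nlinarith [mul_nonneg hc.le e3, mul_pos hκpos hhpos]

lemma aux_Ucont (J f U : ℝ → ℝ) (c : ℝ)
    (hJpos : ∀ x, 0 ≤ J x) (hJint : Integrable J)
    (hfC : Continuous f) (hUdiff : Differentiable ℝ U)
    (hU01 : ∀ x, U x ∈ Set.Icc (0:ℝ) 1) (hc : 0 < c)
    (hTW : ∀ x, (∫ y, J y * U (x - y)) - U x - c * deriv U x + f (U x) = 0) :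
    Continuous (deriv U) := by
  have hUc : Continuous U := hUdiff.continuous
  have hUb : ∀ x, |U x| ≤ 1 := fun x => abs_le.mpr ⟨by linarith [(hU01 x).1], (hU01 x).2⟩
  have hg : Continuous (fun x => ∫ y, J y * U (x - y)) := by
    apply MeasureTheory.continuous_of_dominated (bound := J)
    · exact fun x => (aux_int' J U 1 x hJpos hJint hUc.measurable hUb).aestronglyMeasurable
    · intro x
      refine Eventually.of_forall fun y => ?_
      rw [norm_mul, Real.norm_eq_abs, Real.norm_eq_abs, abs_of_nonneg (hJpos y)]
      exact mul_le_of_le_one_right (hJpos y) (hUb _)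
    · exact hJint
    · exact Eventually.of_forall fun y => by fun_prop
  have : deriv U = fun x => ((∫ y, J y * U (x - y)) - U x + f (U x)) / c := by
    funext x
    rw [eq_div_iff hc.ne']
    linarith [hTW x]
  rw [this]
  exact ((hg.sub hUc).add (hfC.comp hUc)).div_const c

lemma aux_Uk (U : ℝ → ℝ) (hUc : Continuous (deriv U)) (hpos : ∀ x, 0 < deriv U x)
    (hUbot : Tendsto U atBot (nhds 0)) (hUtop : Tendsto U atTop (nhds 1))
    (δ : ℝ) (hδ : 0 < δ) :
    ∃ k, 0 < k ∧ ∀ x, δ ≤ U x → U x ≤ 1 - δ → k ≤ deriv U x := by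
  obtain ⟨a, ha⟩ := eventually_atBot.mp (hUbot.eventually (gt_mem_nhds hδ))
  obtain ⟨b, hb⟩ := eventually_atTop.mp (hUtop.eventually (lt_mem_nhds (sub_lt_self 1 hδ)))
  rcases (Set.Icc a b).eq_empty_or_nonempty with he | hne
  · refine ⟨1, one_pos, fun x h1 h2 => ?_⟩
    have hax : a < x := by by_contra! h; linarith [ha x h]
    have hbx : x < b := by by_contra! h; linarith [hb x h]
    have : x ∈ Set.Icc a b := ⟨hax.le, hbx.le⟩
    rw [he] at this; exact this.elim
  · obtain ⟨z, hz, hmin⟩ := isCompact_Icc.exists_isMinOn hne hUc.continuousOn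
    refine ⟨deriv U z, hpos z, fun x h1 h2 => ?_⟩
    have hax : a < x := by by_contra! h; linarith [ha x h]
    have hbx : x < b := by by_contra! h; linarith [hb x h]
    exact hmin ⟨hax.le, hbx.le⟩

lemma aux_near (f : ℝ → ℝ) (hf : ContDiff ℝ 1 f) (z : ℝ) (hz : deriv f z < 0) :
    ∃ μ δ, 0 < μ ∧ 0 < δ ∧ ∀ a b, |a - z| ≤ δ → |b - z| ≤ δ → a ≤ b →
      μ * (b - a) ≤ f a - f b := by
  have hcd : Continuous (deriv f) := hf.continuous_deriv le_rfl
  obtain ⟨r, hr, h⟩ := Metric.eventually_nhds_iff.mp ((hcd.tendsto z).eventually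
    (gt_mem_nhds (show deriv f z < deriv f z / 2 by linarith)))
  refine ⟨-(deriv f z / 2), r / 2, by linarith, by linarith, fun a b ha hb hab => ?_⟩
  have := (convex_Icc (z - r/2) (z + r/2)).image_sub_le_mul_sub_of_deriv_le (f := f)
    (C := deriv f z / 2) hf.continuous.continuousOn
    (hf.differentiable (by norm_num)).differentiableOn
    (fun x hx => (h (by
      have := interior_subset hx
      rw [Real.dist_eq]
      exact (abs_le.mpr ⟨by linarith [this.1], by linarith [this.2]⟩ : |x - z| ≤ r/2).trans_lt
        (by linarith))).le)
    a ⟨by linarith [(abs_le.mp ha).1], by linarith [(abs_le.mp ha).2]⟩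
    b ⟨by linarith [(abs_le.mp hb).1], by linarith [(abs_le.mp hb).2]⟩ hab
  linarith

lemma aux_end (f : ℝ → ℝ) (θ C q0 : ℝ) (hθ : θ ∈ Set.Ioo (0:ℝ) 1)
    (hf : ContDiff ℝ 1 f)
    (hfpos : ∀ u ∈ Set.Ioo θ 1, 0 < f u)
    (hf'0 : deriv f 0 < 0) (hf'1 : deriv f 1 < 0) (hq1 : q0 < 1 - θ) (hC : 0 < C)
    (hlip : ∀ a ∈ Set.Icc (0:ℝ) 1, ∀ b ∈ Set.Icc (0:ℝ) 1, |f a - f b| ≤ C * |a - b|)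
    (hf1 : f 1 = 0) :
    ∃ μ δ, 0 < μ ∧ 0 < δ ∧ ∀ v q, 0 ≤ q → q ≤ q0 → 0 ≤ v - q → v ≤ 1 →
      (v ≤ δ ∨ 1 - δ ≤ v) → μ * q ≤ f (v - q) - f v := by
  obtain ⟨μ0, δ0, hμ0, hδ0, h0⟩ := aux_near f hf 0 hf'0
  obtain ⟨μ1, δ1, hμ1, hδ1, h1⟩ := aux_near f hf 1 hf'1
  obtain ⟨m0, hm0, hm⟩ : ∃ m0, 0 < m0 ∧ ∀ q, δ1 / 2 ≤ q → q ≤ q0 → m0 ≤ f (1 - q) := by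
    rcases (Set.Icc (δ1/2) q0).eq_empty_or_nonempty with he | hne
    · refine ⟨1, one_pos, fun q ha hb => ?_⟩
      have : q ∈ Set.Icc (δ1/2) q0 := ⟨ha, hb⟩
      rw [he] at this; exact this.elim
    · obtain ⟨z, hz, hmin⟩ := isCompact_Icc.exists_isMinOn hne
        (f := fun q => f (1 - q)) (hf.continuous.comp (by fun_prop)).continuousOn
      exact ⟨f (1 - z), hfpos _ ⟨by linarith [hz.2], by linarith [hz.1]⟩,
        fun q ha hb => hmin ⟨ha, hb⟩⟩
  refine ⟨min μ0 (min μ1 (m0 / 2)), min δ0 (min (δ1 / 2) (m0 / (4 * C))), by positivity,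
    by positivity, fun v q hq hqq hvq hv hor => ?_⟩
  have a1 := min_le_left μ0 (min μ1 (m0 / 2))
  have a2 := (min_le_right μ0 (min μ1 (m0 / 2))).trans (min_le_left _ _)
  have a3 := (min_le_right μ0 (min μ1 (m0 / 2))).trans (min_le_right _ _)
  have b1 := min_le_left δ0 (min (δ1 / 2) (m0 / (4 * C)))
  have b2 := (min_le_right δ0 (min (δ1 / 2) (m0 / (4 * C)))).trans (min_le_left _ _)
  have b3 := (min_le_right δ0 (min (δ1 / 2) (m0 / (4 * C)))).trans (min_le_right _ _)
  rcases hor with hle | hge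
  · have := h0 (v - q) v (abs_le.mpr ⟨by linarith, by linarith⟩)
      (abs_le.mpr ⟨by linarith, by linarith⟩) (by linarith)
    nlinarith
  · by_cases hqs : q ≤ δ1 / 2
    · have := h1 (v - q) v (abs_le.mpr ⟨by linarith, by linarith⟩)
        (abs_le.mpr ⟨by linarith, by linarith⟩) (by linarith)
      nlinarith
    · push Not at hqs
      have hm' := hm q hqs.le hqq
      have hq1' : q ≤ 1 := by linarith [hθ.1]
      have l1 := (abs_le.mp (hlip (v - q) ⟨hvq, by linarith⟩ (1 - q) ⟨by linarith, by linarith⟩)).1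
      have l2 := (abs_le.mp (hlip v ⟨by linarith, hv⟩ 1 ⟨by linarith, le_rfl⟩)).2
      rw [show v - q - (1 - q) = v - 1 by ring, abs_of_nonpos (by linarith)] at l1
      rw [abs_of_nonpos (by linarith), hf1] at l2
      have h5 : C * (1 - v) ≤ m0 / 4 := by
        have : 1 - v ≤ m0 / (4 * C) := by linarith
        rw [le_div_iff₀ (by positivity)] at this
        linarith
      nlinarith

/-- Solutions with values in `[0,1]`. -/
def AuxSol (J f : ℝ → ℝ) (u : ℝ → ℝ → ℝ) : Prop :=
  (∀ t x, 0 ≤ t → u t x ∈ Set.Icc (0:ℝ) 1) ∧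
  (∀ t, 0 ≤ t → Measurable fun x => u t x) ∧
  (∀ x, ContinuousOn (fun t => u t x) (Set.Ici 0)) ∧
  (∀ t x, 0 < t → HasDerivAt (fun s => u s x)
    ((∫ y, J y * u t (x - y)) - u t x + f (u t x)) t)

lemma aux_nonloc (J g : ℝ → ℝ) (M x : ℝ) (hJpos : ∀ x, 0 ≤ J x) (hJint : Integrable J)
    (hJmass : (∫ x, J x) = 1)
    (hg : Measurable g) (hM : ∀ x, |g x| ≤ M) :
    (∫ y, J y * (g (x - y) - g x)) = (∫ y, J y * g (x - y)) - g x := by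
  simp_rw [mul_sub]
  rw [integral_sub (aux_int' J g M x hJpos hJint hg hM) (hJint.mul_const _), integral_mul_const,
    hJmass, one_mul]

lemma aux_conv_le (J g : ℝ → ℝ) (M x b : ℝ) (hJpos : ∀ x, 0 ≤ J x) (hJint : Integrable J)
    (hJmass : (∫ x, J x) = 1)
    (hg : Measurable g) (hM : ∀ x, |g x| ≤ M) (hb : ∀ x, g x ≤ b) :
    (∫ y, J y * g (x - y)) ≤ b := by
  have : (∫ y, J y * g (x - y)) ≤ ∫ y, J y * b :=
    integral_mono (aux_int' J g M x hJpos hJint hg hM) (hJint.mul_const _)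
      (fun y => mul_le_mul_of_nonneg_left (hb _) (hJpos y))
  rwa [integral_mul_const, hJmass, one_mul] at this

lemma aux_le_conv (J g : ℝ → ℝ) (M x b : ℝ) (hJpos : ∀ x, 0 ≤ J x) (hJint : Integrable J)
    (hJmass : (∫ x, J x) = 1)
    (hg : Measurable g) (hM : ∀ x, |g x| ≤ M) (hb : ∀ x, b ≤ g x) :
    b ≤ (∫ y, J y * g (x - y)) := by
  have : ∫ y, J y * b ≤ (∫ y, J y * g (x - y)) :=
    integral_mono (hJint.mul_const _) (aux_int' J g M x hJpos hJint hg hM)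
      (fun y => mul_le_mul_of_nonneg_left (hb _) (hJpos y))
  rwa [integral_mul_const, hJmass, one_mul] at this

lemma aux_range (J f u0 : ℝ → ℝ) (u : ℝ → ℝ → ℝ) (hJpos : ∀ x, 0 ≤ J x) (hJint : Integrable J)
    (hJmass : (∫ x, J x) = 1) (hf : ContDiff ℝ 1 f) (hf0 : f 0 = 0) (hf1 : f 1 = 0)
    (hu0 : ∀ x, u0 x ∈ Set.Icc (0:ℝ) 1) (hu : IsBddSol J f u0 u) : AuxSol J f u := by
  obtain ⟨⟨M, hM⟩, hmeas, hcont, hinit, hder⟩ := hu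
  obtain ⟨C, hC, hlip⟩ := aux_lip f hf (max M 1)
  have hM1 : (1:ℝ) ≤ max M 1 := le_max_right _ _
  have hMu : ∀ t x, 0 ≤ t → u t x ∈ Set.Icc (-(max M 1)) (max M 1) := fun t x ht =>
    abs_le.mp ((hM t x ht).trans (le_max_left _ _))
  have hder' : ∀ t x, 0 < t → HasDerivAt (fun s => u s x)
    ((∫ y, J y * u t (x - y)) - u t x + f (u t x)) t := by
    intro t x ht
    have := hder t x ht
    rwa [aux_nonloc J (u t) M x hJpos hJint hJmass (hmeas t ht.le) (fun y => hM t y ht.le)] at this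
  have hge : ∀ t x, 0 ≤ t → -u t x ≤ 0 := by
    apply aux_comparison (fun t x => -u t x) (1 + C) (max M 1) (by positivity) (by positivity)
    · intro t x ht
      linarith [(hMu t x ht).1]
    · exact fun x => (hcont x).neg
    · intro x; simp only [hinit]; linarith [(hu0 x).1]
    · intro t x b ht hb hvb hpos
      refine ⟨_, (hder' t x ht).neg, ?_⟩
      have h1 := aux_le_conv J (u t) M x (-b) hJpos hJint hJmass (hmeas t ht.le)
        (fun y => hM t y ht.le) (fun y => by linarith [hvb y])
      have h2 := (abs_le.mp (hlip (u t x) (hMu t x ht.le) 0 ⟨by linarith, by linarith⟩)).1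
      rw [hf0, sub_zero, sub_zero, abs_of_neg (by linarith)] at h2
      nlinarith [hvb x]
  have hle : ∀ t x, 0 ≤ t → u t x - 1 ≤ 0 := by
    apply aux_comparison (fun t x => u t x - 1) (1 + C) (max M 1) (by positivity) (by positivity)
    · intro t x ht
      linarith [(hMu t x ht).2]
    · exact fun x => (hcont x).sub continuousOn_const
    · intro x; simp only [hinit]; linarith [(hu0 x).2]
    · intro t x b ht hb hvb hpos
      refine ⟨_, (hder' t x ht).sub_const 1, ?_⟩
      have h1 := aux_conv_le J (u t) M x (1 + b) hJpos hJint hJmass (hmeas t ht.le)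
        (fun y => hM t y ht.le) (fun y => by linarith [hvb y])
      have h2 := (abs_le.mp (hlip (u t x) (hMu t x ht.le) 1 ⟨by linarith, by linarith⟩)).2
      rw [hf1, sub_zero, abs_of_pos (by linarith)] at h2
      nlinarith [hvb x]
  exact ⟨fun t x ht => ⟨by linarith [hge t x ht], by linarith [hle t x ht]⟩, hmeas, hcont, hder'⟩

lemma aux_shift (J f : ℝ → ℝ) (u : ℝ → ℝ → ℝ) (hu : AuxSol J f u) (T : ℝ) (hT : 0 ≤ T) :
    AuxSol J f (fun t x => u (t + T) x) := by
  obtain ⟨h1, h2, h3, h4⟩ := hu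
  refine ⟨fun t x ht => h1 _ x (by linarith), fun t ht => h2 _ (by linarith), fun x => ?_,
    fun t x ht => ?_⟩
  · exact (h3 x).comp (f := fun t => t + T) (by fun_prop) (fun t ht => by
      simp only [Set.mem_Ici] at *; linarith)
  · exact (h4 (t + T) x (by linarith)).comp_add_const t T

lemma aux_alg (f : ℝ → ℝ) (C μ δ k c q0 q1 q U1 U2 D1 D2 η z : ℝ)
    (hC : 0 < C) (hμ : 0 < μ) (hk : 0 < k) (hc : 0 < c)
    (hlip : ∀ a ∈ Set.Icc (0:ℝ) 1, ∀ b ∈ Set.Icc (0:ℝ) 1, |f a - f b| ≤ C * |a - b|)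
    (hf1 : f 1 = 0)
    (hend : ∀ v q, 0 ≤ q → q ≤ q0 → 0 ≤ v - q → v ≤ 1 →
      (v ≤ δ ∨ 1 - δ ≤ v) → μ * q ≤ f (v - q) - f v)
    (hU1 : U1 ∈ Set.Icc (0:ℝ) 1) (hU2 : U2 ∈ Set.Icc (0:ℝ) 1)
    (hD1 : 0 ≤ D1) (hD2 : 0 ≤ D2) (hmid : δ ≤ U2 → U2 ≤ 1 - δ → k ≤ D2)
    (hq1 : 0 < q1) (hq : q1 ≤ q) (hq' : q ≤ q0)
    (hη : 1 - U1 ≤ η) (hη2 : 2 * C * η ≤ μ * q1)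
    (hsm : (μ + C) * q1 ≤ c * k / 2)
    (hz : z = c / 2 - (μ + C) / k * (q - q1))
    (hw : 0 ≤ U1 + U2 - 1 - q) :
    z * (D1 + D2) + μ * (q - q1) ≤ c * (D1 + D2) - f U1 - f U2 + f (U1 + U2 - 1 - q) := by
  have hA : 0 ≤ (μ + C) / k * (q - q1) :=
    mul_nonneg (by positivity) (by linarith)
  have l1 := (abs_le.mp (hlip U1 hU1 1 ⟨by norm_num, le_rfl⟩)).2
  rw [hf1, sub_zero, abs_of_nonpos (by linarith [hU1.2])] at l1
  have l2 := (abs_le.mp (hlip (U1 + U2 - 1 - q) ⟨hw, by linarith [hU1.2, hU2.2]⟩ (U2 - q)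
    ⟨by linarith [hU1.2], by linarith [hU2.2]⟩)).1
  rw [show U1 + U2 - 1 - q - (U2 - q) = U1 - 1 by ring, abs_of_nonpos (by linarith [hU1.2])] at l2
  have l3 : C * (1 - U1) ≤ C * η := mul_le_mul_of_nonneg_left hη hC.le
  have d1 : 0 ≤ (c - z) * D1 := mul_nonneg (by linarith) hD1
  have d2 : 0 ≤ (c - z) * D2 := mul_nonneg (by linarith) hD2
  by_cases hcase : U2 ≤ δ ∨ 1 - δ ≤ U2
  · have := hend U2 q (by linarith) hq' (by linarith [hU1.2]) hU2.2 hcase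
    nlinarith
  · push Not at hcase
    have hk2 := hmid hcase.1.le hcase.2.le
    have l4 := (abs_le.mp (hlip U2 hU2 (U2 - q) ⟨by linarith [hU1.2], by linarith [hU2.2]⟩)).2
    rw [show U2 - (U2 - q) = q by ring, abs_of_nonneg (by linarith)] at l4
    have d3 : (c - z) * k ≤ (c - z) * D2 := mul_le_mul_of_nonneg_left hk2 (by linarith)
    have d4 : (c - z) * k = c * k / 2 + (μ + C) * (q - q1) := by
      rw [hz]; field_simp; ring
    nlinarith

lemma aux_prop (J f U : ℝ → ℝ) (θ c : ℝ)
    (hJC1 : ContDiff ℝ 1 J) (hJpos : ∀ x, 0 ≤ J x) (hJeven : ∀ x, J (-x) = J x)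
    (hJint : Integrable J) (hJmass : (∫ x, J x) = 1)
    (hθ : θ ∈ Set.Ioo (0:ℝ) 1)
    (hfC1 : ContDiff ℝ 1 f) (hf1 : f 1 = 0)
    (hfpos : ∀ u ∈ Set.Ioo θ 1, 0 < f u)
    (hf'0 : deriv f 0 < 0) (hf'1 : deriv f 1 < 0)
    (hc : 0 < c)
    (hUmono : StrictMono U) (hUdiff : Differentiable ℝ U)
    (hU01 : ∀ x, U x ∈ Set.Icc (0:ℝ) 1)
    (hUbot : Tendsto U atBot (nhds 0))
    (hUtop : Tendsto U atTop (nhds 1))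
    (hTW : ∀ x, (∫ y, J y * U (x - y)) - U x - c * deriv U x + f (U x) = 0)
    (h e : ℝ) (hh : h ∈ Set.Ioo θ 1) (he : 0 < e) :
    ∃ L, 0 < L ∧ ∀ u, AuxSol J f u → (∀ x ∈ Set.Ioo (-L) L, h ≤ u 0 x) →
      ∀ R, ∃ T, 0 ≤ T ∧ ∀ t, T ≤ t → ∀ x, |x| ≤ R → 1 - e < u t x := by
  have hUc : Continuous U := hUdiff.continuous
  have hUb : ∀ x, |U x| ≤ 1 := fun x => abs_le.mpr ⟨by linarith [(hU01 x).1], (hU01 x).2⟩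
  have hDpos : ∀ x, 0 < deriv U x := aux_Upos J f U c hJC1.continuous hJpos hJint hJmass hfC1
    hUmono hUdiff hU01 hc hTW
  have hDc := aux_Ucont J f U c hJpos hJint hfC1.continuous hUdiff hU01 hc hTW
  obtain ⟨C, hC, hlip'⟩ := aux_lip f hfC1 1
  have hlip : ∀ a ∈ Set.Icc (0:ℝ) 1, ∀ b ∈ Set.Icc (0:ℝ) 1, |f a - f b| ≤ C * |a - b| :=
    fun a ha b hb => hlip' a ⟨by linarith [ha.1], ha.2⟩ b ⟨by linarith [hb.1], hb.2⟩
  obtain ⟨q0, hq0⟩ : ∃ q0, q0 = 1 - h := ⟨_, rfl⟩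
  have hq0pos : 0 < q0 := by linarith [hh.2]
  obtain ⟨μ, δ, hμ, hδ, hend⟩ := aux_end f θ C q0 hθ hfC1 hfpos hf'0 hf'1 (by linarith [hh.1]) hC
    hlip hf1
  obtain ⟨k, hk, hmid⟩ := aux_Uk U hDc hDpos hUbot hUtop δ hδ
  obtain ⟨q1, hq1⟩ : ∃ q1, q1 = min (e / 2) (min q0 (c * k / (2 * (μ + C)))) := ⟨_, rfl⟩
  have hq1pos : 0 < q1 := by rw [hq1]; positivity
  have hq1e : q1 ≤ e / 2 := hq1 ▸ min_le_left _ _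
  have hq1q0 : q1 ≤ q0 := hq1 ▸ (min_le_right _ _).trans (min_le_left _ _)
  have hsm : (μ + C) * q1 ≤ c * k / 2 := by
    have : q1 ≤ c * k / (2 * (μ + C)) := hq1 ▸ (min_le_right _ _).trans (min_le_right _ _)
    rw [le_div_iff₀ (by positivity)] at this
    linarith
  obtain ⟨η, hη⟩ : ∃ η, η = μ * q1 / (2 * C) := ⟨_, rfl⟩
  have hηpos : 0 < η := by rw [hη]; positivity
  have hη2 : 2 * C * η ≤ μ * q1 := by rw [hη]; field_simp; rfl
  obtain ⟨zm, hzm⟩ := (hUtop.eventually (lt_mem_nhds (sub_lt_self 1 hηpos))).exists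
  obtain ⟨A, hA⟩ : ∃ A, A = (μ + C) / k := ⟨_, rfl⟩
  have hApos : 0 < A := by rw [hA]; positivity
  have hAq : 0 ≤ A * (q0 - q1) / μ :=
    div_nonneg (mul_nonneg hApos.le (by linarith)) hμ.le
  obtain ⟨z0, hz0⟩ : ∃ z0, z0 = zm + A * (q0 - q1) / μ := ⟨_, rfl⟩
  obtain ⟨a, ha⟩ := (hUbot.eventually (gt_mem_nhds hq0pos)).exists
  obtain ⟨L, hL⟩ : ∃ L, L = max 1 (z0 - a) := ⟨_, rfl⟩
  obtain ⟨q, hqdef⟩ : ∃ q : ℝ → ℝ, q = fun t => q1 + (q0 - q1) * Real.exp (-μ * t) := ⟨_, rfl⟩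
  obtain ⟨z, hzdef⟩ : ∃ z : ℝ → ℝ, z = fun t => z0 + c / 2 * t
    - A * (q0 - q1) / μ * (1 - Real.exp (-μ * t)) := ⟨_, rfl⟩
  have hexp : ∀ t, HasDerivAt (fun t => Real.exp (-μ * t)) (Real.exp (-μ * t) * (-μ)) t := by
    intro t
    have := ((hasDerivAt_id t).const_mul (-μ)).exp
    simpa using this
  have hqd : ∀ t, HasDerivAt q (-(μ * (q t - q1))) t := by
    intro t
    have := ((hexp t).const_mul (q0 - q1)).const_add q1
    rw [hqdef]
    refine this.congr_deriv ?_
    ring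
  have hzd : ∀ t, HasDerivAt z (c / 2 - (μ + C) / k * (q t - q1)) t := by
    intro t
    have := (((hasDerivAt_id t).const_mul (c / 2)).const_add z0).sub
      (((hexp t).const_sub 1).const_mul (A * (q0 - q1) / μ))
    rw [hzdef, ← hA, hqdef]
    refine this.congr_deriv ?_
    field_simp
    ring
  have hexp1 : ∀ t, 0 ≤ t → Real.exp (-μ * t) ≤ 1 := fun t ht =>
    Real.exp_le_one_iff.mpr (by nlinarith)
  have hqge : ∀ t, q1 ≤ q t := by
    intro t
    have := mul_nonneg (sub_nonneg.mpr hq1q0) (Real.exp_pos (-μ * t)).le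
    rw [hqdef]; simp only; linarith
  have hqle : ∀ t, 0 ≤ t → q t ≤ q0 := by
    intro t ht
    have := mul_le_mul_of_nonneg_left (hexp1 t ht) (sub_nonneg.mpr hq1q0)
    rw [hqdef]; simp only; linarith
  have hzge : ∀ t, z0 + c / 2 * t - A * (q0 - q1) / μ ≤ z t := by
    intro t
    have := mul_nonneg hAq (Real.exp_pos (-μ * t)).le
    rw [hzdef]; simp only; linarith
  have hzzm : ∀ t, 0 ≤ t → zm ≤ z t := by
    intro t ht
    have := hzge t
    have h2 : 0 ≤ c / 2 * t := by positivity
    linarith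
  have hq00 : q 0 = q0 := by rw [hqdef]; simp
  have hz00 : z 0 = z0 := by rw [hzdef]; simp
  have hqlim : Tendsto q atTop (nhds q1) := by
    have h1 : Tendsto (fun t => Real.exp (-μ * t)) atTop (nhds 0) :=
      Real.tendsto_exp_atBot.comp (tendsto_id.const_mul_atTop_of_neg (by linarith))
    have := (h1.const_mul (q0 - q1)).const_add q1
    rw [hqdef]; simpa using this
  have hzlim : Tendsto z atTop atTop := by
    refine tendsto_atTop_mono hzge ?_
    apply tendsto_atTop_add_const_right
    apply tendsto_atTop_add_const_left
    exact tendsto_id.const_mul_atTop (by positivity)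
  refine ⟨L, by rw [hL]; positivity, fun u hu hinit => ?_⟩
  obtain ⟨hu01, humeas, hucont, huder⟩ := hu
  have hub : ∀ t x, 0 ≤ t → |u t x| ≤ 1 := fun t x ht =>
    abs_le.mpr ⟨by linarith [(hu01 t x ht).1], (hu01 t x ht).2⟩
  have hcmp : ∀ t x, 0 ≤ t → U (x + z t) + U (-x + z t) - 1 - q t - u t x ≤ 0 := by
    apply aux_comparison (fun t x => U (x + z t) + U (-x + z t) - 1 - q t - u t x) (1 + C) 1
      (by positivity) (by positivity)
    · intro t x ht
      have := hqge t
      linarith [(hU01 (x + z t)).2, (hU01 (-x + z t)).2, (hu01 t x ht).1]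
    · intro x
      have hzc : Continuous z := continuous_iff_continuousAt.mpr fun t => (hzd t).continuousAt
      have hqc : Continuous q := continuous_iff_continuousAt.mpr fun t => (hqd t).continuousAt
      refine ContinuousOn.sub (Continuous.continuousOn ?_) (hucont x)
      fun_prop
    · intro x
      simp only [hq00, hz00]
      by_cases hx : x ∈ Set.Ioo (-L) L
      · linarith [hinit x hx, (hU01 (x + z0)).2, (hU01 (-x + z0)).2]
      · have hu0 := (hu01 0 x le_rfl).1
        have hLa : z0 - a ≤ L := hL ▸ le_max_right _ _
        rcases le_or_gt L x with h1 | h1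
        · have : U (-x + z0) ≤ U a := hUmono.monotone (by linarith)
          linarith [(hU01 (x + z0)).2]
        · have h2 : x ≤ -L := by
            by_contra! h3; exact hx ⟨h3, h1⟩
          have : U (x + z0) ≤ U a := hUmono.monotone (by linarith)
          linarith [(hU01 (-x + z0)).2]
    · intro t x b ht hb hvb hpos
      have hut := hu01 t x ht.le
      have hder : HasDerivAt (fun s => U (x + z s) + U (-x + z s) - 1 - q s - u s x)
          (deriv U (x + z t) * (c / 2 - (μ + C) / k * (q t - q1))
            + deriv U (-x + z t) * (c / 2 - (μ + C) / k * (q t - q1))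
            - -(μ * (q t - q1)) - ((∫ y, J y * u t (x - y)) - u t x + f (u t x))) t := by
        have e1 := (hUdiff (x + z t)).hasDerivAt.comp t ((hzd t).const_add x)
        have e2 := (hUdiff (-x + z t)).hasDerivAt.comp t ((hzd t).const_add (-x))
        exact (((e1.add e2).sub_const 1).sub (hqd t)).sub (huder t x ht)
      refine ⟨_, hder, ?_⟩
      have halg : (c / 2 - (μ + C) / k * (q t - q1)) *
          (deriv U (x + z t) + deriv U (-x + z t)) + μ * (q t - q1) ≤
          c * (deriv U (x + z t) + deriv U (-x + z t)) - f (U (x + z t)) - f (U (-x + z t))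
          + f (U (x + z t) + U (-x + z t) - 1 - q t) := by
        rcases le_total 0 x with hx | hx
        · exact aux_alg f C μ δ k c q0 q1 (q t) (U (x + z t)) (U (-x + z t)) _ _ η _ hC hμ hk hc
            hlip hf1 hend (hU01 _) (hU01 _) (hDpos _).le (hDpos _).le (hmid _) hq1pos (hqge t)
            (hqle t ht.le) (by
              have : U zm ≤ U (x + z t) := hUmono.monotone (by linarith [hzzm t ht.le])
              linarith) hη2 hsm rfl (by linarith [hut.1])
        · have := aux_alg f C μ δ k c q0 q1 (q t) (U (-x + z t)) (U (x + z t)) (deriv U (-x + z t))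
            (deriv U (x + z t)) η _ hC hμ hk hc
            hlip hf1 hend (hU01 _) (hU01 _) (hDpos _).le (hDpos _).le (hmid _) hq1pos (hqge t)
            (hqle t ht.le) (by
              have : U zm ≤ U (-x + z t) := hUmono.monotone (by linarith [hzzm t ht.le])
              linarith) hη2 hsm rfl (by linarith [hut.1])
          rw [add_comm (U (-x + z t)) (U (x + z t))] at this
          linarith
      have tw1 := hTW (x + z t)
      have tw2 := hTW (-x + z t)
      have i1 := aux_int' J U 1 (x + z t) hJpos hJint hUc.measurable hUb
      have i2 := aux_int' J U 1 (-x + z t) hJpos hJint hUc.measurable hUb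
      have i2' : Integrable (fun y => J y * U (-x + z t + y)) :=
        aux_int J (fun y => U (-x + z t + y)) 1 hJpos hJint
          (hUc.measurable.comp (measurable_const.add measurable_id)) (fun y => hUb _)
      have i3 := aux_int' J (u t) 1 x hJpos hJint (humeas t ht.le) (fun y => hub t y ht.le)
      have i4 : Integrable (fun y => J y * (1 + q t)) := hJint.mul_const _
      have hflip : ∫ y, J y * U (-x + z t + y) = ∫ y, J y * U (-x + z t - y) := by
        rw [← integral_neg_eq_self]
        simp_rw [hJeven, ← sub_eq_add_neg]
      have hI : (∫ y, J y * U (x + z t - y)) + (∫ y, J y * U (-x + z t - y)) - (1 + q t)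
          - (∫ y, J y * u t (x - y)) ≤ b := by
        have hm : (∫ y, (J y * U (x + z t - y) + J y * U (-x + z t + y) - J y * (1 + q t)
          - J y * u t (x - y))) ≤ ∫ y, J y * b := by
          refine integral_mono (((i1.add i2').sub i4).sub i3) (hJint.mul_const b) fun y => ?_
          have := mul_le_mul_of_nonneg_left (hvb (x - y)) (hJpos y)
          rw [show x - y + z t = x + z t - y by ring, show -(x - y) + z t = -x + z t + y by ring]
            at this
          simp only
          linarith
        have j1 : Integrable (fun y => J y * U (x + z t - y) + J y * U (-x + z t + y)) :=
          i1.add i2'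
        have j2 : Integrable (fun y => J y * U (x + z t - y) + J y * U (-x + z t + y)
            - J y * (1 + q t)) := j1.sub i4
        rw [integral_mul_const, hJmass, one_mul, integral_sub j2 i3,
          integral_sub j1 i4, integral_add i1 i2', hflip, integral_mul_const,
          hJmass, one_mul] at hm
        exact hm
      have hqt := hqge t
      have l1 := (abs_le.mp (hlip (U (x + z t) + U (-x + z t) - 1 - q t)
        ⟨by linarith [hut.1], by linarith [(hU01 (x + z t)).2, (hU01 (-x + z t)).2]⟩
        (u t x) hut)).2
      rw [abs_of_pos hpos] at l1
      have l2 := mul_le_mul_of_nonneg_left (hvb x) hC.le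
      nlinarith
  intro R
  have hlim : Tendsto (fun t => 2 * U (z t + -R) - 1 - q t) atTop (nhds (2 * 1 - 1 - q1)) :=
    (((hUtop.comp (tendsto_atTop_add_const_right _ (-R) hzlim)).const_mul 2).sub_const 1).sub hqlim
  obtain ⟨T, hT⟩ := eventually_atTop.mp
    (hlim.eventually (lt_mem_nhds (show 1 - e < 2 * 1 - 1 - q1 by linarith)))
  refine ⟨max T 0, le_max_right _ _, fun t ht x hx => ?_⟩
  have h1 := hT t ((le_max_left _ _).trans ht)
  have h2 := hcmp t x ((le_max_right _ _).trans ht)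
  have hx' := abs_le.mp hx
  have m1 : U (z t + -R) ≤ U (x + z t) := hUmono.monotone (by linarith)
  have m2 : U (z t + -R) ≤ U (-x + z t) := hUmono.monotone (by linarith)
  linarith

/-- **Theorem (Propagation threshold).** Let `J ∈ C¹` be nonnegative, even, of mass 1, with
`J' ∈ L¹` and a finite first moment; let `f ∈ C¹` be bistable with `f'(0) < 0`, `f'(1) < 0`
and `∫₀¹ f > 0`.  If there exists an increasing traveling wave `(c, U)` with speed `c > 0`,
then for each `ε ∈ (0, 1-θ]` there is `L > 0` such that the solution starting from
`(θ+ε) 1_{(-L,L)}` propagates (converges to 1 locally uniformly). -/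
theorem propagation_threshold
    (J f U : ℝ → ℝ) (θ c : ℝ)
    (hJC1 : ContDiff ℝ 1 J) (hJpos : ∀ x, 0 ≤ J x) (hJeven : ∀ x, J (-x) = J x)
    (hJint : Integrable J) (hJmass : (∫ x, J x) = 1)
    (hJ' : Integrable (deriv J))
    (hJmom : Integrable (fun y => |y| * J y))
    (hθ : θ ∈ Set.Ioo (0:ℝ) 1)
    (hfC1 : ContDiff ℝ 1 f)
    (hf0 : f 0 = 0) (hfθ : f θ = 0) (hf1 : f 1 = 0)
    (hfneg : ∀ u ∈ Set.Ioo 0 θ, f u < 0)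
    (hfpos : ∀ u ∈ Set.Ioo θ 1, 0 < f u)
    (hf'0 : deriv f 0 < 0) (hf'1 : deriv f 1 < 0)
    (hfint : 0 < ∫ u in (0:ℝ)..1, f u)
    (hc : 0 < c)
    (hUmono : StrictMono U) (hUdiff : Differentiable ℝ U)
    (hU01 : ∀ x, U x ∈ Set.Icc (0:ℝ) 1)
    (hUbot : Tendsto U atBot (nhds 0))
    (hUtop : Tendsto U atTop (nhds 1))
    (hTW : ∀ x, (∫ y, J y * U (x - y)) - U x - c * deriv U x + f (U x) = 0) :
    ∀ ε, 0 < ε → ε ≤ 1 - θ → ∃ L, 0 < L ∧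
      ∀ u, IsBddSol J f (stepInit (θ + ε) L) u → Propagates u := by
  intro ε hε hε1
  have hP := aux_prop J f U θ c hJC1 hJpos hJeven hJint hJmass hθ hfC1 hf1 hfpos hf'0 hf'1 hc
    hUmono hUdiff hU01 hUbot hUtop hTW
  have hθ1 := hθ.1
  have hθ2 := hθ.2
  obtain ⟨L, hL, hP1⟩ := hP (θ + ε / 2) ((1 - θ) / 2) ⟨by linarith, by linarith⟩ (by linarith)
  refine ⟨L, hL, fun u hu => ?_⟩
  have hsol : AuxSol J f u := by
    refine aux_range J f _ u hJpos hJint hJmass hfC1 hf0 hf1 (fun x => ?_) hu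
    unfold stepInit
    by_cases hx : x ∈ Set.Ioo (-L) L
    · rw [Set.indicator_of_mem hx]; exact ⟨by linarith, by linarith⟩
    · rw [Set.indicator_of_notMem hx]; exact ⟨le_rfl, zero_le_one⟩
  have hstep1 := hP1 u hsol (fun x hx => by
    rw [hu.2.2.2.1 x, stepInit, Set.indicator_of_mem hx]; linarith)
  unfold Propagates
  rw [Metric.tendstoLocallyUniformly_iff]
  intro e he x0
  refine ⟨Metric.ball x0 1, Metric.ball_mem_nhds x0 one_pos, ?_⟩
  obtain ⟨L2, hL2, hP2⟩ := hP (1 - (1 - θ) / 2) e ⟨by linarith, by linarith⟩ he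
  obtain ⟨T1, hT1, hu1⟩ := hstep1 L2
  obtain ⟨T2, hT2, hu2⟩ := hP2 _ (aux_shift J f u hsol T1 hT1) (fun x hx => by
    rw [zero_add]
    exact (hu1 T1 le_rfl x (abs_le.mpr ⟨hx.1.le, hx.2.le⟩)).le) (|x0| + 1)
  filter_upwards [eventually_ge_atTop (T1 + T2)] with t ht x hx
  have hxb : |x| ≤ |x0| + 1 := by
    rw [Metric.mem_ball, Real.dist_eq] at hx
    have := abs_add_le (x - x0) x0
    rw [sub_add_cancel] at this
    linarith
  have h1 := hu2 (t - T1) (by linarith) x hxb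
  rw [sub_add_cancel] at h1
  have h2 := (hsol.1 t x (by linarith)).2
  rw [Real.dist_eq, abs_of_nonneg (by linarith)]
  linarith
end
end

section
/- Let J : ℝ → ℝ be nonnegative and integrable with ∫_ℝ J(x) dx = 1, and define ψ(t,x) := e^{−t} ∑_{i=1}^∞ (t^i/i!) · J^{*(i)}(x). Then the map t ↦ ψ(t,·) is continuously differentiable from [0,∞) into L¹(ℝ), and for every t ≥ 0 its derivative equals J ∗ ψ(t,·) − ψ(t,·) + e^{−t} J in L¹(ℝ); equivalently, for almost every x ∈ ℝ, ∂_t ψ(t,x) = (J ∗ ψ(t,·))(x) − ψ(t,x) + e^{−t} J(x). -/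
open MeasureTheory Filter Set Asymptotics

noncomputable section

/-- `psiFun J t x = e^{-t} ∑_{i≥1} (tⁱ/i!) J^{*(i)}(x)`. -/
def psiFun (J : ℝ → ℝ) (t x : ℝ) : ℝ :=
  Real.exp (-t) * ∑' n : ℕ, t ^ (n + 1) / (Nat.factorial (n + 1) : ℝ) * convIter J n x

lemma pw_summable (E : Type*) [NormedAddCommGroup E] [NormedSpace ℝ E]
    (a : ℕ → E) (ha : ∀ n, ‖a n‖ ≤ 1) (t : ℝ) (k : ℕ) :
    Summable fun n : ℕ => ‖(t ^ (n + k) / (Nat.factorial (n + k) : ℝ)) • a n‖ := by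
  have h := ((summable_nat_add_iff k).2 (Real.summable_pow_div_factorial |t|))
  refine Summable.of_nonneg_of_le (fun _ => norm_nonneg _) (fun n => ?_) h
  rw [norm_smul, Real.norm_eq_abs, abs_div, abs_pow, Nat.abs_cast]
  exact mul_le_of_le_one_right (by positivity) (ha n)

lemma pw_hasDeriv {E : Type*} [NormedAddCommGroup E] [NormedSpace ℝ E] [CompleteSpace E]
    (a : ℕ → E) (ha : ∀ n, ‖a n‖ ≤ 1) (t : ℝ) :
    HasDerivAt (fun t : ℝ => ∑' n : ℕ, (t ^ (n + 1) / (Nat.factorial (n + 1) : ℝ)) • a n)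
      (∑' n : ℕ, (t ^ n / (Nat.factorial n : ℝ)) • a n) t := by
  have ht : t ∈ Metric.ball (0:ℝ) (|t| + 1) := by simp
  refine hasDerivAt_tsum_of_isPreconnected
    (u := fun n : ℕ => (|t| + 1) ^ n / (Nat.factorial n : ℝ))
    (g' := fun n y => (y ^ n / (Nat.factorial n : ℝ)) • a n)
    (Real.summable_pow_div_factorial _) Metric.isOpen_ball
    (convex_ball (0:ℝ) (|t| + 1)).isPreconnected ?_ ?_ ht ?_ ht
  · intro n y _
    have h := ((hasDerivAt_pow (n + 1) y).div_const (Nat.factorial (n + 1) : ℝ)).smul_const (a n)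
    convert h using 2
    have : (Nat.factorial n : ℝ) ≠ 0 := by positivity
    have : (n : ℝ) + 1 ≠ 0 := by positivity
    rw [Nat.factorial_succ]
    push_cast
    field_simp
  · intro n y hy
    have hy' : |y| ≤ |t| + 1 := by
      simpa using (mem_ball_zero_iff.1 hy).le
    rw [norm_smul, Real.norm_eq_abs, abs_div, abs_pow, Nat.abs_cast]
    refine (mul_le_of_le_one_right (by positivity) (ha n)).trans ?_
    gcongr
  · exact (pw_summable E a ha t 1).of_norm

lemma pw_split {E : Type*} [NormedAddCommGroup E] [NormedSpace ℝ E] [CompleteSpace E]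
    (a : ℕ → E) (ha : ∀ n, ‖a n‖ ≤ 1) (t : ℝ) :
    ∑' n : ℕ, (t ^ n / (Nat.factorial n : ℝ)) • a n
      = a 0 + ∑' n : ℕ, (t ^ (n + 1) / (Nat.factorial (n + 1) : ℝ)) • a (n + 1) := by
  have h := (pw_summable E a ha t 0).of_norm
  simp only [Nat.add_zero] at h
  rw [h.tsum_eq_zero_add]
  simp

lemma convIter_nonneg (J : ℝ → ℝ) (hJ : ∀ x, 0 ≤ J x) (n : ℕ) : ∀ x, 0 ≤ convIter J n x := by
  induction n with
  | zero => exact hJ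
  | succ n ih => exact fun x => integral_nonneg fun y => mul_nonneg (hJ y) (ih _)

lemma convIter_succ_eq (J : ℝ → ℝ) (n : ℕ) : convIter J (n + 1) =
    convolution J (convIter J n) (ContinuousLinearMap.mul ℝ ℝ) volume := by
  ext x
  simp [convIter, convolution_def]

lemma convIter_integrable (J : ℝ → ℝ) (hJ : Integrable J) (n : ℕ) :
    Integrable (convIter J n) := by
  induction n with
  | zero => exact hJ
  | succ n ih =>
    rw [convIter_succ_eq]
    exact hJ.integrable_convolution _ ih

lemma convIter_mass (J : ℝ → ℝ) (hJ : Integrable J) (h1 : (∫ x, J x) = 1) (n : ℕ) :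
    ∫ x, convIter J n x = 1 := by
  induction n with
  | zero => exact h1
  | succ n ih =>
    rw [convIter_succ_eq, integral_convolution _ hJ (convIter_integrable J hJ n), ih, h1]
    simp

lemma ae_hasSum_aux (c : ℕ → ℝ → ℝ) (hc : ∀ n, Integrable (c n) (volume : Measure ℝ))
    (hn : ∀ n, ‖(hc n).toL1 (c n)‖ ≤ 1) (t : ℝ) (k : ℕ) :
    ∀ᵐ x, HasSum (fun n : ℕ => t ^ (n + k) / (Nat.factorial (n + k) : ℝ) * c n x)
      ((∑' n : ℕ, (t ^ (n + k) / (Nat.factorial (n + k) : ℝ)) • (hc n).toL1 (c n) :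
        Lp ℝ 1 (volume : Measure ℝ)) x) := by
  have h1 := pw_summable _ (fun n => (hc n).toL1 (c n)) hn t k
  have h2 := Lp.hasSum_coeFn_tsum (tsum_enorm_ne_top_iff_summable_norm.2 h1)
  have h3 : ∀ᵐ x, ∀ n, ((t ^ (n + k) / (Nat.factorial (n + k) : ℝ)) • (hc n).toL1 (c n) :
        Lp ℝ 1 (volume : Measure ℝ)) x = t ^ (n + k) / (Nat.factorial (n + k) : ℝ) * c n x := by
    rw [ae_all_iff]
    intro n
    filter_upwards [Lp.coeFn_smul (t ^ (n + k) / (Nat.factorial (n + k) : ℝ)) ((hc n).toL1 (c n)),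
      (hc n).coeFn_toL1] with x hx hx'
    rw [hx, Pi.smul_apply, hx', smul_eq_mul]
  filter_upwards [h2, h3] with x hx hx'
  simpa only [hx'] using hx

/-- For `J` nonnegative, integrable of mass 1, the map `t ↦ ψ(t,·)` is `C¹` from `[0,∞)` into
`L¹(ℝ)`: there are `Ψ, D : ℝ → L¹(ℝ)` with `Ψ t` representing `ψ(t,·)`, `Ψ` differentiable on
`[0,∞)` with derivative `D t` there, `D` continuous on `[0,∞)`, and for every `t ≥ 0` the
derivative satisfies `D t = J ∗ ψ(t,·) - ψ(t,·) + e^{-t} J` almost everywhere. -/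
theorem psi_C1_into_L1
    (J : ℝ → ℝ)
    (hJpos : ∀ x, 0 ≤ J x) (hJint : Integrable J) (hJmass : (∫ x, J x) = 1) :
    ∃ Ψ D : ℝ → Lp ℝ 1 (volume : Measure ℝ),
      (∀ t, 0 ≤ t → (Ψ t : ℝ → ℝ) =ᵐ[volume] psiFun J t) ∧
      (∀ t ∈ Set.Ici (0:ℝ), HasDerivWithinAt Ψ (D t) (Set.Ici 0) t) ∧
      ContinuousOn D (Set.Ici 0) ∧
      (∀ t, 0 ≤ t → (D t : ℝ → ℝ) =ᵐ[volume]
        fun x => (∫ y, J y * psiFun J t (x - y)) - psiFun J t x + Real.exp (-t) * J x) := by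
  have hci := convIter_integrable J hJint
  have hnorm : ∀ n, ‖(hci n).toL1 (convIter J n)‖ ≤ 1 := by
    intro n
    rw [L1.norm_eq_integral_norm, ← convIter_mass J hJint hJmass n]
    refine le_of_eq (integral_congr_ae ?_)
    filter_upwards [(hci n).coeFn_toL1] with x hx
    rw [hx, Real.norm_eq_abs, abs_of_nonneg (convIter_nonneg J hJpos n x)]
  set a : ℕ → Lp ℝ 1 (volume : Measure ℝ) := fun n => (hci n).toL1 (convIter J n) with ha
  let P : ℝ → Lp ℝ 1 (volume : Measure ℝ) := fun t =>
    ∑' n : ℕ, (t ^ (n + 1) / (Nat.factorial (n + 1) : ℝ)) • a n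
  let R : ℝ → Lp ℝ 1 (volume : Measure ℝ) := fun t =>
    ∑' n : ℕ, (t ^ (n + 1) / (Nat.factorial (n + 1) : ℝ)) • a (n + 1)
  have hP : ∀ t, HasDerivAt P (a 0 + R t) t := by
    intro t
    have := pw_hasDeriv a hnorm t
    rwa [pw_split a hnorm t] at this
  have hR : Continuous R := continuous_iff_continuousAt.2 fun t =>
    (pw_hasDeriv (fun n => a (n + 1)) (fun n => hnorm (n + 1)) t).continuousAt
  have hPc : Continuous P := continuous_iff_continuousAt.2 fun t => (hP t).continuousAt
  have hPae : ∀ t, ∀ᵐ x, HasSum (fun n : ℕ => t ^ (n + 1) / (Nat.factorial (n + 1) : ℝ)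
      * convIter J n x) (P t x) := fun t => ae_hasSum_aux (convIter J) hci hnorm t 1
  have hRae : ∀ t, ∀ᵐ x, HasSum (fun n : ℕ => t ^ (n + 1) / (Nat.factorial (n + 1) : ℝ)
      * convIter J (n + 1) x) (R t x) := fun t =>
    ae_hasSum_aux (fun n => convIter J (n + 1)) (fun n => hci (n + 1))
      (fun n => hnorm (n + 1)) t 1
  refine ⟨fun t => Real.exp (-t) • P t,
    fun t => Real.exp (-t) • (a 0 + R t) + (-Real.exp (-t)) • P t, ?_, ?_, ?_, ?_⟩
  · intro t _
    filter_upwards [hPae t, Lp.coeFn_smul (Real.exp (-t)) (P t)] with x hx hx'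
    rw [hx', Pi.smul_apply, psiFun, hx.tsum_eq, smul_eq_mul]
  · intro t _
    have he : HasDerivAt (fun t : ℝ => Real.exp (-t)) (-Real.exp (-t)) t := by
      simpa using (hasDerivAt_neg t).exp
    exact (he.smul (hP t)).hasDerivWithinAt
  · apply Continuous.continuousOn
    fun_prop
  · intro t ht
    have hex : ∀ᵐ x, ∀ n, Integrable fun y => J y * convIter J n (x - y) := by
      rw [ae_all_iff]
      intro n
      filter_upwards [hJint.ae_convolution_exists (ContinuousLinearMap.mul ℝ ℝ) (hci n)]
        with x hx
      simpa [ConvolutionExistsAt] using hx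
    filter_upwards [hPae t, hRae t, hex, (hci 0).coeFn_toL1,
      Lp.coeFn_add (Real.exp (-t) • (a 0 + R t)) ((-Real.exp (-t)) • P t),
      Lp.coeFn_smul (Real.exp (-t)) (a 0 + R t), Lp.coeFn_smul (-Real.exp (-t)) (P t),
      Lp.coeFn_add (a 0) (R t)] with x h1 h2 h3 h4 h5 h6 h7 h8
    have hint : (∫ y, J y * psiFun J t (x - y)) = Real.exp (-t) * R t x := by
      have hq : ∀ n : ℕ, (∫ y, t ^ (n + 1) / (Nat.factorial (n + 1) : ℝ) *
          (J y * convIter J n (x - y))) =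
          t ^ (n + 1) / (Nat.factorial (n + 1) : ℝ) * convIter J (n + 1) x := by
        intro n
        rw [integral_const_mul]
        rfl
      have key := integral_tsum_of_summable_integral_norm
        (F := fun (n : ℕ) y => t ^ (n + 1) / (Nat.factorial (n + 1) : ℝ) *
          (J y * convIter J n (x - y))) (fun n => (h3 n).const_mul _) (by
          refine h2.summable.congr fun n => ?_
          rw [← hq n]
          refine integral_congr_ae (Eventually.of_forall fun y => ?_)
          have h0 := convIter_nonneg J hJpos n (x - y)
          have h0' := hJpos y
          exact (Real.norm_of_nonneg (by positivity)).symm)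
      simp_rw [hq] at key
      rw [h2.tsum_eq] at key
      rw [key, ← integral_const_mul]
      congr 1
      ext y
      rw [psiFun, mul_left_comm, ← tsum_mul_left]
      congr 2
      ext n
      ring
    have hpsi : psiFun J t x = Real.exp (-t) * P t x := by rw [psiFun, h1.tsum_eq]
    have h4' : (a 0 : ℝ → ℝ) x = J x := h4
    rw [h5, Pi.add_apply, h6, h7, Pi.smul_apply, Pi.smul_apply, h8, Pi.add_apply, hint, hpsi, h4']
    simp only [smul_eq_mul]
    ring
end
end
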